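/- For every real y > 0, set q := e^{−2πy} ∈ (0,1). Then the three-banana Feynman integral evaluated at t(iy) (which is a negative real number, hence < 16) satisfies I(t(iy)) = ϖ₁(iy) · ( 16ζ(3) + ∑_{n≥1} (ψ(n)/n³)·qⁿ/(1−qⁿ) + 32π³y³ ). -/

import Mathlib

open MeasureTheory

/-- The equal-mass three-banana Feynman integral
`I(t) = ∫_{(0,∞)³} ((1+x+y+z)(1+1/x+1/y+1/z) − t)⁻¹ dx dy dz/(xyz)`. -/
noncomputable def bananaI (t : ℝ) : ℝ :=
  ∫ p in Set.Ioi (0:ℝ) ×ˢ (Set.Ioi (0:ℝ) ×ˢ Set.Ioi (0:ℝ)),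
    ((1 + p.1 + p.2.1 + p.2.2) * (1 + 1/p.1 + 1/p.2.1 + 1/p.2.2) - t)⁻¹ /
      (p.1 * p.2.1 * p.2.2)

/-- The Dedekind eta function `η(τ) = exp(πiτ/12)·∏_{n≥1}(1 − exp(2πinτ))`. -/
noncomputable def dedekindEta (τ : ℂ) : ℂ :=
  Complex.exp (Real.pi * Complex.I * τ / 12) *
    ∏' n : ℕ, (1 - Complex.exp (2 * Real.pi * Complex.I * ((n:ℂ)+1) * τ))

/-- The Hauptmodul `t(τ) = −(η(τ)η(3τ)/(η(2τ)η(6τ)))⁶` for `Γ₁(6)^{+3}`. -/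
noncomputable def tHaupt (τ : ℂ) : ℂ :=
  -((dedekindEta τ * dedekindEta (3*τ)) / (dedekindEta (2*τ) * dedekindEta (6*τ)))^6

/-- The holomorphic period `ϖ₁(τ) = (η(2τ)η(6τ))⁴/(η(τ)η(3τ))²`. -/
noncomputable def varpi1 (τ : ℂ) : ℂ :=
  (dedekindEta (2*τ) * dedekindEta (6*τ))^4 / (dedekindEta τ * dedekindEta (3*τ))^2

/-- The even mod-6 character `ψ` with `ψ(1)=ψ(5)=−48`, `ψ(2)=ψ(4)=720`,
`ψ(3)=384`, `ψ(6)=−5760` (6-periodic). -/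
def psi (n : ℕ) : ℤ :=
  if n % 6 = 1 then -48 else if n % 6 = 2 then 720 else if n % 6 = 3 then 384
  else if n % 6 = 4 then 720 else if n % 6 = 5 then -48 else -5760

/-- `ζ(3) = ∑_{k≥1} 1/k³`. -/
noncomputable def zeta3 : ℝ := ∑' k : ℕ, 1 / ((k:ℝ)+1)^3

namespace Banana
open Real Filter Topology

/-- The exponents are nonnegative and the exponential series `∑ c i e^{-s l i}` converges absolutely
for all `s > 0`. -/
structure ExpSummable {ι : Type*} (c l : ι → ℝ) : Prop where
  nonneg : ∀ i, 0 ≤ l i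
  summable : ∀ s, 0 < s → Summable fun i => |c i| * exp (-s * l i)

/-- The exponential series `∑ c i e^{-s l i}`. -/
noncomputable def expSeries {ι : Type*} (c l : ι → ℝ) (s : ℝ) : ℝ := ∑' i, c i * exp (-s * l i)

namespace ExpSummable
variable {ι : Type*} {c l : ι → ℝ}

lemma summable' (h : ExpSummable c l) {s : ℝ} (hs : 0 < s) :
    Summable fun i => c i * exp (-s * l i) := by
  refine Summable.of_norm ?_
  simpa [abs_mul] using h.summable s hs

lemma hasSum (h : ExpSummable c l) {s : ℝ} (hs : 0 < s) :
    HasSum (fun i => c i * exp (-s * l i)) (expSeries c l s) := (h.summable' hs).hasSum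

lemma mul_exponent (h : ExpSummable c l) : ExpSummable (fun i => c i * l i) l := by
  refine ⟨h.nonneg, fun s hs => ?_⟩
  refine Summable.of_nonneg_of_le (fun i => by positivity) (fun i => ?_)
    ((h.summable (s/2) (by positivity)).mul_left (2/s))
  have h1 := h.nonneg i
  have h2 : s/2 * l i ≤ exp (s/2 * l i) := by linarith [add_one_le_exp (s/2 * l i)]
  have h3 : l i * exp (-s * l i) ≤ 2/s * exp (-(s/2) * l i) := by
    have : exp (-(s/2) * l i) = exp (s/2 * l i) * exp (-s * l i) := by
      rw [← exp_add]; congr 1; ring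
    rw [this, ← mul_assoc]
    refine mul_le_mul_of_nonneg_right ?_ (exp_pos _).le
    calc l i = 2/s * (s/2 * l i) := by field_simp
      _ ≤ _ := by gcongr
  rw [abs_mul, abs_of_nonneg h1]
  calc |c i| * l i * exp (-s * l i) = |c i| * (l i * exp (-s * l i)) := by ring
    _ ≤ |c i| * (2/s * exp (-(s/2) * l i)) := by gcongr
    _ = _ := by ring

lemma hasDerivAt (h : ExpSummable c l) {s : ℝ} (hs : 0 < s) :
    HasDerivAt (expSeries c l) (-expSeries (fun i => c i * l i) l s) s := by
  have h2 := h.mul_exponent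
  have key := hasDerivAt_tsum_of_isPreconnected (u := fun i => |c i * l i| * exp (-(s/2) * l i))
    (g := fun i s => c i * exp (-s * l i)) (g' := fun i s => -(c i * l i * exp (-s * l i)))
    (t := Set.Ioi (s/2)) (y₀ := s) (y := s) (h2.summable (s/2) (by positivity)) isOpen_Ioi
    isPreconnected_Ioi ?_ ?_ (by simpa using hs) (h.summable' hs) (by simpa using hs)
  · rw [tsum_neg] at key
    exact key
  · intro i y _
    have : HasDerivAt (fun s : ℝ => -s * l i) (-1 * l i) y := by
      simpa using ((hasDerivAt_id y).neg.mul_const (l i))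
    convert! this.exp.const_mul (c i) using 1
    ring
  · intro i y hy
    rw [norm_neg, norm_mul, Real.norm_eq_abs, Real.norm_eq_abs, abs_exp]
    have := h.nonneg i
    have hy' : s/2 < y := hy
    gcongr

lemma tendsto (h : ExpSummable c l) :
    Tendsto (expSeries c l) atTop (𝓝 (∑' i, if l i = 0 then c i else 0)) := by
  refine tendsto_tsum_of_dominated_convergence (h.summable 1 one_pos) (fun i => ?_) ?_
  · split_ifs with hi
    · simp [hi]
    · have hl : 0 < l i := lt_of_le_of_ne (h.nonneg i) (Ne.symm hi)
      have : Tendsto (fun s : ℝ => exp (-(s * l i))) atTop (𝓝 0) :=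
        tendsto_exp_neg_atTop_nhds_zero.comp (tendsto_id.atTop_mul_const hl)
      simpa using this.const_mul (c i)
  · filter_upwards [eventually_ge_atTop 1] with s hs i
    rw [norm_mul, Real.norm_eq_abs, Real.norm_eq_abs, abs_exp]
    have := h.nonneg i
    gcongr

lemma decay (h : ExpSummable c l) (hl : ∀ i, c i ≠ 0 → 1 ≤ l i) (k : ℕ) :
    Tendsto (fun s => s ^ k * expSeries c l s) atTop (𝓝 0) := by
  have h0 := (tendsto_pow_mul_exp_neg_atTop_nhds_zero k).mul_const
    (exp 1 * ∑' i, |c i| * exp (-1 * l i))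
  rw [zero_mul] at h0
  refine squeeze_zero_norm' ?_ h0
  filter_upwards [eventually_ge_atTop 1] with s hs
  have hs0 : 0 < s := by linarith
  rw [norm_mul, Real.norm_eq_abs, abs_of_nonneg (by positivity : 0 ≤ s ^ k), mul_assoc]
  refine mul_le_mul_of_nonneg_left ?_ (by positivity)
  rw [← mul_assoc, ← tsum_mul_left]
  refine tsum_of_norm_bounded (((h.summable 1 one_pos).mul_left _).hasSum) (fun i => ?_)
  rw [norm_mul, Real.norm_eq_abs, Real.norm_eq_abs, abs_exp]
  by_cases hc : c i = 0
  · simp [hc]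
  have h1 := hl i hc
  rw [mul_left_comm, ← exp_add, ← exp_add]
  gcongr
  nlinarith

end ExpSummable

lemma eq_of_doubling {f : ℝ → ℝ} {a : ℝ} (hf : ∀ s, 0 < s → f s = f (2 * s))
    (hlim : Tendsto f atTop (𝓝 a)) {s : ℝ} (hs : 0 < s) : f s = a := by
  have h1 : ∀ n : ℕ, f (2 ^ n * s) = f s := by
    intro n
    induction n with
    | zero => simp
    | succ n ih => rw [← ih, hf (2 ^ n * s) (by positivity)]; congr 1; ring
  have h2 : Tendsto (fun n : ℕ => f (2 ^ n * s)) atTop (𝓝 a) :=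
    hlim.comp ((tendsto_pow_atTop_atTop_of_one_lt (by norm_num : (1:ℝ) < 2)).atTop_mul_const hs)
  simp only [h1] at h2
  exact tendsto_nhds_unique tendsto_const_nhds h2

lemma summable_exp_neg_mul_int_sq {s : ℝ} (hs : 0 < s) :
    Summable fun k : ℤ => exp (-s * (k:ℝ)^2) := by
  have h : Summable fun n : ℕ => exp (-s * (n:ℝ)) := by
    simpa [mul_comm] using Real.summable_exp_nat_mul_iff.mpr (neg_neg_of_pos hs)
  have h2 : Summable fun n : ℕ => exp (-s * (n:ℝ)^2) := by
    refine Summable.of_nonneg_of_le (fun n => (exp_pos _).le) (fun n => ?_) h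
    apply exp_le_exp.mpr
    have : (n:ℝ) ≤ (n:ℝ)^2 := by exact_mod_cast Nat.le_self_pow two_ne_zero n
    nlinarith
  refine Summable.of_nat_of_neg (by simpa using h2) (by simpa using h2)

lemma expSummable_int {c l : ℤ → ℝ} (hc : ∀ k, |c k| ≤ 1) (hl : ∀ k, 0 ≤ l k) {b : ℝ}
    (hb : ∀ k : ℤ, (k:ℝ)^2 / 2 - b ≤ l k) : ExpSummable c l := by
  refine ⟨hl, fun s hs => ?_⟩
  refine Summable.of_nonneg_of_le (fun i => by positivity) (fun k => ?_)
    ((summable_exp_neg_mul_int_sq (half_pos hs)).mul_left (exp (s * b)))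
  rw [← exp_add]
  calc |c k| * exp (-s * l k) ≤ 1 * exp (-s * l k) := by gcongr; exact hc k
    _ ≤ _ := by
      rw [one_mul]; apply exp_le_exp.mpr
      nlinarith [hb k]

/-- `θ₃` at the nome `e^{-s}`. -/
noncomputable def th3 : ℝ → ℝ := expSeries (fun _ : ℤ => 1) (fun k => (k:ℝ)^2)
/-- `θ₄` at the nome `e^{-s}`. -/
noncomputable def th4 : ℝ → ℝ := expSeries (fun k : ℤ => (-1)^k) (fun k => (k:ℝ)^2)
/-- `θ₂` at the nome `e^{-s}`. -/
noncomputable def th2 : ℝ → ℝ := expSeries (fun _ : ℤ => 1) (fun k => ((k:ℝ)+1/2)^2)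

lemma abs_neg_one_zpow (k : ℤ) : |(-1:ℝ)^k| = 1 := by
  simp [abs_zpow]

lemma expSummable_th3 : ExpSummable (fun _ : ℤ => 1) (fun k => (k:ℝ)^2) :=
  expSummable_int (b := 0) (by simp) (fun k => sq_nonneg _) (fun k => by nlinarith [sq_nonneg (k:ℝ)])
lemma expSummable_th4 : ExpSummable (fun k : ℤ => (-1)^k) (fun k => (k:ℝ)^2) :=
  expSummable_int (b := 0) (fun k => (abs_neg_one_zpow k).le) (fun k => sq_nonneg _)
    (fun k => by nlinarith [sq_nonneg (k:ℝ)])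
lemma expSummable_th2 : ExpSummable (fun _ : ℤ => 1) (fun k => ((k:ℝ)+1/2)^2) :=
  expSummable_int (b := 1) (by simp) (fun k => sq_nonneg _)
    (fun k => by nlinarith [sq_nonneg ((k:ℝ)+1)])

lemma int_sq_add_nonneg (k : ℤ) : (0:ℝ) ≤ (k:ℝ)^2 + k := by
  have : 0 ≤ k^2 + k := by
    rcases le_or_gt 0 k with h | h
    · positivity
    · nlinarith
  exact_mod_cast this

lemma expSummable_psi : ExpSummable (fun _ : ℤ => 1) (fun k => (k:ℝ)^2 + k) :=
  expSummable_int (b := 1) (by simp) int_sq_add_nonneg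
    (fun k => by nlinarith [sq_nonneg ((k:ℝ)+1)])

lemma ExpSummable.hasSum_mul {ι κ : Type*} {c l : ι → ℝ} {c' l' : κ → ℝ} (h : ExpSummable c l)
    (h' : ExpSummable c' l') {s s' : ℝ} (hs : 0 < s) (hs' : 0 < s') :
    HasSum (fun p : ι × κ => c p.1 * c' p.2 * exp (-(s * l p.1 + s' * l' p.2)))
      (expSeries c l s * expSeries c' l' s') := by
  have h1 : Summable fun i => ‖c i * exp (-s * l i)‖ := by simpa [abs_mul] using h.summable s hs
  have h2 : Summable fun i => ‖c' i * exp (-s' * l' i)‖ := by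
    simpa [abs_mul] using h'.summable s' hs'
  rw [expSeries, expSeries, tsum_mul_tsum_of_summable_norm h1 h2]
  convert! (summable_mul_of_summable_norm h1 h2).hasSum using 2 with p
  rw [show -(s * l p.1 + s' * l' p.2) = -s * l p.1 + -s' * l' p.2 by ring, exp_add]
  ring

/-- The lattice `ℤ²` is the disjoint union of the sublattice `m ≡ n mod 2` and its translate. -/
lemma hasSum_split {F : ℤ × ℤ → ℝ} {a b d : ℝ} (hF : HasSum F a)
    (h0 : HasSum (fun p : ℤ × ℤ => F (2 * p.1 + p.2, p.2)) b)
    (h1 : HasSum (fun p : ℤ × ℤ => F (2 * p.1 + 1 + p.2, p.2)) d) : a = b + d := by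
  have i0 : Function.Injective fun p : ℤ × ℤ => (2 * p.1 + p.2, p.2) := by
    rintro ⟨a, b⟩ ⟨c, d⟩ h
    simp only [Prod.mk.injEq] at h ⊢
    omega
  have i1 : Function.Injective fun p : ℤ × ℤ => (2 * p.1 + 1 + p.2, p.2) := by
    rintro ⟨a, b⟩ ⟨c, d⟩ h
    simp only [Prod.mk.injEq] at h ⊢
    omega
  refine hF.unique ((i0.hasSum_range_iff.2 h0).add_isCompl ?_ (i1.hasSum_range_iff.2 h1))
  rw [isCompl_iff, disjoint_iff, codisjoint_iff]
  constructor
  · ext ⟨m, n⟩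
    simp only [Set.inf_eq_inter, Set.mem_inter_iff, Set.mem_range, Prod.mk.injEq, Prod.exists,
      Set.bot_eq_empty, Set.mem_empty_iff_false, iff_false]
    rintro ⟨⟨a, b, h, h'⟩, ⟨c, d, h2, h2'⟩⟩
    omega
  · ext ⟨m, n⟩
    simp only [Set.sup_eq_union, Set.mem_union, Set.mem_range, Prod.mk.injEq, Prod.exists,
      Set.top_eq_univ, Set.mem_univ, iff_true]
    rcases Int.even_or_odd' (m - n) with ⟨k, h | h⟩
    · exact Or.inl ⟨k, n, by omega, rfl⟩
    · exact Or.inr ⟨k, n, by omega, rfl⟩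

/-- The shear `(k, n) ↦ (k, k + n)`. -/
def shear : ℤ × ℤ ≃ ℤ × ℤ where
  toFun p := (p.1, p.1 + p.2)
  invFun p := (p.1, p.2 - p.1)
  left_inv p := by simp
  right_inv p := by simp

lemma hasSum_split_shear {F G H : ℤ × ℤ → ℝ} {a b d : ℝ} (hF : HasSum F a)
    (hG : HasSum G b) (hH : HasSum H d) (h0 : ∀ k n, F (2 * k + n, n) = G (k, k + n))
    (h1 : ∀ k n, F (2 * k + 1 + n, n) = H (k, k + n)) : a = b + d := by
  refine hasSum_split hF ?_ ?_
  · rw [← shear.hasSum_iff] at hG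
    exact hG.congr_fun fun p => h0 p.1 p.2
  · rw [← shear.hasSum_iff] at hH
    exact hH.congr_fun fun p => h1 p.1 p.2

section Products
variable {s : ℝ} (hs : 0 < s)
include hs

lemma th3_sq : th3 s ^ 2 = th3 (2*s) ^ 2 + th2 (2*s) ^ 2 := by
  have h2 : 0 < 2 * s := by positivity
  simp only [sq]
  refine hasSum_split_shear (expSummable_th3.hasSum_mul expSummable_th3 hs hs)
    (expSummable_th3.hasSum_mul expSummable_th3 h2 h2)
    (expSummable_th2.hasSum_mul expSummable_th2 h2 h2) ?_ ?_ <;>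
  · intro k n
    push_cast
    congr 2
    ring

lemma th4_sq : th4 s ^ 2 = th3 (2*s) ^ 2 - th2 (2*s) ^ 2 := by
  have h2 : 0 < 2 * s := by positivity
  simp only [sq, sub_eq_add_neg]
  refine hasSum_split_shear (expSummable_th4.hasSum_mul expSummable_th4 hs hs)
    (expSummable_th3.hasSum_mul expSummable_th3 h2 h2)
    (expSummable_th2.hasSum_mul expSummable_th2 h2 h2).neg ?_ ?_
  · intro k n
    have : (-1:ℝ)^(2*k+n) * (-1)^n = 1 := by
      rw [← zpow_add₀ (by norm_num)]
      exact Even.neg_one_zpow ⟨k + n, by ring⟩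
    simp only [this]
    push_cast
    congr 2
    · ring
    · ring
  · intro k n
    have : (-1:ℝ)^(2*k+1+n) * (-1)^n = -1 := by
      rw [← zpow_add₀ (by norm_num)]
      exact Odd.neg_one_zpow ⟨k + n, by ring⟩
    simp only [this]
    push_cast
    rw [one_mul, neg_one_mul, one_mul]
    congr 2
    ring

lemma th2_sq : th2 s ^ 2 = 2 * (th2 (2*s) * th3 (2*s)) := by
  have h2 : 0 < 2 * s := by positivity
  rw [show 2 * (th2 (2*s) * th3 (2*s)) = th3 (2*s) * th2 (2*s) + th2 (2*s) * th3 (2*s) by ring, sq]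
  have H := expSummable_th2.hasSum_mul expSummable_th3 h2 h2
  have H' := expSummable_th3.hasSum_mul expSummable_th2 h2 h2
  rw [← ((Equiv.refl ℤ).prodCongr (Equiv.addRight (1:ℤ))).hasSum_iff] at H
  refine hasSum_split_shear (expSummable_th2.hasSum_mul expSummable_th2 hs hs) H' H ?_ ?_ <;>
  · intro k n
    simp only [Function.comp, Equiv.prodCongr_apply, Prod.map, Equiv.refl_apply,
      Equiv.coe_addRight]
    push_cast
    congr 2
    ring

lemma hasSum_neg_one_half :
    HasSum (fun k : ℤ => (-1:ℝ)^k * exp (-s * ((k:ℝ)+1/2)^2)) 0 := by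
  have hS : ExpSummable (fun k : ℤ => (-1:ℝ)^k) (fun k => ((k:ℝ)+1/2)^2) :=
    expSummable_int (b := 1) (fun k => (abs_neg_one_zpow k).le) (fun k => sq_nonneg _)
      (fun k => by nlinarith [sq_nonneg ((k:ℝ)+1)])
  have h1 := hS.hasSum hs
  have h2 := h1
  rw [← (Equiv.subLeft (-1:ℤ)).hasSum_iff] at h2
  have h3 := h2.neg.congr_fun (g := fun k : ℤ => (-1:ℝ)^k * exp (-s * ((k:ℝ)+1/2)^2)) (fun k => by
    simp only [Function.comp, Equiv.subLeft_apply]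
    have : (-1:ℝ)^(-1-k) = -(-1)^k := by
      rw [show -1 - k = -(k+1) by ring, zpow_neg, ← inv_zpow, zpow_add_one₀ (by norm_num)]
      norm_num
    rw [this]
    push_cast
    rw [show (-1 - (k:ℝ) + 1/2)^2 = ((k:ℝ)+1/2)^2 by ring]
    ring)
  have h4 := h1.unique h3
  have : expSeries (fun k : ℤ => (-1:ℝ)^k) (fun k => ((k:ℝ)+1/2)^2) s = 0 := by linarith
  rwa [this] at h1

lemma th3_mul_th4 : th3 s * th4 s = th4 (2*s) ^ 2 := by
  have h2 : 0 < 2 * s := by positivity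
  have hS : ExpSummable (fun k : ℤ => (-1:ℝ)^k) (fun k => ((k:ℝ)+1/2)^2) :=
    expSummable_int (b := 1) (fun k => (abs_neg_one_zpow k).le) (fun k => sq_nonneg _)
      (fun k => by nlinarith [sq_nonneg ((k:ℝ)+1)])
  have h0 : expSeries (fun k : ℤ => (-1:ℝ)^k) (fun k => ((k:ℝ)+1/2)^2) (2*s) = 0 :=
    (hS.hasSum h2).unique (hasSum_neg_one_half h2)
  have hH := hS.hasSum_mul hS h2 h2
  rw [h0, zero_mul] at hH
  rw [← add_zero (th4 (2*s) ^ 2), sq]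
  have key : ∀ k n : ℤ, (-1:ℝ)^n = (-1)^k * (-1)^(k+n) := fun k n => by
    rw [zpow_add₀ (by norm_num), ← mul_assoc, ← mul_zpow]; norm_num
  refine hasSum_split_shear (expSummable_th3.hasSum_mul expSummable_th4 hs hs)
    (expSummable_th4.hasSum_mul expSummable_th4 h2 h2) hH ?_ ?_ <;>
  · intro k n
    push_cast
    rw [key k n, one_mul]
    congr 2
    ring

/-- The cubic theta identity. -/
lemma th3_mul_th3 : th3 s * th3 (3*s) = th2 s * th2 (3*s) + th4 s * th4 (3*s) := by
  have h3 : 0 < 3 * s := by positivity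
  have H3 := expSummable_th3.hasSum_mul expSummable_th3 hs h3
  have H4 := expSummable_th4.hasSum_mul expSummable_th4 hs h3
  have H2 := expSummable_th2.hasSum_mul expSummable_th2 hs h3
  have hinj : Function.Injective fun p : ℤ × ℤ => (2 * p.1 + p.2, p.2) := by
    rintro ⟨a, b⟩ ⟨c, d⟩ h
    simp only [Prod.mk.injEq] at h ⊢
    omega
  have hinj' : Function.Injective fun p : ℤ × ℤ => (2 * p.1 + 1 + p.2, p.2) := by
    rintro ⟨a, b⟩ ⟨c, d⟩ h
    simp only [Prod.mk.injEq] at h ⊢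
    omega
  obtain ⟨E, hE⟩ := H3.summable.comp_injective hinj
  obtain ⟨S, hS⟩ := H3.summable.comp_injective hinj'
  have e3 := hasSum_split H3 hE hS
  have e4 := hasSum_split H4 (hE.congr_fun (fun p => by
      have : (-1:ℝ)^(2*p.1+p.2) * (-1)^p.2 = 1 := by
        rw [← zpow_add₀ (by norm_num)]
        exact Even.neg_one_zpow ⟨p.1 + p.2, by ring⟩
      simp only [this, Function.comp, mul_one])) (hS.neg.congr_fun (fun p => by
      have : (-1:ℝ)^(2*p.1+1+p.2) * (-1)^p.2 = -1 := by
        rw [← zpow_add₀ (by norm_num)]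
        exact Odd.neg_one_zpow ⟨p.1 + p.2, by ring⟩
      simp only [this, Function.comp, mul_one, one_mul, neg_one_mul]))
  have hS1 := hS
  have hS2 := hS
  let e : ℤ × ℤ ≃ ℤ × ℤ :=
    { toFun := fun p => (-1 - p.2, p.1 + 1 + p.2)
      invFun := fun p => (p.2 + p.1, -1 - p.1)
      left_inv := fun p => by ext <;> simp
      right_inv := fun p => by ext <;> (simp; try ring) }
  rw [← (Equiv.prodComm ℤ ℤ).hasSum_iff] at hS1
  rw [← e.hasSum_iff] at hS2
  have e2 := hasSum_split H2 (hS1.congr_fun (fun p => by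
      simp only [Function.comp, Equiv.prodComm_apply, Prod.swap]
      push_cast
      congr 2
      ring)) (hS2.congr_fun (fun p => by
      simp only [Function.comp, e, Equiv.coe_fn_mk]
      push_cast
      congr 2
      ring))
  change th3 s * th3 (3*s) = _ at e3
  change th4 s * th4 (3*s) = _ at e4
  change th2 s * th2 (3*s) = _ at e2
  linarith

end Products

lemma hasDerivAt_scale {f : ℝ → ℝ} {f' s : ℝ} (c : ℝ) (h : HasDerivAt f f' (c * s)) :
    HasDerivAt (fun u => f (c * u)) (c * f') s := by
  have := h.comp s ((hasDerivAt_id s).const_mul c)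
  rw [mul_comm]
  rw [mul_one] at this
  exact this

lemma deriv_eq_of_eq {f g : ℝ → ℝ} {f' g' s : ℝ} (hs : 0 < s) (h : ∀ u, 0 < u → f u = g u)
    (hf : HasDerivAt f f' s) (hg : HasDerivAt g g' s) : f' = g' := by
  refine hf.unique (hg.congr_of_eventuallyEq ?_)
  filter_upwards [lt_mem_nhds hs] with u hu using h u hu

lemma ExpSummable.pos {ι : Type*} {c l : ι → ℝ} (h : ExpSummable c l) (hc : ∀ i, 0 ≤ c i) (i : ι)
    (hi : 0 < c i) {s : ℝ} (hs : 0 < s) : 0 < expSeries c l s :=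
  (h.summable' hs).tsum_pos (fun j => mul_nonneg (hc j) (exp_pos _).le) i
    (mul_pos hi (exp_pos _))

lemma th3_pos {s : ℝ} (hs : 0 < s) : 0 < th3 s :=
  expSummable_th3.pos (fun _ => zero_le_one) 0 one_pos hs
lemma th2_pos {s : ℝ} (hs : 0 < s) : 0 < th2 s :=
  expSummable_th2.pos (fun _ => zero_le_one) 0 one_pos hs

lemma tendsto_th3 : Tendsto th3 atTop (𝓝 1) := by
  have := expSummable_th3.tendsto
  rwa [tsum_eq_single 0 (fun k hk => by simp [hk]), if_pos (by simp)] at this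
lemma tendsto_th4 : Tendsto th4 atTop (𝓝 1) := by
  have := expSummable_th4.tendsto
  rwa [tsum_eq_single 0 (fun k hk => by simp [hk]), if_pos (by simp), zpow_zero] at this

lemma th4_pos {s : ℝ} (hs : 0 < s) : 0 < th4 s := by
  have h0 : ∀ u, 0 < u → 0 ≤ th4 u := fun u hu => by
    have h1 := th3_mul_th4 hu
    have h2 := th3_pos hu
    by_contra! h
    nlinarith [sq_nonneg (th4 (2*u)), mul_pos_of_neg_of_neg (neg_neg_of_pos h2) h]
  refine lt_of_le_of_ne (h0 s hs) (fun h => ?_)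
  have h1 : ∀ n : ℕ, th4 (2 ^ n * s) = 0 := by
    intro n
    induction n with
    | zero => simpa using h.symm
    | succ n ih =>
      have := th3_mul_th4 (show 0 < 2 ^ n * s by positivity)
      rw [ih, mul_zero, eq_comm, sq_eq_zero_iff] at this
      rw [← this]; congr 1; ring
  have h2 : Tendsto (fun n : ℕ => th4 (2 ^ n * s)) atTop (𝓝 1) := tendsto_th4.comp
    ((tendsto_pow_atTop_atTop_of_one_lt (by norm_num : (1:ℝ) < 2)).atTop_mul_const hs)
  simp only [h1] at h2
  exact zero_ne_one (tendsto_nhds_unique tendsto_const_nhds h2)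

/-- Negated logarithmic derivative of an exponential series. -/
noncomputable def lgd {ι : Type*} (c l : ι → ℝ) (s : ℝ) : ℝ :=
  expSeries (fun i => c i * l i) l s / expSeries c l s
/-- The negated derivative of `lgd`. -/
noncomputable def dlgd {ι : Type*} (c l : ι → ℝ) (s : ℝ) : ℝ :=
  expSeries (fun i => c i * l i * l i) l s / expSeries c l s - lgd c l s ^ 2

lemma ExpSummable.hasDerivAt_lgd {ι : Type*} {c l : ι → ℝ} (h : ExpSummable c l) {s : ℝ}
    (hs : 0 < s) (h0 : expSeries c l s ≠ 0) : HasDerivAt (lgd c l) (-dlgd c l s) s := by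
  have := (h.mul_exponent.hasDerivAt hs).div (h.hasDerivAt hs) h0
  convert! this using 1
  rw [dlgd, lgd]
  field_simp
  ring

lemma ExpSummable.hasDerivAt' {ι : Type*} {c l : ι → ℝ} (h : ExpSummable c l) {s : ℝ}
    (hs : 0 < s) (h0 : expSeries c l s ≠ 0) :
    HasDerivAt (expSeries c l) (-(lgd c l s * expSeries c l s)) s := by
  convert! h.hasDerivAt hs using 2
  rw [lgd]
  field_simp

/-- Negated logarithmic derivative of `θ₂`. -/
noncomputable def T2 : ℝ → ℝ := lgd (fun _ : ℤ => 1) (fun k => ((k:ℝ)+1/2)^2)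
/-- Negated logarithmic derivative of `θ₃`. -/
noncomputable def T3 : ℝ → ℝ := lgd (fun _ : ℤ => 1) (fun k => (k:ℝ)^2)
/-- Negated logarithmic derivative of `θ₄`. -/
noncomputable def T4 : ℝ → ℝ := lgd (fun k : ℤ => (-1)^k) (fun k => (k:ℝ)^2)
/-- Negated derivative of `T2`. -/
noncomputable def dT2 : ℝ → ℝ := dlgd (fun _ : ℤ => 1) (fun k => ((k:ℝ)+1/2)^2)
/-- Negated derivative of `T3`. -/
noncomputable def dT3 : ℝ → ℝ := dlgd (fun _ : ℤ => 1) (fun k => (k:ℝ)^2)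
/-- Negated derivative of `T4`. -/
noncomputable def dT4 : ℝ → ℝ := dlgd (fun k : ℤ => (-1)^k) (fun k => (k:ℝ)^2)

section
variable {s : ℝ} (hs : 0 < s)
include hs

lemma hasDerivAt_th2 : HasDerivAt th2 (-(T2 s * th2 s)) s :=
  expSummable_th2.hasDerivAt' hs (th2_pos hs).ne'
lemma hasDerivAt_th3 : HasDerivAt th3 (-(T3 s * th3 s)) s :=
  expSummable_th3.hasDerivAt' hs (th3_pos hs).ne'
lemma hasDerivAt_th4 : HasDerivAt th4 (-(T4 s * th4 s)) s :=
  expSummable_th4.hasDerivAt' hs (th4_pos hs).ne'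
lemma hasDerivAt_T2 : HasDerivAt T2 (-dT2 s) s :=
  expSummable_th2.hasDerivAt_lgd hs (th2_pos hs).ne'
lemma hasDerivAt_T3 : HasDerivAt T3 (-dT3 s) s :=
  expSummable_th3.hasDerivAt_lgd hs (th3_pos hs).ne'
lemma hasDerivAt_T4 : HasDerivAt T4 (-dT4 s) s :=
  expSummable_th4.hasDerivAt_lgd hs (th4_pos hs).ne'

lemma T2_double : T2 s = T2 (2*s) + T3 (2*s) := by
  have h2 : 0 < 2 * s := by positivity
  have := deriv_eq_of_eq hs (fun u hu => th2_sq hu) ((hasDerivAt_th2 hs).pow 2)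
    (((hasDerivAt_scale 2 (hasDerivAt_th2 h2)).mul
      (hasDerivAt_scale 2 (hasDerivAt_th3 h2))).const_mul 2)
  have e := th2_sq hs
  have p := th2_pos hs
  apply mul_right_cancel₀ (pow_ne_zero 2 p.ne')
  norm_num at this
  linear_combination (-1/2) * this + (T2 (2*s) + T3 (2*s)) * (-e)

lemma T3_double : th3 s ^ 2 * T3 s =
    2 * (T3 (2*s) * th3 (2*s) ^ 2 + T2 (2*s) * th2 (2*s) ^ 2) := by
  have h2 : 0 < 2 * s := by positivity
  have := deriv_eq_of_eq hs (fun u hu => th3_sq hu) ((hasDerivAt_th3 hs).pow 2)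
    (((hasDerivAt_scale 2 (hasDerivAt_th3 h2)).pow 2).add
      ((hasDerivAt_scale 2 (hasDerivAt_th2 h2)).pow 2))
  norm_num at this
  linear_combination (-1/2) * this

lemma T4_double : th4 s ^ 2 * T4 s =
    2 * (T3 (2*s) * th3 (2*s) ^ 2 - T2 (2*s) * th2 (2*s) ^ 2) := by
  have h2 : 0 < 2 * s := by positivity
  have := deriv_eq_of_eq hs (fun u hu => th4_sq hu) ((hasDerivAt_th4 hs).pow 2)
    (((hasDerivAt_scale 2 (hasDerivAt_th3 h2)).pow 2).sub
      ((hasDerivAt_scale 2 (hasDerivAt_th2 h2)).pow 2))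
  norm_num at this
  linear_combination (-1/2) * this

lemma T3_add_T4 : T3 s + T4 s = 4 * T4 (2*s) := by
  have h2 : 0 < 2 * s := by positivity
  have := deriv_eq_of_eq hs (fun u hu => th3_mul_th4 hu)
    ((hasDerivAt_th3 hs).mul (hasDerivAt_th4 hs))
    ((hasDerivAt_scale 2 (hasDerivAt_th4 h2)).pow 2)
  norm_num at this
  have e := th3_mul_th4 hs
  apply mul_right_cancel₀ (mul_pos (th3_pos hs) (th4_pos hs)).ne'
  linear_combination - this - 4 * T4 (2*s) * e

/-- Jacobi's quartic identity. -/
lemma jacobi : th3 s ^ 4 = th2 s ^ 4 + th4 s ^ 4 := by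
  obtain ⟨u, rfl⟩ : ∃ u, s = 2 * u := ⟨s / 2, by ring⟩
  have hu : 0 < u := by linarith
  have h1 := th3_sq hu
  have h2 := th4_sq hu
  have h3 := th3_mul_th4 hu
  have : th4 (2*u) ^ 4 = th3 u ^ 2 * th4 u ^ 2 := by
    rw [← mul_pow, h3]; ring
  rw [this, h1, h2]
  ring

end

lemma tendsto_T2 : Tendsto T2 atTop (𝓝 (1/4)) := by
  have h1 := expSummable_psi.tendsto
  have h2 := expSummable_psi.mul_exponent.tendsto
  have e1 : (∑' k : ℤ, if (k:ℝ)^2 + k = 0 then (1:ℝ) else 0) = 2 := by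
    rw [tsum_eq_sum (s := {0, -1})]
    · rw [Finset.sum_pair (by norm_num)]
      norm_num
    · intro k hk
      rw [if_neg]
      intro h
      have h' : k * (k + 1) = 0 := by
        have : (k:ℝ) * (k + 1) = 0 := by linarith
        exact_mod_cast this
      rcases mul_eq_zero.1 h' with h | h
      · simp [h] at hk
      · simp [show k = -1 by omega] at hk
  have e2 : (∑' k : ℤ, if (k:ℝ)^2 + k = 0 then (1:ℝ) * ((k:ℝ)^2 + k) else 0) = 0 := by
    rw [← tsum_zero (β := ℤ) (α := ℝ)]
    congr 1
    ext k
    split_ifs with h <;> simp [h]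
  rw [e1] at h1
  rw [e2] at h2
  have h3 := (h2.div h1 two_ne_zero).add_const (1/4 : ℝ)
  rw [zero_div, zero_add] at h3
  refine h3.congr' ?_
  filter_upwards [eventually_gt_atTop 0] with s hs
  have a1 : th2 s = exp (-s/4) * expSeries (fun _ : ℤ => 1) (fun k => (k:ℝ)^2 + k) s := by
    rw [expSeries, ← tsum_mul_left]
    refine tsum_congr fun k => ?_
    rw [mul_left_comm, ← exp_add]
    congr 2
    ring
  have a2 : expSeries (fun k : ℤ => 1 * ((k:ℝ)+1/2)^2) (fun k => ((k:ℝ)+1/2)^2) s =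
      exp (-s/4) * (expSeries (fun k : ℤ => 1 * ((k:ℝ)^2 + k)) (fun k => (k:ℝ)^2 + k) s
        + 1/4 * expSeries (fun _ : ℤ => 1) (fun k => (k:ℝ)^2 + k) s) := by
    simp only [expSeries]
    rw [← tsum_mul_left (a := (1/4 : ℝ)),
      ← (expSummable_psi.mul_exponent.summable' hs).tsum_add
        ((expSummable_psi.summable' hs).mul_left _), ← tsum_mul_left]
    refine tsum_congr fun k => ?_
    rw [show -s * ((k:ℝ)+1/2)^2 = -s/4 + -s * ((k:ℝ)^2+k) by ring, exp_add]
    ring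
  have a3 : 0 < expSeries (fun _ : ℤ => 1) (fun k => (k:ℝ)^2 + k) s :=
    expSummable_psi.pos (fun _ => zero_le_one) 0 one_pos hs
  change _ = expSeries (fun k : ℤ => 1 * ((k:ℝ)+1/2)^2) _ s / th2 s
  rw [a1, a2, Pi.div_apply, mul_div_mul_left _ _ (exp_pos _).ne', add_div, mul_div_assoc, div_self a3.ne', mul_one]

lemma one_le_int_sq {k : ℤ} (hk : k ≠ 0) : (1:ℝ) ≤ (k:ℝ)^2 := by
  have : 1 ≤ k^2 := Int.add_one_le_iff.2 (sq_pos_of_ne_zero hk)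
  exact_mod_cast this

lemma tendsto_pow_mul_T3 (n : ℕ) : Tendsto (fun s => s ^ n * T3 s) atTop (𝓝 0) := by
  have h := (expSummable_th3.mul_exponent.decay (fun k hk => one_le_int_sq (by
    rintro rfl; simp at hk)) n).div tendsto_th3 one_ne_zero
  rw [zero_div] at h
  exact h.congr fun s => by rw [Pi.div_apply, mul_div_assoc]; rfl
lemma tendsto_pow_mul_T4 (n : ℕ) : Tendsto (fun s => s ^ n * T4 s) atTop (𝓝 0) := by
  have h := (expSummable_th4.mul_exponent.decay (fun k hk => one_le_int_sq (by
    rintro rfl; simp at hk)) n).div tendsto_th4 one_ne_zero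
  rw [zero_div] at h
  exact h.congr fun s => by rw [Pi.div_apply, mul_div_assoc]; rfl
lemma tendsto_T3 : Tendsto T3 atTop (𝓝 0) := by simpa using tendsto_pow_mul_T3 0
lemma tendsto_T4 : Tendsto T4 atTop (𝓝 0) := by simpa using tendsto_pow_mul_T4 0
lemma tendsto_pow_mul_dT4 (n : ℕ) : Tendsto (fun s => s ^ n * dT4 s) atTop (𝓝 0) := by
  have h := (expSummable_th4.mul_exponent.mul_exponent.decay (fun k hk => one_le_int_sq (by
    rintro rfl; simp at hk)) n).div tendsto_th4 one_ne_zero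
  have h2 := h.sub ((tendsto_pow_mul_T4 n).mul tendsto_T4)
  rw [zero_div, zero_mul, sub_zero] at h2
  refine h2.congr fun s => ?_
  simp only [dT4, dlgd, T4]
  rw [mul_sub, Pi.div_apply, mul_div_assoc]
  change _ * (_ / th4 s) - _ = _ * (_ / th4 s) - _
  ring

section
variable {s : ℝ} (hs : 0 < s)
include hs

lemma T2_sub_T3 : T2 s - T3 s = 1/4 * th4 s ^ 4 := by
  have key := eq_of_doubling (f := fun s => (T2 s - T3 s) / th4 s ^ 4) (a := 1/4) ?_ ?_ hs
  · have := th4_pos hs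
    rw [div_eq_iff (by positivity)] at key
    exact key
  · intro s hs
    have h2 : 0 < 2 * s := by positivity
    have e3 := th3_sq hs
    have e4 := th4_sq hs
    have p3 := th3_pos hs
    have p4 := th4_pos hs
    have q4 := th4_pos h2
    have e34 := th3_mul_th4 hs
    have d2 := T2_double hs
    have d3 := T3_double hs
    have : th4 (2*s) ^ 4 = th3 s ^ 2 * th4 s ^ 2 := by
      rw [← mul_pow, e34]; ring
    rw [this, div_eq_div_iff (by positivity) (by positivity)]
    have : (T2 s - T3 s) * th3 s ^ 2 = (T2 (2*s) - T3 (2*s)) * th4 s ^ 2 := by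
      rw [sub_mul, mul_comm (T3 s), d3, d2, e4, e3]; ring
    linear_combination th4 s ^ 2 * this
  · have := (tendsto_T2.sub tendsto_T3).div (tendsto_th4.pow 4) (by norm_num)
    simp only [sub_zero, one_pow, div_one] at this
    exact this

lemma T3_sub_T4 : T3 s - T4 s = 1/4 * th2 s ^ 4 := by
  have h2 : 0 < 2 * s := by positivity
  have e3 := th3_sq hs
  have e4 := th4_sq hs
  have p3 := th3_pos hs
  have p4 := th4_pos hs
  have d3 := T3_double hs
  have d4 := T4_double hs
  have e := T2_sub_T3 h2
  have e2 := th2_sq hs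
  have : th4 (2*s) ^ 4 = th3 s ^ 2 * th4 s ^ 2 := by
    rw [← mul_pow, th3_mul_th4 hs]; ring
  rw [this] at e
  have h : th2 s ^ 4 = 4 * th2 (2*s)^2 * th3 (2*s)^2 := by
    rw [show th2 s ^ 4 = (th2 s ^ 2)^2 by ring, e2]; ring
  rw [h]
  have p : 0 < th3 s ^ 2 * th4 s ^ 2 := by positivity
  apply mul_right_cancel₀ p.ne'
  rw [e3] at d3
  rw [e4] at d4
  rw [e3, e4] at e ⊢
  linear_combination (th3 (2*s) ^ 2 - th2 (2*s) ^ 2) * d3 - (th3 (2*s) ^ 2 + th2 (2*s) ^ 2) * d4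
    + 4 * th2 (2*s)^2 * th3 (2*s)^2 * e

lemma T2_sub_T4 : T2 s - T4 s = 1/4 * th3 s ^ 4 := by
  linear_combination T2_sub_T3 hs + T3_sub_T4 hs - 1/4 * jacobi hs

lemma dT2_sub_dT3 : dT2 s - dT3 s = 4 * (T2 s - T3 s) * T4 s := by
  have := deriv_eq_of_eq hs (fun u hu => T2_sub_T3 hu) ((hasDerivAt_T2 hs).sub (hasDerivAt_T3 hs))
    (((hasDerivAt_th4 hs).pow 4).const_mul (1/4))
  norm_num at this
  linear_combination (-1) * this - 4 * T4 s * T2_sub_T3 hs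

lemma dT3_sub_dT4 : dT3 s - dT4 s = 4 * (T3 s - T4 s) * T2 s := by
  have := deriv_eq_of_eq hs (fun u hu => T3_sub_T4 hu) ((hasDerivAt_T3 hs).sub (hasDerivAt_T4 hs))
    (((hasDerivAt_th2 hs).pow 4).const_mul (1/4))
  norm_num at this
  linear_combination (-1) * this - 4 * T2 s * T3_sub_T4 hs

lemma T3_mul_T4_double : T3 s * T4 s =
    4 * (T4 (2*s) * (T2 (2*s) + T3 (2*s)) - T2 (2*s) * T3 (2*s)) := by
  have h2 : 0 < 2 * s := by positivity
  have d3 := T3_double hs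
  have d4 := T4_double hs
  have p3 := th3_pos hs
  have p4 := th4_pos hs
  have t23 := T2_sub_T3 h2
  have t34 := T3_sub_T4 h2
  have t24 := T2_sub_T4 h2
  have : th4 (2*s) ^ 4 = th3 s ^ 2 * th4 s ^ 2 := by
    rw [← mul_pow, th3_mul_th4 hs]; ring
  rw [this] at t23
  have p : 0 < th3 s ^ 2 * th4 s ^ 2 := by positivity
  apply mul_right_cancel₀ p.ne'
  have h : T3 s * T4 s * (th3 s ^ 2 * th4 s ^ 2) =
      4 * (T3 (2*s) ^ 2 * th3 (2*s) ^ 4 - T2 (2*s)^2 * th2 (2*s)^4) := by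
    linear_combination T4 s * th4 s ^ 2 * d3 +
      2 * (T3 (2*s) * th3 (2*s) ^ 2 + T2 (2*s) * th2 (2*s) ^ 2) * d4
  rw [h]
  linear_combination (-16) * T3 (2*s) ^ 2 * t24 + 16 * T2 (2*s)^2 * t34 + 
    16 * (T4 (2*s) * (T2 (2*s) + T3 (2*s)) - T2 (2*s) * T3 (2*s)) * t23

/-- The Halphen system. -/
lemma halphen : dT4 s = 2 * (T4 s * (T2 s + T3 s) - T2 s * T3 s) := by
  have key := eq_of_doubling
    (f := fun s => s ^ 2 * (dT4 s - 2 * (T4 s * (T2 s + T3 s) - T2 s * T3 s))) (a := 0) ?_ ?_ hs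
  · rcases mul_eq_zero.1 key with h | h
    · exact absurd h (by positivity)
    · linarith
  · intro s hs
    have h2 : 0 < 2 * s := by positivity
    have a1 := deriv_eq_of_eq hs (fun u hu => T2_double hu) (hasDerivAt_T2 hs)
      ((hasDerivAt_scale 2 (hasDerivAt_T2 h2)).add (hasDerivAt_scale 2 (hasDerivAt_T3 h2)))
    have a2 := dT2_sub_dT3 hs
    have a3 := dT3_sub_dT4 hs
    have b2 := dT2_sub_dT3 h2
    have b3 := dT3_sub_dT4 h2
    have c := T3_mul_T4_double hs
    have e := T3_add_T4 hs
    have f := T2_double hs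
    have : dT4 s - 2 * (T4 s * (T2 s + T3 s) - T2 s * T3 s) =
        4 * (dT4 (2*s) - 2 * (T4 (2*s) * (T2 (2*s) + T3 (2*s)) - T2 (2*s) * T3 (2*s))) := by
      have : dT4 s - 2 * (T4 s * (T2 s + T3 s) - T2 s * T3 s) =
          dT2 s - 2 * (T2 s * (T3 s + T4 s) - T3 s * T4 s) := by
        linear_combination (-1) * a2 - a3
      rw [this, e, c, f]
      linear_combination (-1) * a1 + 2 * b2 + 4 * b3
    rw [this]
    ring
  · have h := (tendsto_pow_mul_dT4 2).sub ((((tendsto_pow_mul_T4 2).mul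
      (tendsto_T2.add tendsto_T3)).sub ((tendsto_pow_mul_T3 2).mul tendsto_T2)).const_mul 2)
    simp only [zero_mul, sub_zero, mul_zero] at h
    exact h.congr fun s => by ring

lemma dT4_eq : dT4 s - 2 * T4 s ^ 2 = -(1/8) * (th2 s * th3 s) ^ 4 := by
  have h := halphen hs
  have h1 := T2_sub_T4 hs
  have h2 := T3_sub_T4 hs
  rw [mul_pow]
  linear_combination h - 2 * (T3 s - T4 s) * h1 - 1/2 * th3 s ^ 4 * h2

end

/-- The level 6 products `θᵢ(s) θᵢ(3 s)`. -/
noncomputable def u2 (s : ℝ) : ℝ := th2 s * th2 (3*s)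
/-- `θ₃(s) θ₃(3 s)`. -/
noncomputable def u3 (s : ℝ) : ℝ := th3 s * th3 (3*s)
/-- `θ₄(s) θ₄(3 s)`. -/
noncomputable def u4 (s : ℝ) : ℝ := th4 s * th4 (3*s)

lemma lambda_strictAnti : StrictAntiOn (fun s => th2 s ^ 4 / th3 s ^ 4) (Set.Ioi 0) := by
  have hd : ∀ s, 0 < s → HasDerivAt (fun s => th2 s ^ 4 / th3 s ^ 4)
      (-(th4 s ^ 4 * (th2 s ^ 4 / th3 s ^ 4))) s := fun s hs => by
    have p := th3_pos hs
    convert! ((hasDerivAt_th2 hs).fun_pow 4).fun_div ((hasDerivAt_th3 hs).fun_pow 4) (by positivity)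
      using 1
    have := T2_sub_T3 hs
    rw [show th4 s ^ 4 = 4 * (T2 s - T3 s) by linarith]
    field_simp
    push_cast
    ring
  refine strictAntiOn_of_deriv_neg (convex_Ioi 0)
    (fun s hs => (hd s hs).continuousAt.continuousWithinAt) (fun s hs => ?_)
  rw [interior_Ioi] at hs
  rw [(hd s hs).deriv]
  have := th3_pos hs
  have := th2_pos hs
  have := th4_pos hs
  exact neg_neg_of_pos (by positivity)

section
variable {s : ℝ} (hs : 0 < s)
include hs

lemma u2_pos : 0 < u2 s := mul_pos (th2_pos hs) (th2_pos (by positivity))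
lemma u3_pos : 0 < u3 s := mul_pos (th3_pos hs) (th3_pos (by positivity))
lemma u4_pos : 0 < u4 s := mul_pos (th4_pos hs) (th4_pos (by positivity))
lemma u3_eq : u3 s = u2 s + u4 s := th3_mul_th3 hs

lemma hasDerivAt_u2 : HasDerivAt u2 (-((T2 s + 3 * T2 (3*s)) * u2 s)) s := by
  have h3 : 0 < 3 * s := by positivity
  convert! (hasDerivAt_th2 hs).mul (hasDerivAt_scale 3 (hasDerivAt_th2 h3)) using 1
  rw [u2]; ring
lemma hasDerivAt_u3 : HasDerivAt u3 (-((T3 s + 3 * T3 (3*s)) * u3 s)) s := by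
  have h3 : 0 < 3 * s := by positivity
  convert! (hasDerivAt_th3 hs).mul (hasDerivAt_scale 3 (hasDerivAt_th3 h3)) using 1
  rw [u3]; ring
lemma hasDerivAt_u4 : HasDerivAt u4 (-((T4 s + 3 * T4 (3*s)) * u4 s)) s := by
  have h3 : 0 < 3 * s := by positivity
  convert! (hasDerivAt_th4 hs).mul (hasDerivAt_scale 3 (hasDerivAt_th4 h3)) using 1
  rw [u4]; ring

lemma u3_mul_sum : u3 s * (th2 s ^ 4 + 3 * th2 (3*s) ^ 4) =
    u2 s * (th3 s ^ 4 + 3 * th3 (3*s) ^ 4) := by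
  have h3 : 0 < 3 * s := by positivity
  have := deriv_eq_of_eq hs (fun u hu => u3_eq hu) (hasDerivAt_u3 hs)
    ((hasDerivAt_u2 hs).add (hasDerivAt_u4 hs))
  have e := u3_eq hs
  have a1 := T2_sub_T3 hs
  have a2 := T2_sub_T3 h3
  have b1 := T3_sub_T4 hs
  have b2 := T3_sub_T4 h3
  have j1 := jacobi hs
  have j2 := jacobi h3
  linear_combination (-4) * this - u2 s * (j1 + 3 * j2) + 4 * u2 s * (a1 + 3 * a2)
    - 4 * u4 s * (b1 + 3 * b2) + (th2 s ^ 4 + 3 * th2 (3*s) ^ 4 - 4 * (T3 s + 3 * T3 (3*s))) * e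

lemma u3_mul_th2 : u3 s * th2 s ^ 4 = u2 s * th3 s ^ 4 + 3 * u2 s * u4 s * u3 s ∧
    u3 s * th2 (3*s) ^ 4 = u2 s * th3 (3*s) ^ 4 - u2 s * u4 s * u3 s := by
  have h3 : 0 < 3 * s := by positivity
  have e := u3_eq hs
  have h := u3_mul_sum hs
  have j1 := jacobi hs
  have j2 := jacobi h3
  have p2 := u2_pos hs
  have p3 := u3_pos hs
  have p4 := u4_pos hs
  have hα : th2 s ^ 4 * th2 (3*s) ^ 4 = u2 s ^ 4 := by rw [u2]; ring
  have hx : th3 s ^ 4 * th3 (3*s) ^ 4 = u3 s ^ 4 := by rw [u3]; ring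
  have hc : th4 s ^ 4 * th4 (3*s) ^ 4 = u4 s ^ 4 := by rw [u4]; ring
  have hanti := lambda_strictAnti (a := s) (b := 3 * s) hs h3 (by linarith)
  have q1 := pow_pos (th3_pos hs) 4
  have q2 := pow_pos (th3_pos h3) 4
  rw [div_lt_div_iff₀ q2 q1] at hanti
  rw [show th4 s ^ 4 = th3 s ^ 4 - th2 s ^ 4 by linarith,
    show th4 (3*s) ^ 4 = th3 (3*s) ^ 4 - th2 (3*s) ^ 4 by linarith] at hc
  generalize th2 s ^ 4 = α at *
  generalize th2 (3*s) ^ 4 = α' at *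
  generalize th3 s ^ 4 = x at *
  generalize th3 (3*s) ^ 4 = x' at *
  generalize u2 s = u at *
  generalize u3 s = m at *
  generalize u4 s = v at *
  subst e
  have hf : ((u+v) * α - u * x) + 3 * ((u+v) * α' - u * x') = 0 := by linarith
  have hff : ((u+v) * α - u * x) * ((u+v) * α' - u * x') = -3 * (u * v * (u+v)) ^ 2 := by
    linear_combination ((u+v)^2 - u*(u+v)) * hα + (u^2 - u*(u+v)) * hx + u*(u+v) * hc
  have hf' : (u+v) * α' - u * x' < 0 := by
    by_contra! hcon
    have h1 : (u+v) * α - u * x ≤ 0 := by linarith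
    have h2 := mul_nonneg q1.le hcon
    have h3 := mul_nonneg q2.le (neg_nonneg.2 h1)
    nlinarith
  have h2 : ((u+v) * α' - u * x') ^ 2 = (u * v * (u+v)) ^ 2 := by
    have : (u+v) * α - u * x = -3 * ((u+v) * α' - u * x') := by linarith
    rw [this] at hff
    linarith
  have hP : 0 < u * v * (u+v) := by positivity
  rcases sq_eq_sq_iff_eq_or_eq_neg.1 h2 with h | h
  · linarith
  · constructor <;> linarith

lemma th3_diff : 3 * th3 (3*s) ^ 4 - th3 s ^ 4 = 2 * u3 s * (u4 s - u2 s) := by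
  obtain ⟨h1, h2⟩ := u3_mul_th2 hs
  have e := u3_eq hs
  have p2 := u2_pos hs
  have p3 := u3_pos hs
  have p4 := u4_pos hs
  have hα : th2 s ^ 4 * th2 (3*s) ^ 4 = u2 s ^ 4 := by rw [u2]; ring
  have hx : th3 s ^ 4 * th3 (3*s) ^ 4 = u3 s ^ 4 := by rw [u3]; ring
  have : (u2 s ^ 2 * u3 s * u4 s) ≠ 0 := by positivity
  apply mul_left_cancel₀ this
  have key : (u2 s * th3 s ^ 4 + 3 * u2 s * u4 s * u3 s) *
      (u2 s * th3 (3*s) ^ 4 - u2 s * u4 s * u3 s) = u3 s ^ 2 * u2 s ^ 4 := by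
    rw [← h1, ← h2, ← hα]; ring
  rw [e] at *
  linear_combination key - u2 s ^ 2 * hx

lemma th3_sum_sq : (th3 s ^ 4 + 3 * th3 (3*s) ^ 4) ^ 2 =
    16 * u3 s ^ 2 * (u2 s ^ 2 + u2 s * u4 s + u4 s ^ 2) := by
  have h := th3_diff hs
  have hx : th3 s ^ 4 * th3 (3*s) ^ 4 = u3 s ^ 4 := by rw [u3]; ring
  have e := u3_eq hs
  have : (th3 s ^ 4 + 3 * th3 (3*s) ^ 4) ^ 2 = (3 * th3 (3*s) ^ 4 - th3 s ^ 4) ^ 2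
    + 12 * (th3 s ^ 4 * th3 (3*s) ^ 4) := by ring
  rw [this, h, hx, e]
  ring

lemma T4_sub : T4 s - 3 * T4 (3*s) = -(1/2) * u2 s * u3 s := by
  have h3 : 0 < 3 * s := by positivity
  have d := deriv_eq_of_eq hs (fun u hu => th3_diff hu)
    (((hasDerivAt_scale 3 ((hasDerivAt_th3 h3).fun_pow 4)).const_mul 3).sub
      ((hasDerivAt_th3 hs).fun_pow 4))
    (((hasDerivAt_u3 hs).const_mul 2).mul ((hasDerivAt_u4 hs).sub (hasDerivAt_u2 hs)))
  push_cast at d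
  obtain ⟨h1, h2⟩ := u3_mul_th2 hs
  have hsum := u3_mul_sum hs
  have e := u3_eq hs
  have a1 := T2_sub_T3 hs
  have a2 := T2_sub_T3 h3
  have b1 := T3_sub_T4 hs
  have b2 := T3_sub_T4 h3
  have j1 := jacobi hs
  have j2 := jacobi h3
  have hd := th3_diff hs
  have p3 := u3_pos hs
  have hT3 : T3 s - 3 * T3 (3*s) = 1/2 * u2 s * u4 s := by
    have hp : 0 < th3 s ^ 4 + 3 * th3 (3*s) ^ 4 := by
      have := th3_pos hs
      have := th3_pos h3
      positivity
    apply mul_left_cancel₀ hp.ne'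
    have eT2 : T2 s + 3 * T2 (3*s) = T3 s + 3 * T3 (3*s) +
      1/4 * (th3 s ^ 4 + 3 * th3 (3*s)^4 - th2 s ^ 4 - 3 * th2 (3*s)^4) := by
        linear_combination a1 + 3 * a2 - 1/4 * (j1 + 3 * j2)
    have eT4 : T4 s + 3 * T4 (3*s) = T3 s + 3 * T3 (3*s) -
      1/4 * (th2 s ^ 4 + 3 * th2 (3*s)^4) := by linear_combination - b1 - 3 * b2
    rw [eT2, eT4] at d
    linear_combination (1/2) * d + (T3 s + 3 * T3 (3*s)) * hd - 1/4 * (u4 s + u2 s) * hsum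
      + 1/2 * u4 s * hsum + 1/4 * u2 s * (th3 s ^ 4 + 3 * th3 (3*s)^4) * e
  have hdiff : th2 s ^ 4 - 3 * th2 (3*s) ^ 4 = 4 * u2 s * u4 s + 2 * u2 s ^ 2 := by
    apply mul_left_cancel₀ p3.ne'
    linear_combination h1 - 3 * h2 - u2 s * hd
  linear_combination hT3 - b1 + 3 * b2 - 1/4 * hdiff - 1/2 * u2 s * (-e)
end

/-- The modular form `θ₄(s)² θ₄(3 s)²`. -/
noncomputable def A2 (s : ℝ) : ℝ := u4 s ^ 2
/-- The modular form `θ₂(s) θ₃(s) θ₂(3 s) θ₃(3 s) / 4`. -/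
noncomputable def B2 (s : ℝ) : ℝ := 1/4 * u2 s * u3 s
/-- The Hauptmodul as a function of `s`. -/
noncomputable def tt (s : ℝ) : ℝ := -64 * B2 s / A2 s
/-- The logarithmic derivative of `tt`. -/
noncomputable def AA (s : ℝ) : ℝ :=
  T2 s + T3 s - 2 * T4 s + 3 * (T2 (3*s) + T3 (3*s) - 2 * T4 (3*s))
/-- The logarithmic derivative of `A2`. -/
noncomputable def hh (s : ℝ) : ℝ := 2 * (T4 s + 3 * T4 (3*s))
/-- The derivative of `hh`. -/
noncomputable def dhh (s : ℝ) : ℝ := 2 * (dT4 s + 9 * dT4 (3*s))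

section
variable {s : ℝ} (hs : 0 < s)
include hs

lemma A2_pos : 0 < A2 s := pow_pos (u4_pos hs) 2
lemma B2_pos : 0 < B2 s := by
  have := u2_pos hs
  have := u3_pos hs
  rw [B2]; positivity

lemma hasDerivAt_A2 : HasDerivAt A2 (-(hh s * A2 s)) s := by
  convert! (hasDerivAt_u4 hs).fun_pow 2 using 1
  rw [hh, A2]; push_cast; ring
lemma hasDerivAt_B2 : HasDerivAt B2
    (-((T2 s + T3 s + 3 * (T2 (3*s) + T3 (3*s))) * B2 s)) s := by
  convert! ((hasDerivAt_u2 hs).const_mul (1/4)).mul (hasDerivAt_u3 hs) using 1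
  rw [B2]; ring
lemma hasDerivAt_tt : HasDerivAt tt (-(AA s * tt s)) s := by
  have := A2_pos hs
  convert! ((hasDerivAt_B2 hs).const_mul (-64)).fun_div (hasDerivAt_A2 hs) this.ne' using 1
  rw [tt, AA, hh]; field_simp; ring
lemma hasDerivAt_hh : HasDerivAt hh (-dhh s) s := by
  have h3 : 0 < 3 * s := by positivity
  convert! ((hasDerivAt_T4 hs).add
    ((hasDerivAt_scale 3 (hasDerivAt_T4 h3)).const_mul 3)).const_mul 2 using 1
  rw [dhh]; ring

lemma u3_mul_AA : 4 * u3 s * AA s = (u3 s + u2 s) * (th3 s ^ 4 + 3 * th3 (3*s) ^ 4) := by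
  have h3 : 0 < 3 * s := by positivity
  have a1 := T2_sub_T4 hs
  have a2 := T2_sub_T4 h3
  have b1 := T3_sub_T4 hs
  have b2 := T3_sub_T4 h3
  rw [AA]
  linear_combination 4 * u3 s * (a1 + 3 * a2 + b1 + 3 * b2) + u3_mul_sum hs

lemma AA_pos : 0 < AA s := by
  have h := u3_mul_AA hs
  have p2 := u2_pos hs
  have p3 := u3_pos hs
  have q := th3_pos hs
  have q' := th3_pos (show 0 < 3 * s by positivity)
  have : 0 < 4 * u3 s * AA s := by rw [h]; positivity
  exact pos_of_mul_pos_right this (by positivity)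

lemma AA_sq : AA s ^ 2 = (A2 s + 4 * B2 s) * (A2 s + 16 * B2 s) := by
  have h := u3_mul_AA hs
  have p3 := u3_pos hs
  have e := u3_eq hs
  have h2 := th3_sum_sq hs
  have : (16 * u3 s ^ 2) ≠ 0 := by positivity
  apply mul_left_cancel₀ this
  have : 16 * u3 s ^ 2 * AA s ^ 2 = (4 * u3 s * AA s) ^ 2 := by ring
  rw [this, h, mul_pow, h2, A2, B2, e]
  ring

lemma AA_sq' : AA s ^ 2 = A2 s ^ 2 * ((1 - tt s / 4) * (1 - tt s / 16)) := by
  have := A2_pos hs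
  rw [AA_sq hs, tt]; field_simp; ring

lemma sixteen_B2_mul_AA : 16 * (B2 s * AA s) =
    (th2 s * th3 s) ^ 4 - 9 * (th2 (3*s) * th3 (3*s)) ^ 4 := by
  have h := u3_mul_AA hs
  obtain ⟨h1, h2⟩ := u3_mul_th2 hs
  have p3 := u3_pos hs
  have e := u3_eq hs
  have hd := th3_diff hs
  apply mul_left_cancel₀ p3.ne'
  rw [mul_pow, mul_pow, B2]
  linear_combination u2 s * u3 s * h - th3 s ^ 4 * h1 + 9 * th3 (3*s) ^ 4 * h2
    + u2 s * (th3 s ^ 4 + 3 * th3 (3*s) ^ 4) * hd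
    + u2 s * (th3 s ^ 4 + 3 * th3 (3*s) ^ 4) * u3 s * e

lemma dhh_eq : 2 * dhh s - hh s ^ 2 = -8 * A2 s * B2 s - 64 * B2 s ^ 2 := by
  have h3 : 0 < 3 * s := by positivity
  obtain ⟨h1, h2⟩ := u3_mul_th2 hs
  have p3 := u3_pos hs
  have e := u3_eq hs
  have hd := th3_diff hs
  have hx : th3 s ^ 4 * th3 (3*s) ^ 4 = u3 s ^ 4 := by rw [u3]; ring
  have d1 := dT4_eq hs
  have d2 := dT4_eq h3
  have hT := T4_sub hs
  have key : th2 s ^ 4 * th3 s ^ 4 + 9 * (th2 (3*s) ^ 4 * th3 (3*s) ^ 4) =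
      u2 s * u3 s * (4 * u4 s ^ 2 + 10 * u2 s * u3 s) := by
    apply mul_left_cancel₀ p3.ne'
    have k1 : u3 s * (th2 s ^ 4 * th3 s ^ 4 + 9 * (th2 (3*s) ^ 4 * th3 (3*s) ^ 4)) =
        u2 s * ((3 * th3 (3*s) ^ 4 - th3 s ^ 4) ^ 2 + 6 * (th3 s ^ 4 * th3 (3*s) ^ 4)
          - 3 * u4 s * u3 s * (3 * th3 (3*s) ^ 4 - th3 s ^ 4)) := by
      linear_combination th3 s ^ 4 * h1 + 9 * th3 (3*s) ^ 4 * h2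
    rw [k1, hx, hd, e]
    ring
  have k2 : 2 * dhh s - hh s ^ 2 = 4 * (T4 s - 3 * T4 (3*s)) ^ 2
      - 1/2 * (th2 s ^ 4 * th3 s ^ 4 + 9 * (th2 (3*s) ^ 4 * th3 (3*s) ^ 4)) := by
    rw [dhh, hh]
    rw [mul_pow] at d1 d2
    linear_combination 4 * d1 + 36 * d2
  rw [k2, key, hT, A2, B2]
  ring

end

/-- The finite `q`-Pochhammer product `∏_{i<m} (1 - Q^{i+1})`. -/
noncomputable def qp (Q : ℝ) (m : ℕ) : ℝ := ∏ i ∈ Finset.range m, (1 - Q ^ (i+1))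

/-- The Euler product `∏ (1 - Q^{n+1})`. -/
noncomputable def euler (Q : ℝ) : ℝ := ∏' n : ℕ, (1 - Q ^ (n+1))

/-- Reciprocal Pochhammer, extended by zero to negative indices. -/
noncomputable def ip (Q : ℝ) (m : ℤ) : ℝ := if m < 0 then 0 else (qp Q m.toNat)⁻¹

section
variable {Q : ℝ} (h0 : 0 < Q) (h1 : Q < 1)
include h0 h1

lemma one_sub_pow_pos (n : ℕ) : 0 < 1 - Q ^ (n+1) := by
  have := pow_lt_one₀ h0.le h1 (Nat.succ_ne_zero n)
  exact sub_pos.2 this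

lemma summable_log_one_sub : Summable fun n : ℕ => log (1 - Q ^ (n+1)) := by
  have : Summable fun n : ℕ => -Q ^ (n+1) :=
    ((summable_nat_add_iff 1).2 (summable_geometric_of_lt_one h0.le h1)).neg
  simpa [sub_eq_add_neg] using Real.summable_log_one_add_of_summable this.norm.of_norm

lemma multipliable_one_sub : Multipliable fun n : ℕ => (1 - Q ^ (n+1)) :=
  Real.multipliable_of_summable_log (one_sub_pow_pos h0 h1) (summable_log_one_sub h0 h1)

lemma euler_pos : 0 < euler Q := by
  rw [euler, ← Real.rexp_tsum_eq_tprod (one_sub_pow_pos h0 h1) (summable_log_one_sub h0 h1)]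
  exact exp_pos _

lemma tendsto_qp : Tendsto (qp Q) atTop (𝓝 (euler Q)) :=
  (multipliable_one_sub h0 h1).hasProd.tendsto_prod_nat

lemma qp_pos (m : ℕ) : 0 < qp Q m := Finset.prod_pos fun i _ => one_sub_pow_pos h0 h1 i

lemma qp_antitone : Antitone (qp Q) := antitone_nat_of_succ_le fun n => by
  rw [qp, qp, Finset.prod_range_succ]
  have := qp_pos h0 h1 n
  have h2 : 0 < Q ^ (n+1) := by positivity
  rw [qp] at this
  nlinarith

lemma euler_le_qp (m : ℕ) : euler Q ≤ qp Q m := (qp_antitone h0 h1).le_of_tendsto (tendsto_qp h0 h1) m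

lemma qp_le_one (m : ℕ) : qp Q m ≤ 1 := by
  simpa [qp] using qp_antitone h0 h1 (Nat.zero_le m)

lemma ip_nonneg (m : ℤ) : 0 ≤ ip Q m := by
  rw [ip]; split_ifs
  · exact le_rfl
  · exact inv_nonneg.2 (qp_pos h0 h1 _).le

lemma ip_le (m : ℤ) : ip Q m ≤ (euler Q)⁻¹ := by
  rw [ip]; split_ifs
  · exact inv_nonneg.2 (euler_pos h0 h1).le
  · exact inv_anti₀ (euler_pos h0 h1) (euler_le_qp h0 h1 _)

lemma ip_rec (m : ℤ) : (1 - Q ^ m) * ip Q m = ip Q (m-1) := by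
  rcases lt_trichotomy m 0 with h | rfl | h
  · rw [ip, ip, if_pos h, if_pos (by omega), mul_zero]
  · simp [ip]
  · obtain ⟨n, rfl⟩ : ∃ n : ℕ, m = n + 1 := ⟨(m-1).toNat, by omega⟩
    rw [ip, ip, if_neg (by omega), if_neg (by omega),
      show ((n:ℤ) + 1).toNat = n + 1 by omega, show ((n:ℤ) + 1 - 1).toNat = n by omega,
      qp, Finset.prod_range_succ, ← qp, mul_inv]
    have := (one_sub_pow_pos h0 h1 n).ne'
    have e : Q ^ ((n:ℤ) + 1) = Q ^ (n+1) := by exact_mod_cast zpow_natCast Q (n+1)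
    rw [e]
    field_simp

lemma tendsto_ip (k : ℤ) (ε : ℤ) (hε : ε = 1 ∨ ε = -1) :
    Tendsto (fun N : ℕ => ip Q (N + ε * k)) atTop (𝓝 (euler Q)⁻¹) := by
  have h : Tendsto (fun N : ℕ => ((N:ℤ) + ε * k).toNat) atTop atTop := by
    rw [tendsto_atTop]
    intro b
    filter_upwards [eventually_ge_atTop (b + k.natAbs)] with N hN
    rcases hε with rfl | rfl <;> omega
  refine (((tendsto_qp h0 h1).comp h).inv₀ (euler_pos h0 h1).ne').congr' ?_
  filter_upwards [eventually_ge_atTop k.natAbs] with N hN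
  rw [ip, if_neg]
  · rfl
  · rcases hε with rfl | rfl <;> omega

end

/-- The coefficient of `(-1)^k q^{k²} z^k` in the finite Jacobi triple product. -/
noncomputable def jc (Q : ℝ) (N : ℕ) (k : ℤ) : ℝ := qp Q (2*N) * (ip Q (N + k) * ip Q (N - k))

lemma jc_rec {q : ℝ} (h0 : 0 < q) (h1 : q < 1) (N : ℕ) (k : ℤ) :
    q ^ (k^2) * jc (q^2) (N+1) k = (1 + q ^ (4*N+2)) * (q ^ (k^2) * jc (q^2) N k)
      + q ^ (2*N+1) * (q ^ ((k-1)^2) * jc (q^2) N (k-1) + q ^ ((k+1)^2) * jc (q^2) N (k+1)) := by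
  have H0 : 0 < q^2 := by positivity
  have H1 : q^2 < 1 := pow_lt_one₀ h0.le h1 two_ne_zero
  have hq : q ≠ 0 := h0.ne'
  have a1 := ip_rec H0 H1 ((N:ℤ) + 1 + k)
  have a2 := ip_rec H0 H1 ((N:ℤ) + k)
  have b1 := ip_rec H0 H1 ((N:ℤ) + 1 - k)
  have b2 := ip_rec H0 H1 ((N:ℤ) - k)
  simp only [jc]
  push_cast
  rw [show (N:ℤ) + 1 + k - 1 = N + k by ring] at a1
  rw [show (N:ℤ) + 1 - k - 1 = N - k by ring] at b1
  rw [show (N:ℤ) + (k - 1) = N + k - 1 by ring, show (N:ℤ) - (k - 1) = N + 1 - k by ring,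
    show (N:ℤ) + (k + 1) = N + 1 + k by ring, show (N:ℤ) - (k + 1) = N - k - 1 by ring,
    ← a2, ← b2, ← a1, ← b1, show 2 * (N + 1) = 2 * N + 1 + 1 by ring, qp, Finset.prod_range_succ,
    Finset.prod_range_succ, ← qp]
  have e : q ^ ((k-1)^2) = q ^ (k^2) * (q / (q ^ k) ^ 2) := by
    rw [show (k-1)^2 = k^2 + (1 - k - k) by ring, zpow_add₀ hq, zpow_sub₀ hq, zpow_sub₀ hq, zpow_one]
    field_simp
  have e' : q ^ ((k+1)^2) = q ^ (k^2) * (q * (q ^ k) ^ 2) := by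
    rw [show (k+1)^2 = k^2 + (1 + k + k) by ring, zpow_add₀ hq, zpow_add₀ hq, zpow_add₀ hq, zpow_one]
    ring
  have f1 : (q^2) ^ ((N:ℤ) + 1 + k) = (q ^ N) ^ 2 * q ^ 2 * (q ^ k) ^ 2 := by
    have H2 := H0.ne'
    rw [zpow_add₀ H2, zpow_add₀ H2, zpow_one, zpow_natCast, ← zpow_natCast (q^k), zpow_comm q,
      ← pow_mul, ← pow_mul, mul_comm 2 N]
    norm_cast
  have f2 : (q^2) ^ ((N:ℤ) + k) = (q ^ N) ^ 2 * (q ^ k) ^ 2 := by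
    have H2 := H0.ne'
    rw [zpow_add₀ H2, zpow_natCast, ← zpow_natCast (q^k), zpow_comm q,
      ← pow_mul, ← pow_mul, mul_comm 2 N]
    norm_cast
  have f3 : (q^2) ^ ((N:ℤ) + 1 - k) = (q ^ N) ^ 2 * q ^ 2 / (q ^ k) ^ 2 := by
    have H2 := H0.ne'
    rw [zpow_sub₀ H2, zpow_add₀ H2, zpow_one, zpow_natCast, ← zpow_natCast (q^k), zpow_comm q,
      ← pow_mul, ← pow_mul, mul_comm 2 N]
    norm_cast
  have f4 : (q^2) ^ ((N:ℤ) - k) = (q ^ N) ^ 2 / (q ^ k) ^ 2 := by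
    have H2 := H0.ne'
    rw [zpow_sub₀ H2, zpow_natCast, ← zpow_natCast (q^k), zpow_comm q,
      ← pow_mul, ← pow_mul, mul_comm 2 N]
    norm_cast
  rw [e, e', f1, f2, f3, f4]
  have hk : q ^ k ≠ 0 := zpow_ne_zero k hq
  have g1 : (q^2)^(2*N+1) = (q^N)^4 * q^2 := by ring
  have g2 : (q^2)^(2*N+1+1) = (q^N)^4 * q^4 := by ring
  have g3 : q^(4*N+2) = (q^N)^4 * q^2 := by ring
  have g4 : q^(2*N+1) = (q^N)^2 * q := by ring
  rw [g1, g2, g3, g4]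
  generalize q ^ k = K at *
  generalize q ^ N = M at *
  field_simp
  ring

/-- The finite Jacobi triple product. -/
lemma hasSum_finite_triple {q : ℝ} (h0 : 0 < q) (h1 : q < 1) {z : ℂ} (hz : z ≠ 0) (N : ℕ) :
    HasSum (fun k : ℤ => (-z) ^ k * ((q ^ (k^2) * jc (q^2) N k : ℝ) : ℂ))
      (∏ n ∈ Finset.range N, ((1 - (q:ℂ) ^ (2*n+1) * z) * (1 - (q:ℂ) ^ (2*n+1) / z))) := by
  induction N with
  | zero =>
    have : ∀ k : ℤ, k ≠ 0 → (-z) ^ k * ((q ^ (k^2) * jc (q^2) 0 k : ℝ) : ℂ) = 0 := fun k hk => by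
      have : jc (q^2) 0 k = 0 := by
        rcases lt_or_gt_of_ne hk with h | h
        · simp [jc, ip, h]
        · simp [jc, ip, h]
      simp [this]
    convert! hasSum_single 0 this using 1
    simp [jc, ip, qp]
  | succ N ih =>
    rw [Finset.prod_range_succ]
    have hp := (Equiv.addRight (1:ℤ)).hasSum_iff.2 ih
    have hm := (Equiv.subRight (1:ℤ)).hasSum_iff.2 ih
    have key := ((ih.mul_left (1 + (q:ℂ)^(4*N+2))).add
      ((hm.mul_left ((q:ℂ)^(2*N+1) * (-z))).add (hp.mul_left ((q:ℂ)^(2*N+1) * (-z)⁻¹))))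
    convert! key using 1
    · ext k
      simp only [Function.comp, Equiv.coe_addRight, Equiv.subRight_apply]
      have hz' : -z ≠ 0 := neg_ne_zero.2 hz
      rw [zpow_sub_one₀ hz', zpow_add_one₀ hz']
      push_cast [jc_rec h0 h1 N k]
      field_simp
    · have : (q:ℂ)^(4*N+2) = ((q:ℂ)^(2*N+1))^2 := by ring
      rw [this]
      field_simp
      ring_nf

lemma summable_triple {q : ℝ} (h0 : 0 < q) (h1 : q < 1) {r : ℝ} (hr : 0 < r) :
    Summable fun k : ℤ => r ^ k * q ^ (k^2) := by
  obtain ⟨s, hs, rfl⟩ : ∃ s, 0 < s ∧ q = exp (-s) :=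
    ⟨-log q, by linarith [log_neg h0 h1], by rw [neg_neg, exp_log h0]⟩
  obtain ⟨b, rfl⟩ : ∃ b, r = exp b := ⟨log r, (exp_log hr).symm⟩
  have hsum := (summable_exp_neg_mul_int_sq (half_pos hs)).mul_left (exp (b^2/(2*s)))
  refine Summable.of_nonneg_of_le (fun k => by positivity) (fun k => ?_) hsum
  rw [← rpow_intCast, ← rpow_intCast, ← exp_mul, ← exp_mul, ← exp_add, ← exp_add, exp_le_exp]
  push_cast
  have : 0 ≤ (b - s * k)^2 / (2*s) := by positivity
  have e : (b - s * k)^2 / (2*s) = b^2/(2*s) + -(s/2) * (k:ℝ)^2 - (b * k + -s * (k:ℝ)^2) := by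
    field_simp; ring
  linarith

/-- The Jacobi triple product. -/
lemma jacobi_triple {q : ℝ} (h0 : 0 < q) (h1 : q < 1) {z : ℂ} (hz : z ≠ 0) :
    Tendsto (fun N => ∏ n ∈ Finset.range N, ((1 - (q:ℂ) ^ (2*n+1) * z) * (1 - (q:ℂ) ^ (2*n+1) / z)))
      atTop (𝓝 ((∑' k : ℤ, (-z) ^ k * ((q ^ (k^2) : ℝ) : ℂ)) / euler (q^2))) := by
  have H0 : 0 < q^2 := by positivity
  have H1 : q^2 < 1 := pow_lt_one₀ h0.le h1 two_ne_zero
  have hE := euler_pos H0 H1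
  have : (∑' k : ℤ, (-z) ^ k * ((q ^ (k^2) : ℝ) : ℂ)) / euler (q^2) =
    ∑' k : ℤ, (-z) ^ k * ((q ^ (k^2) * (euler (q^2))⁻¹ : ℝ) : ℂ) := by
    rw [div_eq_mul_inv, ← tsum_mul_right]
    push_cast
    simp only [mul_assoc]
  rw [this]
  simp only [fun N => (hasSum_finite_triple h0 h1 hz N).tsum_eq.symm]
  refine tendsto_tsum_of_dominated_convergence
    (bound := fun k : ℤ => ‖z‖ ^ k * q ^ (k^2) * ((euler (q^2))⁻¹ * (euler (q^2))⁻¹))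
    ((summable_triple h0 h1 (norm_pos_iff.2 hz)).mul_right _) (fun k => ?_) (.of_forall fun N k => ?_)
  · refine Tendsto.const_mul _ ((Complex.continuous_ofReal.tendsto _).comp ?_)
    refine Tendsto.const_mul _ ?_
    have t1 := (tendsto_qp H0 H1).comp (tendsto_id.const_mul_atTop' (two_pos : 0 < 2))
    have t2 := tendsto_ip H0 H1 k 1 (Or.inl rfl)
    have t3 := tendsto_ip H0 H1 k (-1) (Or.inr rfl)
    have t := t1.mul (t2.mul t3)
    rw [mul_inv_cancel_left₀ hE.ne'] at t
    refine t.congr fun N => ?_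
    simp [jc, sub_eq_add_neg]
  · rw [norm_mul, norm_zpow, norm_neg, Complex.norm_real, norm_mul, mul_assoc]
    refine mul_le_mul_of_nonneg_left ?_ (by positivity)
    rw [Real.norm_eq_abs, abs_of_pos (by positivity)]
    refine mul_le_mul_of_nonneg_left ?_ (by positivity)
    have n1 := ip_nonneg H0 H1 (N+k)
    have n2 := ip_nonneg H0 H1 (N-k)
    have n3 := qp_pos H0 H1 (2*N)
    rw [jc, Real.norm_eq_abs, abs_of_nonneg (by positivity)]
    calc qp (q^2) (2*N) * (ip (q^2) (N+k) * ip (q^2) (N-k))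
        ≤ 1 * (ip (q^2) (N+k) * ip (q^2) (N-k)) := by gcongr; exact qp_le_one H0 H1 _
      _ ≤ _ := by
        rw [one_mul]
        exact mul_le_mul (ip_le H0 H1 _) (ip_le H0 H1 _) n2 (inv_nonneg.2 hE.le)

/-- The Euler product at the nome `e^{-s}`. -/
noncomputable def eu (s : ℝ) : ℝ := euler (exp (-s))
/-- `∑ q^{k²+k}` at the nome `e^{-s}`. -/
noncomputable def thψ : ℝ → ℝ := expSeries (fun _ : ℤ => 1) (fun k => (k:ℝ)^2 + k)

lemma th2_eq_thψ (s : ℝ) : th2 s = exp (-s/4) * thψ s := by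
  rw [th2, thψ, expSeries, expSeries, ← tsum_mul_left]
  refine tsum_congr fun k => ?_
  rw [mul_left_comm, ← exp_add]
  congr 2
  ring

section
variable {s : ℝ} (hs : 0 < s)
include hs

lemma exp_neg_lt_one : exp (-s) < 1 := by
  rw [← exp_zero]; exact exp_lt_exp.2 (neg_neg_of_pos hs)

lemma eu_pos : 0 < eu s := euler_pos (exp_pos _) (exp_neg_lt_one hs)

omit hs in
lemma eu_nat_mul (n : ℕ) : eu (n * s) = euler (exp (-s) ^ n) := by
  rw [eu, ← exp_nat_mul]; congr 2; ring

lemma tendsto_qp_eu (n : ℕ) (hn : n ≠ 0) :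
    Tendsto (qp (exp (-s) ^ n)) atTop (𝓝 (eu (n * s))) := by
  rw [eu_nat_mul]
  exact tendsto_qp (pow_pos (exp_pos _) _) (pow_lt_one₀ (exp_pos _).le (exp_neg_lt_one hs) hn)

lemma qp_exp_pos (n : ℕ) (hn : n ≠ 0) (N : ℕ) : 0 < qp (exp (-s) ^ n) N :=
  qp_pos (pow_pos (exp_pos _) _) (pow_lt_one₀ (exp_pos _).le (exp_neg_lt_one hs) hn) N

omit hs in
lemma exp_neg_zpow (k : ℤ) : exp (-s) ^ (k^2) = exp (-s * (k:ℝ)^2) := by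
  rw [← rpow_intCast, ← exp_mul]; push_cast; rfl

lemma th4_eq : th4 s = eu s ^ 2 / eu (2*s) := by
  have hq := exp_neg_lt_one hs
  have h := jacobi_triple (exp_pos _) hq one_ne_zero
  have e1 : (∑' k : ℤ, (-1:ℂ) ^ k * ((exp (-s) ^ (k^2) : ℝ) : ℂ)) = (th4 s : ℂ) := by
    rw [th4, expSeries, Complex.ofReal_tsum]
    refine tsum_congr fun k => ?_
    rw [exp_neg_zpow]
    push_cast
    rfl
  have e2 : ∀ N : ℕ, qp (exp (-s) ^ 1) (2*N) =
      (∏ n ∈ Finset.range N, (1 - exp (-s) ^ (2*n+1))) * qp (exp (-s) ^ 2) N := by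
    intro N
    induction N with
    | zero => simp [qp]
    | succ N ih =>
      rw [show 2 * (N+1) = 2*N+1+1 by ring, qp, Finset.prod_range_succ, Finset.prod_range_succ,
        ← qp, ih, Finset.prod_range_succ, qp, qp, Finset.prod_range_succ]
      rw [pow_one, show (exp (-s)^2)^(N+1) = exp (-s)^(2*N+1+1) by ring]
      ring
  rw [e1, show (euler (exp (-s) ^ 2) : ℂ) = (eu (2*s) : ℂ) by
    rw [← eu_nat_mul]; norm_num] at h
  have p2 := eu_pos (show 0 < 2 * s by positivity)
  have h' : Tendsto (fun N => (qp (exp (-s) ^ 1) (2*N) / qp (exp (-s) ^ 2) N) ^ 2) atTop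
      (𝓝 (th4 s / eu (2*s))) := by
    rw [← tendsto_ofReal_iff]
    push_cast
    refine h.congr fun N => ?_
    have e5 := congrArg (fun x : ℝ => (x:ℂ)) (show qp (exp (-s) ^ 1) (2*N) / qp (exp (-s) ^ 2) N =
      ∏ n ∈ Finset.range N, (1 - exp (-s) ^ (2*n+1)) by
        rw [e2 N, mul_div_cancel_right₀ _ (qp_exp_pos hs 2 two_ne_zero N).ne'])
    push_cast at e5
    rw [e5, ← Finset.prod_pow]
    push_cast
    exact Finset.prod_congr rfl fun n _ => by rw [div_one, mul_one, sq]
  have t1 := (tendsto_qp_eu hs 1 one_ne_zero).comp (tendsto_id.const_mul_atTop' (two_pos : 0 < 2))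
  have t2 := tendsto_qp_eu hs 2 two_ne_zero
  push_cast at t1 t2
  rw [one_mul] at t1
  have := tendsto_nhds_unique h' ((t1.div t2 p2.ne').pow 2)
  rw [div_eq_iff p2.ne'] at this
  rw [this]
  field_simp

lemma thψ_eq : thψ s = 2 * eu (4*s) ^ 2 / eu (2*s) := by
  have hq := exp_neg_lt_one hs
  have hq0 := exp_pos (-s)
  have h := jacobi_triple hq0 hq (z := ((-exp (-s) : ℝ) : ℂ)) (by exact_mod_cast (neg_ne_zero.2 hq0.ne'))
  have e1 : (∑' k : ℤ, (-((-exp (-s) : ℝ) : ℂ)) ^ k * ((exp (-s) ^ (k^2) : ℝ) : ℂ)) = (thψ s : ℂ) := by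
    rw [thψ, expSeries, Complex.ofReal_tsum]
    refine tsum_congr fun k => ?_
    rw [exp_neg_zpow, ← Complex.ofReal_neg, neg_neg, ← Complex.ofReal_zpow, ← Complex.ofReal_mul,
      ← rpow_intCast, ← exp_mul, ← exp_add, one_mul]
    congr 2
    ring
  have e2 : ∀ N : ℕ, qp (exp (-s) ^ 4) N =
      (∏ n ∈ Finset.range N, (1 + exp (-s) ^ (2*n+2))) * qp (exp (-s) ^ 2) N := by
    intro N
    simp only [qp]
    rw [← Finset.prod_mul_distrib]
    exact Finset.prod_congr rfl fun n _ => by ring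
  have e3 : ∀ N : ℕ, (∏ n ∈ Finset.range N, (1 + exp (-s) ^ (2*n))) * (1 + exp (-s) ^ (2*N)) =
      2 * ∏ n ∈ Finset.range N, (1 + exp (-s) ^ (2*n+2)) := by
    intro N
    rw [← Finset.prod_range_succ (fun n => 1 + exp (-s) ^ (2*n)), Finset.prod_range_succ', mul_comm]
    norm_num
    exact Finset.prod_congr rfl fun n _ => by ring
  rw [e1, show (euler (exp (-s) ^ 2) : ℂ) = (eu (2*s) : ℂ) by
    rw [← eu_nat_mul]; norm_num] at h
  have p2 := eu_pos (show 0 < 2 * s by positivity)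
  have h' : Tendsto (fun N => 2 * (qp (exp (-s) ^ 4) N / qp (exp (-s) ^ 2) N) ^ 2 /
      (1 + exp (-s) ^ (2*N))) atTop (𝓝 (thψ s / eu (2*s))) := by
    rw [← tendsto_ofReal_iff]
    push_cast
    refine h.congr fun N => ?_
    have e4 : 2 * (qp (exp (-s) ^ 4) N / qp (exp (-s) ^ 2) N) ^ 2 / (1 + exp (-s) ^ (2*N)) =
        ∏ n ∈ Finset.range N, ((1 + exp (-s) ^ (2*n+2)) * (1 + exp (-s) ^ (2*n))) := by
      rw [e2 N, mul_div_cancel_right₀ _ (qp_exp_pos hs 2 two_ne_zero N).ne',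
        div_eq_iff (by positivity), Finset.prod_mul_distrib, mul_assoc, e3 N]
      ring
    have e5 := congrArg (fun x : ℝ => (x:ℂ)) e4
    push_cast at e5
    rw [e5]
    refine Finset.prod_congr rfl fun n _ => ?_
    have hz' : Complex.exp (-(s:ℂ)) ≠ 0 := Complex.exp_ne_zero _
    push_cast
    field_simp
    ring
  have t4 := tendsto_qp_eu hs 4 (by norm_num)
  have t2 := tendsto_qp_eu hs 2 two_ne_zero
  push_cast at t4 t2
  have t0 : Tendsto (fun N : ℕ => 1 + exp (-s) ^ (2*N)) atTop (𝓝 (1 + 0)) := by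
    refine Tendsto.const_add _ ?_
    exact (tendsto_pow_atTop_nhds_zero_of_lt_one hq0.le hq).comp
      (tendsto_id.const_mul_atTop' (two_pos : 0 < 2))
  have := tendsto_nhds_unique h' ((((t4.div t2 p2.ne').pow 2).const_mul 2).div t0 (by norm_num))
  rw [div_eq_iff p2.ne'] at this
  rw [this]
  field_simp
  ring

end

/-! ### Trigonometric series -/

section Trig
variable {ι : Type*} {b l : ι → ℝ}

lemma summable_mul_pow_of_four (h0 : Summable fun i => |b i|) (h4 : Summable fun i => |b i * l i ^ 4|)
    {j : ℕ} (hj : j ≤ 4) : Summable fun i => |b i * l i ^ j| := by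
  refine Summable.of_nonneg_of_le (fun i => abs_nonneg _) (fun i => ?_) (h0.add h4)
  rw [abs_mul, abs_mul, abs_pow, abs_pow]
  have : |l i| ^ j ≤ 1 + |l i| ^ 4 := by
    rcases le_total (|l i|) 1 with h | h
    · have := pow_le_one₀ (n := j) (abs_nonneg (l i)) h
      have : 0 ≤ |l i| ^ 4 := by positivity
      linarith
    · have := pow_le_pow_right₀ h hj
      linarith
  nlinarith [abs_nonneg (b i)]

lemma hasDerivAt_cosSeries (h0 : Summable fun i => |b i|) (h1 : Summable fun i => |b i * l i|)
    (x : ℝ) : HasDerivAt (fun x => ∑' i, b i * cos (l i * x)) (-∑' i, b i * l i * sin (l i * x)) x := by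
  rw [← tsum_neg]
  refine hasDerivAt_tsum h1 (g := fun i x => b i * cos (l i * x))
    (g' := fun i x => -(b i * l i * sin (l i * x))) (fun i y => ?_) (fun i y => ?_)
    (y₀ := 0) ?_ x
  · have := (((hasDerivAt_id y).const_mul (l i)).cos).const_mul (b i)
    convert! this using 1
    simp; ring
  · rw [norm_neg, norm_mul, Real.norm_eq_abs, Real.norm_eq_abs]
    exact mul_le_of_le_one_right (abs_nonneg _) (abs_sin_le_one _)
  · simpa using h0.of_abs

lemma hasDerivAt_sinSeries (h1 : Summable fun i => |b i * l i|)
    (x : ℝ) : HasDerivAt (fun x => ∑' i, b i * sin (l i * x)) (∑' i, b i * l i * cos (l i * x)) x := by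
  refine hasDerivAt_tsum h1 (g := fun i x => b i * sin (l i * x))
    (g' := fun i x => b i * l i * cos (l i * x)) (fun i y => ?_) (fun i y => ?_)
    (y₀ := 0) ?_ x
  · have := (((hasDerivAt_id y).const_mul (l i)).sin).const_mul (b i)
    convert! this using 1
    simp; ring
  · rw [norm_mul, Real.norm_eq_abs, Real.norm_eq_abs]
    exact mul_le_of_le_one_right (abs_nonneg _) (abs_cos_le_one _)
  · simp only [mul_zero, sin_zero]; exact summable_zero

lemma exists_cosSeries_derivs (h0 : Summable fun i => |b i|) (h4 : Summable fun i => |b i * l i ^ 4|) :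
    ∃ F1 F2 F3 F4 : ℝ → ℝ, (∀ x, HasDerivAt (fun x => ∑' i, b i * cos (l i * x)) (F1 x) x) ∧
      (∀ x, HasDerivAt F1 (F2 x) x) ∧ (∀ x, HasDerivAt F2 (F3 x) x) ∧ (∀ x, HasDerivAt F3 (F4 x) x) ∧
      F1 0 = 0 ∧ F2 0 = -∑' i, b i * l i ^ 2 ∧ F3 0 = 0 ∧ F4 0 = ∑' i, b i * l i ^ 4 := by
  have s1 : Summable fun i => |b i * l i| := by
    simpa using summable_mul_pow_of_four h0 h4 (j := 1) (by norm_num)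
  have s2 : Summable fun i => |b i * l i * l i| := by
    simpa [pow_two, mul_assoc] using summable_mul_pow_of_four h0 h4 (j := 2) (by norm_num)
  have s3 : Summable fun i => |b i * l i * l i * l i| := by
    simpa [pow_succ, mul_assoc] using summable_mul_pow_of_four h0 h4 (j := 3) (by norm_num)
  have s4 : Summable fun i => |b i * l i * l i * l i * l i| := by
    simpa [pow_succ, mul_assoc] using h4
  refine ⟨_, _, _, _, fun x => hasDerivAt_cosSeries h0 s1 x,
    fun x => (hasDerivAt_sinSeries s2 x).neg, fun x => (hasDerivAt_cosSeries s2 s3 x).neg,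
    fun x => (hasDerivAt_sinSeries s4 x).neg.neg, by simp, ?_, by simp, ?_⟩
  · simp [pow_two, mul_assoc]
  · simp [pow_succ, mul_assoc]

/-- If a cosine series equals `C` times the exponential of another cosine series, then their second
and fourth moments are related. -/
lemma moments_of_exp {κ : Type*} {b' l' : κ → ℝ} {C : ℝ} (h0 : Summable fun i => |b i|)
    (h4 : Summable fun i => |b i * l i ^ 4|) (k0 : Summable fun i => |b' i|)
    (k4 : Summable fun i => |b' i * l' i ^ 4|)
    (h : ∀ x, ∑' i, b i * cos (l i * x) = C * exp (∑' i, b' i * cos (l' i * x))) :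
    ∑' i, b i * l i ^ 2 = (∑' i, b' i * l' i ^ 2) * ∑' i, b i ∧
    ∑' i, b i * l i ^ 4 = (∑' i, b' i * l' i ^ 4) * (∑' i, b i)
      + 3 * (∑' i, b' i * l' i ^ 2) * (∑' i, b i * l i ^ 2) := by
  obtain ⟨F1, F2, F3, F4, f1, f2, f3, f4, v1, v2, v3, v4⟩ := exists_cosSeries_derivs h0 h4
  obtain ⟨G1, G2, G3, G4, g1, g2, g3, g4, w1, w2, w3, w4⟩ := exists_cosSeries_derivs k0 k4
  have hF : (fun x => ∑' i, b i * cos (l i * x)) = fun x => C * exp (∑' i, b' i * cos (l' i * x)) :=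
    funext h
  have e1 : F1 = fun x => G1 x * ∑' i, b i * cos (l i * x) := by
    ext x
    refine (f1 x).unique ?_
    rw [hF]
    convert! ((g1 x).exp.const_mul C) using 1
    rw [h x]; ring
  have e2 : F2 = fun x => G2 x * (∑' i, b i * cos (l i * x)) + G1 x * F1 x := by
    ext x
    refine (f2 x).unique ?_
    rw [e1]
    convert! (g2 x).mul (f1 x) using 1
    rw [e1]
  have e3 : F3 = fun x => (G3 x * (∑' i, b i * cos (l i * x)) + G2 x * F1 x) +
      (G2 x * F1 x + G1 x * F2 x) := by
    ext x
    refine (f3 x).unique ?_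
    rw [e2]
    convert! ((g3 x).mul (f1 x)).add ((g2 x).mul (f2 x)) using 1
    rw [e2]
  have e4 : F4 0 = ((G4 0 * (∑' i, b i * cos (l i * 0)) + G3 0 * F1 0) + (G3 0 * F1 0 + G2 0 * F2 0)) +
      ((G3 0 * F1 0 + G2 0 * F2 0) + (G2 0 * F2 0 + G1 0 * F3 0)) := by
    refine (f4 0).unique ?_
    rw [e3]
    convert! (((g4 0).mul (f1 0)).add ((g3 0).mul (f2 0))).add
      (((g3 0).mul (f2 0)).add ((g2 0).mul (f3 0))) using 1
    rw [e3]
  have e20 := congrFun e2 0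
  simp only [mul_zero, cos_zero, mul_one, v1, v2, v3, v4, w1, w2, w3, w4] at e4 e20
  constructor
  · linarith
  · linarith

end Trig

/-! ### Lambert series -/

lemma ExpSummable.of_abs_le {ι : Type*} {c d l : ι → ℝ} (h : ExpSummable d l)
    (hc : ∀ i, |c i| ≤ |d i|) : ExpSummable c l :=
  ⟨h.nonneg, fun s hs => Summable.of_nonneg_of_le (fun i => by positivity)
    (fun i => mul_le_mul_of_nonneg_right (hc i) (exp_pos _).le) (h.summable s hs)⟩

lemma ExpSummable.comp_injective {ι κ : Type*} {c l : ι → ℝ} (h : ExpSummable c l) {f : κ → ι}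
    (hf : Function.Injective f) : ExpSummable (fun i => c (f i)) (fun i => l (f i)) :=
  ⟨fun _ => h.nonneg _, fun s hs => (h.summable s hs).comp_injective hf⟩

/-- The exponents `(n+1)(m+1)` of a Lambert series. -/
def lamExp (p : ℕ × ℕ) : ℝ := ((p.1:ℝ)+1) * ((p.2:ℝ)+1)

lemma lamExp_pos (p : ℕ × ℕ) : 0 < lamExp p := by unfold lamExp; positivity

lemma succ_le_lamExp (p : ℕ × ℕ) : (p.2:ℝ)+1 ≤ lamExp p := by
  unfold lamExp
  nlinarith [Nat.cast_nonneg (α := ℝ) p.1, Nat.cast_nonneg (α := ℝ) p.2]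

lemma expSummable_lamExp : ExpSummable (fun _ => 1) lamExp := by
  refine ⟨fun p => (lamExp_pos p).le, fun s hs => ?_⟩
  have h : Summable fun n : ℕ => exp (-s * (n:ℝ)) := by
    simpa [mul_comm] using Real.summable_exp_nat_mul_iff.mpr (neg_neg_of_pos hs)
  refine Summable.of_nonneg_of_le (fun i => by positivity) (fun p => ?_)
    (h.mul_of_nonneg h (fun n => (exp_pos _).le) (fun n => (exp_pos _).le))
  rw [abs_one, one_mul, ← exp_add]
  apply exp_le_exp.2
  unfold lamExp
  have : (0:ℝ) ≤ p.1 * p.2 := by positivity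
  nlinarith

lemma expSummable_lamExp_pow (j : ℕ) : ExpSummable (fun p => lamExp p ^ j) lamExp := by
  induction j with
  | zero => simpa using expSummable_lamExp
  | succ j ih => simpa only [pow_succ] using ih.mul_exponent

lemma expSummable_lamExp_of_le {c : ℕ × ℕ → ℝ} (j : ℕ) (hc : ∀ p, |c p| ≤ lamExp p ^ j) :
    ExpSummable c lamExp :=
  (expSummable_lamExp_pow j).of_abs_le fun p => (hc p).trans (le_abs_self _)

/-- The exponents `(2 n + 1) (m + 1)`. -/
def oddExp (p : ℕ × ℕ) : ℝ := lamExp (2 * p.1, p.2)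

lemma oddExp_eq (p : ℕ × ℕ) : oddExp p = ((2 * p.1 + 1 : ℕ) : ℝ) * ((p.2 + 1 : ℕ) : ℝ) := by
  unfold oddExp lamExp; push_cast; ring

lemma inj_double : Function.Injective fun p : ℕ × ℕ => (2 * p.1, p.2) := by
  rintro ⟨a, b⟩ ⟨c, d⟩ h
  simp only [Prod.mk.injEq] at h ⊢
  omega

lemma expSummable_oddExp_pow (j : ℕ) : ExpSummable (fun p => ((p.2:ℝ)+1) ^ j) oddExp := by
  have := (expSummable_lamExp_of_le (c := fun p => ((p.2:ℝ)+1) ^ j) j (fun p => ?_)).comp_injective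
    inj_double
  · exact this
  · rw [abs_of_nonneg (by positivity)]
    gcongr
    exact succ_le_lamExp p

/-- The Lambert series `∑ (m+1)³ q^{(2 n + 1) (m + 1)}` at the nome `e^{-s}`. -/
noncomputable def oddLambert : ℝ → ℝ := expSeries (fun p : ℕ × ℕ => ((p.2:ℝ)+1) ^ 3) oddExp

lemma factor_eq_exp {r : ℝ} (h0 : 0 ≤ r) (h1 : r < 1) (x : ℝ) :
    ∃ a : ℝ, HasSum (fun k : ℕ => -2 * r ^ (k+1) / (k+1) * cos ((k+1) * x)) a ∧
      (1 - (r:ℂ) * Complex.exp (x * Complex.I)) * (1 - (r:ℂ) / Complex.exp (x * Complex.I)) =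
        ((exp a : ℝ) : ℂ) := by
  have hn : ‖(r:ℂ) * Complex.exp (x * Complex.I)‖ < 1 := by
    rw [norm_mul, Complex.norm_exp_ofReal_mul_I, mul_one, Complex.norm_real, Real.norm_eq_abs,
      abs_of_nonneg h0]; exact h1
  have hn' : ‖(r:ℂ) * Complex.exp (-x * Complex.I)‖ < 1 := by
    rw [norm_mul, ← Complex.ofReal_neg, Complex.norm_exp_ofReal_mul_I, mul_one, Complex.norm_real,
      Real.norm_eq_abs, abs_of_nonneg h0]; exact h1
  have e : (r:ℂ) / Complex.exp (x * Complex.I) = (r:ℂ) * Complex.exp (-x * Complex.I) := by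
    rw [neg_mul, Complex.exp_neg, div_eq_mul_inv]
  have hs := ((Complex.hasSum_taylorSeries_neg_log' hn).add
    (Complex.hasSum_taylorSeries_neg_log' hn')).neg
  have ht : ∀ k : ℕ, -(((r:ℂ) * Complex.exp (x * Complex.I)) ^ (k+1) / (k+1) +
      ((r:ℂ) * Complex.exp (-x * Complex.I)) ^ (k+1) / (k+1)) =
      ((-2 * r ^ (k+1) / (k+1) * cos ((k+1) * x) : ℝ) : ℂ) := by
    intro k
    push_cast
    rw [Complex.cos, mul_pow, mul_pow, ← Complex.exp_nat_mul, ← Complex.exp_nat_mul]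
    push_cast
    rw [show ((k:ℂ)+1) * (x * Complex.I) = ((k:ℂ)+1) * x * Complex.I by ring,
      show ((k:ℂ)+1) * (-x * Complex.I) = -(((k:ℂ)+1) * x) * Complex.I by ring]
    ring
  simp_rw [ht] at hs
  have hsum := Complex.summable_ofReal.1 hs.summable
  refine ⟨_, hsum.hasSum, ?_⟩
  have hu := hs.unique (Complex.hasSum_ofReal.2 hsum.hasSum)
  rw [Complex.ofReal_exp, ← hu, neg_add, neg_neg, neg_neg, Complex.exp_add, Complex.exp_log,
    Complex.exp_log, e]
  · intro h0; rw [sub_eq_zero] at h0; rw [← h0] at hn'; simp at hn'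
  · intro h0; rw [sub_eq_zero] at h0; rw [← h0] at hn; simp at hn

section
variable {s : ℝ} (hs : 0 < s)
include hs

lemma summable_log_triple : Summable fun p : ℕ × ℕ => |-2 * exp (-s * oddExp p) / ((p.2:ℝ)+1)| := by
  refine Summable.of_nonneg_of_le (fun _ => abs_nonneg _) (fun p => ?_)
    (((expSummable_oddExp_pow 0).summable s hs).mul_left 2)
  rw [abs_div, abs_mul, abs_exp, pow_zero, abs_one, one_mul, abs_of_pos (by positivity : (0:ℝ) < p.2+1),
    abs_neg, abs_two]
  exact div_le_self (by positivity) (by linarith [Nat.cast_nonneg (α := ℝ) p.2])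

lemma theta_eq_exp (x : ℝ) : ∑' k : ℤ, (-1) ^ k * exp (-s * (k:ℝ)^2) * cos (k * x) =
    euler (exp (-s) ^ 2) *
      exp (∑' p : ℕ × ℕ, -2 * exp (-s * oddExp p) / ((p.2:ℝ)+1) * cos (((p.2:ℝ)+1) * x)) := by
  have hq0 := exp_pos (-s)
  have hq := exp_neg_lt_one hs
  have h := jacobi_triple hq0 hq (Complex.exp_ne_zero (x * Complex.I))
  have hE : 0 < euler (exp (-s) ^ 2) := euler_pos (by positivity) (pow_lt_one₀ hq0.le hq two_ne_zero)
  choose a ha ha' using fun n : ℕ => factor_eq_exp (pow_pos hq0 (2*n+1)).le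
    (pow_lt_one₀ hq0.le hq (by omega : 2*n+1 ≠ 0)) x
  have hsum : Summable fun p : ℕ × ℕ => -2 * exp (-s * oddExp p) / ((p.2:ℝ)+1) * cos (((p.2:ℝ)+1) * x) := by
    refine Summable.of_norm_bounded (summable_log_triple hs) fun p => ?_
    rw [norm_mul, Real.norm_eq_abs, Real.norm_eq_abs]
    exact mul_le_of_le_one_right (abs_nonneg _) (abs_cos_le_one _)
  have hA := hsum.hasSum.prod_fiberwise (g := a) fun n => by
    convert! ha n using 2 with k
    rw [oddExp_eq, ← pow_mul, ← exp_nat_mul]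
    push_cast
    congr 4
    ring
  have h1 : Tendsto (fun N => exp (∑ n ∈ Finset.range N, a n)) atTop
      (𝓝 (exp (∑' p : ℕ × ℕ, -2 * exp (-s * oddExp p) / ((p.2:ℝ)+1) * cos (((p.2:ℝ)+1) * x)))) :=
    (continuous_exp.tendsto _).comp hA.tendsto_sum_nat
  have h2 := ((Complex.continuous_re.tendsto _).comp h).congr (f₂ := fun N => exp (∑ n ∈ Finset.range N, a n))
    fun N => by
      rw [Function.comp_apply, exp_sum]
      have : ∀ n ∈ Finset.range N, (1 - ((exp (-s) : ℝ) : ℂ) ^ (2*n+1) * Complex.exp (x * Complex.I)) *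
          (1 - ((exp (-s) : ℝ) : ℂ) ^ (2*n+1) / Complex.exp (x * Complex.I)) = ((exp (a n) : ℝ) : ℂ) :=
        fun n _ => by rw [← ha' n]; push_cast; rfl
      rw [Finset.prod_congr rfl this, ← Complex.ofReal_prod, Complex.ofReal_re]
  have h3 := tendsto_nhds_unique h1 h2
  rw [h3, Complex.div_ofReal_re, mul_div_cancel₀ _ hE.ne']
  have ht : ∀ k : ℤ, (-Complex.exp (x * Complex.I)) ^ k * ((exp (-s) ^ (k^2) : ℝ) : ℂ) =
      (((-1) ^ k * exp (-s * (k:ℝ)^2) : ℝ) : ℂ) * Complex.exp ((k * x : ℝ) * Complex.I) := by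
    intro k
    rw [exp_neg_zpow, neg_eq_neg_one_mul, mul_zpow, ← Complex.exp_int_mul]
    push_cast
    rw [mul_assoc (k:ℂ)]
    ring
  simp_rw [ht]
  rw [Complex.re_tsum]
  · refine tsum_congr fun k => ?_
    rw [Complex.re_ofReal_mul, Complex.exp_ofReal_mul_I_re]
  · refine Summable.of_norm_bounded (expSummable_th4.summable s hs) fun k => ?_
    rw [norm_mul, Complex.norm_exp_ofReal_mul_I, mul_one, Complex.norm_real, Real.norm_eq_abs, abs_mul,
      abs_exp]

theorem oddLambert_eq : oddLambert s = 1/16 * (th2 s * th3 s) ^ 4 := by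
  have hm := moments_of_exp (b := fun k : ℤ => (-1) ^ k * exp (-s * (k:ℝ)^2)) (l := fun k => (k:ℝ))
    (b' := fun p : ℕ × ℕ => -2 * exp (-s * oddExp p) / ((p.2:ℝ)+1)) (l' := fun p => (p.2:ℝ)+1)
    (C := euler (exp (-s) ^ 2)) ?_ ?_ (summable_log_triple hs) ?_ (theta_eq_exp hs)
  · have e0 : ∑' k : ℤ, (-1) ^ k * exp (-s * (k:ℝ)^2) = th4 s := rfl
    have e2 : ∑' k : ℤ, (-1) ^ k * exp (-s * (k:ℝ)^2) * (k:ℝ)^2 =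
        expSeries (fun k : ℤ => (-1) ^ k * (k:ℝ)^2) (fun k => (k:ℝ)^2) s :=
      tsum_congr fun k => by ring
    have e4 : ∑' k : ℤ, (-1) ^ k * exp (-s * (k:ℝ)^2) * (k:ℝ)^4 =
        expSeries (fun k : ℤ => (-1) ^ k * (k:ℝ)^2 * (k:ℝ)^2) (fun k => (k:ℝ)^2) s :=
      tsum_congr fun k => by ring
    have eL : ∑' p : ℕ × ℕ, -2 * exp (-s * oddExp p) / ((p.2:ℝ)+1) * ((p.2:ℝ)+1)^4 = -2 * oddLambert s := by
      rw [oddLambert, expSeries, ← tsum_mul_left]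
      refine tsum_congr fun p => ?_
      have : (p.2:ℝ)+1 ≠ 0 := by positivity
      field_simp
    rw [e0, e2, e4, eL] at hm
    obtain ⟨m2, m4⟩ := hm
    have h := dT4_eq hs
    have p4 := (th4_pos hs).ne'
    rw [dT4, dlgd, T4, lgd, m4, m2, ← th4] at h
    have : (-2 * oddLambert s * th4 s + 3 * (∑' p : ℕ × ℕ, -2 * exp (-s * oddExp p) / ((p.2:ℝ)+1) *
        ((p.2:ℝ)+1)^2) * ((∑' p : ℕ × ℕ, -2 * exp (-s * oddExp p) / ((p.2:ℝ)+1) *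
        ((p.2:ℝ)+1)^2) * th4 s)) / th4 s = -2 * oddLambert s + 3 * (∑' p : ℕ × ℕ, -2 * exp (-s * oddExp p) /
        ((p.2:ℝ)+1) * ((p.2:ℝ)+1)^2) ^ 2 := by field_simp
    rw [this, mul_div_cancel_right₀ _ p4] at h
    linarith
  · simpa only [abs_mul, abs_exp] using expSummable_th4.summable s hs
  · have := expSummable_th4.mul_exponent.mul_exponent.summable s hs
    refine this.congr fun k => ?_
    rw [← abs_exp (-s * (k:ℝ)^2), ← abs_mul]
    congr 1
    rw [abs_exp]
    ring
  · refine ((expSummable_oddExp_pow 3).summable s hs).mul_left 2 |>.congr fun p => ?_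
    have : (p.2:ℝ)+1 ≠ 0 := by positivity
    rw [← abs_exp (-s * oddExp p), ← abs_mul, ← abs_two, ← abs_mul, abs_two, ← abs_neg]
    congr 1
    rw [abs_exp]
    field_simp

end

/-- `∑ q^{n m}/n³` over `n, m ≥ 1` at the nome `e^{-s}`. -/
noncomputable def lamR : ℝ → ℝ := expSeries (fun p => 1 / ((p.1:ℝ)+1)^3) lamExp

lemma expSummable_lamR : ExpSummable (fun p => 1 / ((p.1:ℝ)+1)^3) lamExp := by
  refine expSummable_lamExp_of_le 0 fun p => ?_
  rw [abs_of_nonneg (by positivity), pow_zero, div_le_one (by positivity)]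
  exact one_le_pow₀ (by linarith [Nat.cast_nonneg (α := ℝ) p.1])

/-- `∑ m³ q^{n m}` over `n, m ≥ 1` at the nome `e^{-s}`. -/
noncomputable def lamE : ℝ → ℝ := expSeries (fun p => ((p.2:ℝ)+1)^3) lamExp

lemma expSummable_lamE : ExpSummable (fun p => ((p.2:ℝ)+1)^3) lamExp := by
  refine expSummable_lamExp_of_le 3 fun p => ?_
  rw [abs_of_nonneg (by positivity)]
  gcongr
  exact succ_le_lamExp p

lemma exists_lamR_derivs : ∃ R1 R2 : ℝ → ℝ, ∀ s, 0 < s → HasDerivAt lamR (-R1 s) s ∧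
    HasDerivAt R1 (-R2 s) s ∧ HasDerivAt R2 (-lamE s) s := by
  refine ⟨_, _, fun s hs => ⟨expSummable_lamR.hasDerivAt hs,
    expSummable_lamR.mul_exponent.hasDerivAt hs, ?_⟩⟩
  convert! expSummable_lamR.mul_exponent.mul_exponent.hasDerivAt hs using 2
  unfold lamE
  congr 1
  ext p
  have : (p.1:ℝ)+1 ≠ 0 := by positivity
  unfold lamExp
  field_simp

lemma lamE_sub {s : ℝ} (hs : 0 < s) : lamE s - lamE (2*s) = oddLambert s := by
  have h := expSummable_lamE.summable' hs
  have e1 : lamE s = ∑' n : ℕ, ∑' m : ℕ, ((m:ℝ)+1)^3 * exp (-s * lamExp (n, m)) :=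
    h.tsum_prod
  have e2 : oddLambert s = ∑' n : ℕ, ∑' m : ℕ, ((m:ℝ)+1)^3 * exp (-s * lamExp (2*n, m)) :=
    ((expSummable_oddExp_pow 3).summable' hs).tsum_prod
  have e3 : lamE (2*s) = ∑' n : ℕ, ∑' m : ℕ, ((m:ℝ)+1)^3 * exp (-s * lamExp (2*n+1, m)) := by
    refine ((expSummable_lamE.summable' (by positivity : 0 < 2*s)).tsum_prod).trans ?_
    refine tsum_congr fun n => tsum_congr fun m => ?_
    unfold lamExp
    push_cast
    congr 2
    ring
  have hs' := h.prod
  have := tsum_even_add_odd (f := fun n : ℕ => ∑' m : ℕ, ((m:ℝ)+1)^3 * exp (-s * lamExp (n, m)))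
    (hs'.comp_injective (mul_right_injective₀ (two_ne_zero' ℕ)))
    (hs'.comp_injective ((add_left_injective 1).comp (mul_right_injective₀ (two_ne_zero' ℕ))))
  rw [e1, e2, e3, ← this]
  ring

lemma sum_zeta3_pos : Summable fun k : ℕ => 1 / ((k:ℝ)+1)^3 := by
  have := (summable_nat_add_iff 1).2 (Real.summable_one_div_nat_pow.2 (by norm_num : 1 < 3))
  simpa using this

/-- `½ζ(3) + ∑ q^{nm}/n³`. -/
noncomputable def lamV (s : ℝ) : ℝ := 1/2 * zeta3 + lamR s

/-- The Eichler integral of the inhomogeneous term. -/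
noncomputable def GG (s : ℝ) : ℝ := 24 * lamV s - 3 * lamV (2*s) - 8 * lamV (3*s) + lamV (6*s)

lemma exists_GG_derivs : ∃ G1 G2 : ℝ → ℝ, ∀ s, 0 < s → HasDerivAt GG (-G1 s) s ∧
    HasDerivAt G1 (-G2 s) s ∧ HasDerivAt G2 (-(24 * (B2 s * AA s))) s := by
  obtain ⟨R1, R2, hR⟩ := exists_lamR_derivs
  refine ⟨fun s => 24 * R1 s - 6 * R1 (2*s) - 24 * R1 (3*s) + 6 * R1 (6*s),
    fun s => 24 * R2 s - 12 * R2 (2*s) - 72 * R2 (3*s) + 36 * R2 (6*s), fun s hs => ?_⟩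
  obtain ⟨a1, b1, c1⟩ := hR s hs
  obtain ⟨a2, b2, c2⟩ := hR (2*s) (by positivity)
  obtain ⟨a3, b3, c3⟩ := hR (3*s) (by positivity)
  obtain ⟨a6, b6, c6⟩ := hR (6*s) (by positivity)
  refine ⟨?_, ?_, ?_⟩
  · convert! ((((a1.const_add (1/2 * zeta3)).const_mul 24).fun_sub
      (((hasDerivAt_scale 2 a2).const_add (1/2 * zeta3)).const_mul 3)).fun_sub
      (((hasDerivAt_scale 3 a3).const_add (1/2 * zeta3)).const_mul 8)).fun_add
      ((hasDerivAt_scale 6 a6).const_add (1/2 * zeta3)) using 1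
    ring
  · convert! (((b1.const_mul 24).fun_sub ((hasDerivAt_scale 2 b2).const_mul 6)).fun_sub
      ((hasDerivAt_scale 3 b3).const_mul 24)).fun_add ((hasDerivAt_scale 6 b6).const_mul 6) using 1
    ring
  · convert! (((c1.const_mul 24).fun_sub ((hasDerivAt_scale 2 c2).const_mul 12)).fun_sub
      ((hasDerivAt_scale 3 c3).const_mul 72)).fun_add ((hasDerivAt_scale 6 c6).const_mul 36) using 1
    have h1 := lamE_sub hs
    have h3 := lamE_sub (by positivity : 0 < 3*s)
    rw [show 2 * (3*s) = 6*s by ring] at h3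
    have h := sixteen_B2_mul_AA hs
    rw [oddLambert_eq hs] at h1
    rw [oddLambert_eq (by positivity)] at h3
    linarith

lemma tendsto_GG : Tendsto GG atTop (𝓝 (7 * zeta3)) := by
  have h : Tendsto lamR atTop (𝓝 0) := by
    have := expSummable_lamR.tendsto
    simp only [(lamExp_pos _).ne', if_false, tsum_zero] at this
    exact this
  have hV : ∀ c : ℝ, 0 < c → Tendsto (fun s => lamV (c*s)) atTop (𝓝 (1/2 * zeta3)) := by
    intro c hc
    simpa [lamV] using (h.comp (tendsto_id.const_mul_atTop hc)).const_add (1/2 * zeta3)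
  have h1 := hV 1 one_pos
  simp only [one_mul] at h1
  have := (((h1.const_mul 24).sub ((hV 2 (by norm_num)).const_mul 3)).sub
    ((hV 3 (by norm_num)).const_mul 8)).add (hV 6 (by norm_num))
  convert! this using 2
  ring

/-- A function on `(0, ∞)` with vanishing third derivative and limit `0` at infinity is zero. -/
lemma eq_zero_of_third_deriv {f f1 f2 : ℝ → ℝ} (h0 : ∀ s, 0 < s → HasDerivAt f (f1 s) s)
    (h1 : ∀ s, 0 < s → HasDerivAt f1 (f2 s) s) (h2 : ∀ s, 0 < s → HasDerivAt f2 0 s)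
    (hf : Tendsto f atTop (𝓝 0)) {s : ℝ} (hs : 0 < s) : f s = 0 := by
  have const : ∀ g : ℝ → ℝ, (∀ s, 0 < s → HasDerivAt g 0 s) → ∀ s, 0 < s → g s = g 1 := by
    intro g hg s hs
    exact isOpen_Ioi.is_const_of_deriv_eq_zero isPreconnected_Ioi
      (fun x hx => (hg x hx).differentiableAt.differentiableWithinAt)
      (fun x hx => (hg x hx).deriv) (Set.mem_Ioi.2 hs) (Set.mem_Ioi.2 one_pos)
  obtain ⟨c, hc⟩ : ∃ c, ∀ s, 0 < s → f2 s = 2*c :=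
    ⟨f2 1 / 2, fun s hs => by rw [const f2 h2 s hs]; ring⟩
  obtain ⟨b, hb⟩ : ∃ b, ∀ s, 0 < s → f1 s = b + 2*c*s := by
    refine ⟨f1 1 - 2*c*1, fun s hs => ?_⟩
    have := const (fun s => f1 s - 2*c*s) (fun s hs => by
      convert! (h1 s hs).fun_sub ((hasDerivAt_id s).const_mul (2*c)) using 1
      rw [hc s hs]; ring) s hs
    linarith
  obtain ⟨a, ha⟩ : ∃ a, ∀ s, 0 < s → f s = a + b*s + c*s^2 := by
    refine ⟨f 1 - b - c, fun s hs => ?_⟩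
    have := const (fun s => f s - (b*s + c*s^2)) (fun s hs => by
      convert! (h0 s hs).fun_sub (((hasDerivAt_id s).const_mul b).fun_add
        (((hasDerivAt_id s).fun_pow 2).const_mul c)) using 1
      rw [hb s hs]; simp; ring) s hs
    linarith
  have i1 : Tendsto (fun s : ℝ => s⁻¹) atTop (𝓝 0) := tendsto_inv_atTop_zero
  have hc0 : c = 0 := by
    have t1 := hf.mul (i1.mul i1)
    have t2 : Tendsto (fun s => f s * (s⁻¹ * s⁻¹)) atTop (𝓝 (a * (0 * 0) + b * 0 + c)) := by
      refine ((((i1.mul i1).const_mul a).add (i1.const_mul b)).add_const c).congr' ?_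
      filter_upwards [eventually_gt_atTop 0] with s hs
      rw [ha s hs]; field_simp
    simpa using tendsto_nhds_unique t2 t1
  subst hc0
  have hb0 : b = 0 := by
    have t1 := hf.mul i1
    have t2 : Tendsto (fun s => f s * s⁻¹) atTop (𝓝 (a * 0 + b)) := by
      refine ((i1.const_mul a).add_const b).congr' ?_
      filter_upwards [eventually_gt_atTop 0] with s hs
      rw [ha s hs]; field_simp; ring
    simpa using tendsto_nhds_unique t2 t1
  subst hb0
  have ha0 : a = 0 := by
    refine tendsto_nhds_unique ?_ hf
    refine tendsto_const_nhds.congr' ?_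
    filter_upwards [eventually_gt_atTop 0] with s hs
    rw [ha s hs]; ring
  rw [ha s hs, ha0]; ring

section
variable {s : ℝ} (hs : 0 < s)
include hs

lemma hasDerivAt_AA : HasDerivAt AA (-(hh s * AA s +
    A2 s ^ 2 * tt s * ((-1/4) * (1 - tt s / 16) + (1 - tt s / 4) * (-1/16)) / 2)) s := by
  have h3 : 0 < 3 * s := by positivity
  have hp := AA_pos hs
  obtain ⟨d, hd⟩ : ∃ d, HasDerivAt AA d s :=
    ⟨_, (((hasDerivAt_T2 hs).fun_add (hasDerivAt_T3 hs)).fun_sub ((hasDerivAt_T4 hs).const_mul 2)).fun_add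
      ((((hasDerivAt_scale 3 (hasDerivAt_T2 h3)).fun_add (hasDerivAt_scale 3 (hasDerivAt_T3 h3))).fun_sub
      ((hasDerivAt_scale 3 (hasDerivAt_T4 h3)).const_mul 2)).const_mul 3)⟩
  convert hd using 1
  have e := deriv_eq_of_eq hs (fun u hu => AA_sq' hu) (hd.fun_pow 2)
    (((hasDerivAt_A2 hs).fun_pow 2).fun_mul
      ((((hasDerivAt_tt hs).div_const 4).const_sub 1).fun_mul (((hasDerivAt_tt hs).div_const 16).const_sub 1)))
  have sq := AA_sq' hs
  norm_num at e
  refine (mul_left_cancel₀ (mul_pos two_pos hp).ne' ?_).symm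
  rw [e]
  linear_combination (2 * hh s) * sq

lemma tt_neg : tt s < 0 := by
  have h1 := A2_pos hs
  have h2 := B2_pos hs
  rw [tt, div_neg_iff]
  right
  exact ⟨by linarith, h1⟩

end

lemma tendsto_th2 : Tendsto th2 atTop (𝓝 0) := by
  have := expSummable_th2.tendsto
  have h0 : ∀ k : ℤ, ((k:ℝ)+1/2)^2 ≠ 0 := fun k h => by
    have h1 : 2 * (k:ℝ) + 1 = 0 := by have := pow_eq_zero_iff (two_ne_zero) |>.1 h; linarith
    have h2 : 2 * k + 1 = 0 := by exact_mod_cast h1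
    omega
  simp only [h0, if_false, tsum_zero] at this
  exact this

lemma tendsto_A2 : Tendsto A2 atTop (𝓝 1) := by
  have := (tendsto_th4.mul (tendsto_th4.comp (tendsto_id.const_mul_atTop (by norm_num : (0:ℝ) < 3)))).pow 2
  simp only [mul_one, one_pow] at this
  exact this

lemma tendsto_tt : Tendsto tt atTop (𝓝[<] 0) := by
  refine tendsto_nhdsWithin_iff.2 ⟨?_, (eventually_gt_atTop 0).mono fun s hs => tt_neg hs⟩
  have c3 := tendsto_id.const_mul_atTop (by norm_num : (0:ℝ) < 3)
  have h2 := tendsto_th2.mul (tendsto_th2.comp c3)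
  have h3 := tendsto_th3.mul (tendsto_th3.comp c3)
  have hB := ((h2.const_mul (1/4)).mul h3).const_mul (-64)
  have := hB.div tendsto_A2 one_ne_zero
  simp only [mul_zero, zero_mul, zero_div] at this
  refine this.congr fun s => ?_
  rw [Pi.div_apply, tt, B2, u2, u3]
  rfl

/-- A solution of the inhomogeneous Picard-Fuchs equation with value `7ζ(3)` at the origin, pulled
back along `tt`, is `A2` times the Eichler integral `GG`. -/
theorem comp_tt_eq {I0 I1 I2 I3 : ℝ → ℝ} (d0 : ∀ t < 0, HasDerivAt I0 (I1 t) t)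
    (d1 : ∀ t < 0, HasDerivAt I1 (I2 t) t) (d2 : ∀ t < 0, HasDerivAt I2 (I3 t) t)
    (ode : ∀ t < 0, t^2 * (t-4) * (t-16) * I3 t + 6*t*(t^2-15*t+32) * I2 t + (7*t^2-68*t+64) * I1 t
      + (t-4) * I0 t = -24)
    (hl : Tendsto I0 (𝓝[<] 0) (𝓝 (7 * zeta3))) {s : ℝ} (hs : 0 < s) :
    I0 (tt s) = A2 s * GG s := by
  obtain ⟨G1, G2, hG⟩ := exists_GG_derivs
  set F1 : ℝ → ℝ := fun s => (AA s * tt s * I1 (tt s) - hh s * I0 (tt s)) / A2 s with hF1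
  set S : ℝ → ℝ := fun t => t^2 * ((1 - t/4) * (1 - t/16)) * I2 t +
    (t^2 * ((-1/4) * (1 - t/16) + (1 - t/4) * (-1/16)) / 2 + t * ((1 - t/4) * (1 - t/16))) * I1 t -
    (t/16 - t^2/128) * I0 t with hS
  set F2 : ℝ → ℝ := fun s => A2 s * S (tt s) - hh s * F1 s - hh s ^ 2 / 2 * (I0 (tt s) / A2 s) with hF2
  have D0 : ∀ s, 0 < s → HasDerivAt (fun s => I0 (tt s) / A2 s) (-F1 s) s := by
    intro s hs
    have hA := (A2_pos hs).ne'
    convert! ((d0 _ (tt_neg hs)).comp s (hasDerivAt_tt hs)).fun_div (hasDerivAt_A2 hs) hA using 1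
    simp only [hF1, Function.comp]
    field_simp
    ring
  have dh : ∀ s, 0 < s → dhh s = hh s ^ 2 / 2 + A2 s ^ 2 * (tt s / 16 - tt s ^ 2 / 128) := by
    intro s hs
    have h := dhh_eq hs
    have hA := (A2_pos hs).ne'
    rw [tt]
    field_simp
    linear_combination (2048 : ℝ) * h
  have D1 : ∀ s, 0 < s → HasDerivAt F1 (-F2 s) s := by
    intro s hs
    have hA := (A2_pos hs).ne'
    have i0 := (d0 _ (tt_neg hs)).comp s (hasDerivAt_tt hs)
    have i1 := (d1 _ (tt_neg hs)).comp s (hasDerivAt_tt hs)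
    convert! ((((hasDerivAt_AA hs).fun_mul (hasDerivAt_tt hs)).fun_mul i1).fun_sub
      ((hasDerivAt_hh hs).fun_mul i0)).fun_div (hasDerivAt_A2 hs) hA using 1
    simp only [hF2, hS, hF1, Function.comp, dh s hs]
    have sq := AA_sq' hs
    field_simp
    linear_combination 16384 * (tt s * I1 (tt s) + tt s ^ 2 * I2 (tt s)) * sq
  have D2 : ∀ s, 0 < s → HasDerivAt F2 (-(24 * (B2 s * AA s))) s := by
    intro s hs
    have hA := (A2_pos hs).ne'
    have i0 := (d0 _ (tt_neg hs)).comp s (hasDerivAt_tt hs)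
    have ds : HasDerivAt S (-3/8 + (tt s/16 - tt s^2/128) * I1 (tt s)) (tt s) := by
      have ht := tt_neg hs
      generalize tt s = t at ht
      have hid := hasDerivAt_id' t
      have p1 := (hid.div_const 4).const_sub 1
      have p2 := (hid.div_const 16).const_sub 1
      convert! ((((hid.fun_pow 2).fun_mul (p1.fun_mul p2)).fun_mul (d2 t ht)).fun_add
        (((((hid.fun_pow 2).fun_mul ((p2.const_mul (-1/4)).fun_add (p1.mul_const (-1/16)))).div_const 2).fun_add
          (hid.fun_mul (p1.fun_mul p2))).fun_mul (d1 t ht))).fun_sub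
          (((hid.div_const 16).fun_sub ((hid.fun_pow 2).div_const 128)).fun_mul (d0 t ht)) using 1
      have := ode t ht
      push_cast
      linear_combination (-1/64 : ℝ) * this
    have dS := ds.comp s (hasDerivAt_tt hs)
    convert! (((hasDerivAt_A2 hs).fun_mul dS).fun_sub ((hasDerivAt_hh hs).fun_mul (D1 s hs))).fun_sub
      ((((hasDerivAt_hh hs).fun_pow 2).div_const 2).fun_mul (D0 s hs)) using 1
    simp only [hF2, Function.comp, dh s hs]
    have hB : B2 s = - tt s * A2 s / 64 := by rw [tt]; field_simp
    have hF1s : AA s * tt s * I1 (tt s) = A2 s * F1 s + hh s * I0 (tt s) := by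
      simp only [hF1]; field_simp; ring
    rw [hB]
    push_cast
    generalize S (tt s) = X
    generalize F1 s = Y at *
    field_simp
    linear_combination (131072 * tt s * A2 s ^ 2 - 16384 * tt s ^ 2 * A2 s ^ 2) * hF1s
  have key := eq_zero_of_third_deriv (f := fun s => I0 (tt s) / A2 s - GG s)
    (f1 := fun s => -(F1 s) + G1 s) (f2 := fun s => F2 s - G2 s)
    (fun s hs => by
      convert! (D0 s hs).fun_sub (hG s hs).1 using 1
      ring)
    (fun s hs => by
      convert! (D1 s hs).fun_neg.fun_add (hG s hs).2.1 using 1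
      ring)
    (fun s hs => by
      convert! (D2 s hs).fun_sub (hG s hs).2.2 using 1
      ring) ?_ hs
  · have hA := (A2_pos hs).ne'
    rw [sub_eq_zero, div_eq_iff hA] at key
    rw [key, mul_comm]
  · have := ((hl.comp tendsto_tt).div tendsto_A2 one_ne_zero).sub tendsto_GG
    rw [div_one, sub_self] at this
    exact this

lemma th4_poisson {a : ℝ} (ha : 0 < a) : th4 (π * a) = th2 (π / a) / √a := by
  have h := Complex.tsum_exp_neg_quadratic (a := (a:ℂ)) (by simpa using ha) (Complex.I / 2)
  have e1 : ∑' n : ℤ, Complex.exp (-π * a * n ^ 2 + 2 * π * (Complex.I / 2) * n) = (th4 (π * a) : ℂ) := by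
    rw [th4, expSeries, Complex.ofReal_tsum]
    refine tsum_congr fun n => ?_
    rw [Complex.exp_add, show 2 * (π:ℂ) * (Complex.I / 2) * n = n * (π * Complex.I) by ring,
      Complex.exp_int_mul, Complex.exp_pi_mul_I]
    push_cast
    rw [mul_comm]
    congr 2
    ring
  have e2 : ∑' n : ℤ, Complex.exp (-π / a * (n + Complex.I * (Complex.I / 2)) ^ 2) = (th2 (π / a) : ℂ) := by
    rw [th2, expSeries, Complex.ofReal_tsum, ← (Equiv.neg ℤ).tsum_eq]
    refine tsum_congr fun n => ?_
    rw [one_mul, Complex.ofReal_exp]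
    congr 1
    rw [← mul_div_assoc, Complex.I_mul_I]
    simp only [Equiv.neg_apply]
    push_cast
    ring
  rw [e1, e2, ← Complex.ofReal_one, ← Complex.ofReal_ofNat, ← Complex.ofReal_div, ← Complex.ofReal_cpow ha.le,
    ← Complex.ofReal_div, ← Complex.ofReal_mul, ← sqrt_eq_rpow] at h
  rw [Complex.ofReal_inj.1 h]
  ring

/-- The value of the eta function at `iy`. -/
noncomputable def etaR (y : ℝ) : ℝ := exp (-π * y / 12) * eu (2 * π * y)

lemma dedekindEta_I_mul {y : ℝ} (hy : 0 < y) : dedekindEta (Complex.I * y) = (etaR y : ℂ) := by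
  have hm := (multipliable_one_sub (exp_pos (-(2 * π * y))) (exp_neg_lt_one (by positivity))).map_tprod
    Complex.ofRealHom Complex.continuous_ofReal
  simp only [Complex.ofRealHom_eq_coe] at hm
  rw [dedekindEta, etaR, eu, euler, Complex.ofReal_mul, hm, Complex.ofReal_exp]
  congr 1
  · congr 1
    push_cast
    linear_combination (π * y / 12 : ℂ) * Complex.I_mul_I
  · refine tprod_congr fun n => ?_
    push_cast
    rw [← Complex.exp_nat_mul]
    congr 2
    push_cast
    linear_combination (2 * π * (n+1) * y : ℂ) * Complex.I_mul_I

section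
variable {y : ℝ} (hy : 0 < y)
include hy

lemma etaR_pos : 0 < etaR y := mul_pos (exp_pos _) (eu_pos (by positivity))

lemma th4_eq_etaR : th4 (2 * π * y) = etaR y ^ 2 / etaR (2 * y) := by
  rw [th4_eq (by positivity), etaR, etaR, mul_pow, ← exp_nat_mul]
  have h := eu_pos (show 0 < 2 * π * (2 * y) by positivity)
  rw [show 2 * (2 * π * y) = 2 * π * (2 * y) by ring,
    show ((2:ℕ):ℝ) * (-π * y / 12) = -π * (2*y) / 12 by push_cast; ring]
  field_simp

lemma th2_eq_etaR : th2 (π * y) = 2 * etaR (2 * y) ^ 2 / etaR y := by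
  rw [th2_eq_thψ, thψ_eq (by positivity), etaR, etaR, mul_pow, ← exp_nat_mul]
  have h := eu_pos (show 0 < 2 * π * y by positivity)
  rw [show 2 * (π * y) = 2 * π * y by ring, show 4 * (π * y) = 2 * π * (2 * y) by ring,
    show ((2:ℕ):ℝ) * (-π * (2 * y) / 12) = -(π * y)/4 + -π * y / 12 by push_cast; ring, exp_add]
  field_simp

lemma etaR_period : (etaR (2*y) * etaR (6*y)) ^ 4 / (etaR y * etaR (3*y)) ^ 2 =
    A2 (π / (3*y)) / (48 * y^2) := by
  have p1 := etaR_pos hy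
  have p3 := etaR_pos (show 0 < 3 * y by positivity)
  have h1 := th2_eq_etaR hy
  have h3 := th2_eq_etaR (show 0 < 3 * y by positivity)
  rw [show 2 * (3 * y) = 6 * y by ring] at h3
  have q1 := th4_poisson (show 0 < 1 / y by positivity)
  have q3 := th4_poisson (show 0 < 1 / (3 * y) by positivity)
  rw [show π * (1/y) = 3 * (π / (3*y)) by field_simp, show π / (1/y) = π * y by field_simp] at q1
  rw [show π * (1/(3*y)) = π / (3*y) by field_simp, show π / (1/(3*y)) = π * (3*y) by field_simp] at q3
  rw [A2, u4, q1, q3, h1, h3]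
  have s1 : √(1/y) ^ 2 = 1 / y := sq_sqrt (by positivity)
  have s3 : √(1/(3*y)) ^ 2 = 1 / (3*y) := sq_sqrt (by positivity)
  generalize √(1/y) = a at *
  generalize √(1/(3*y)) = b at *
  rw [show (2 * etaR (6 * y) ^ 2 / etaR (3 * y) / b * (2 * etaR (2 * y) ^ 2 / etaR y / a)) ^ 2 =
    (2 * etaR (6 * y) ^ 2 / etaR (3 * y)) ^ 2 / b ^ 2 * ((2 * etaR (2 * y) ^ 2 / etaR y) ^ 2 / a ^ 2) by ring,
    s1, s3]
  field_simp
  ring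

lemma etaR_haupt : -((etaR y * etaR (3*y)) / (etaR (2*y) * etaR (6*y))) ^ 6 = tt (π / (3*y)) := by
  have p1 := etaR_pos hy
  have p3 := etaR_pos (show 0 < 3 * y by positivity)
  have p2 := etaR_pos (show 0 < 2 * y by positivity)
  have p6 := etaR_pos (show 0 < 6 * y by positivity)
  set S := π / (3 * y) with hS
  have hSp : 0 < S := by positivity
  have h1 := th4_eq_etaR hy
  have h3 := th4_eq_etaR (show 0 < 3 * y by positivity)
  rw [show 2 * (3 * y) = 6 * y by ring] at h3
  have q1 := th4_poisson (show 0 < 2 * y by positivity)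
  have q3 := th4_poisson (show 0 < 2 * (3 * y) by positivity)
  rw [← mul_assoc, mul_comm π 2, h1, show π / (2 * y) = 3 * S / 2 by rw [hS]; field_simp] at q1
  rw [← mul_assoc, mul_comm π 2, h3, show π / (2 * (3 * y)) = S / 2 by rw [hS]; field_simp] at q3
  have s1 : √(2 * y) ^ 2 = 2 * y := sq_sqrt (by positivity)
  have s3 : √(2 * (3*y)) ^ 2 = 2 * (3 * y) := sq_sqrt (by positivity)
  have t1 := th2_sq (show 0 < S / 2 by positivity)
  have t3 := th2_sq (show 0 < 3 * S / 2 by positivity)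
  rw [show 2 * (S / 2) = S by ring] at t1
  rw [show 2 * (3 * S / 2) = 3 * S by ring] at t3
  have e : (etaR y ^ 2 / etaR (2*y)) ^ 2 * (etaR (3*y) ^ 2 / etaR (6*y)) ^ 2 = 4 * B2 S / (3 * y^2) := by
    rw [q1, q3, div_pow, div_pow, s1, s3, t1, t3, B2, u2, u3]
    field_simp
  have e2 := etaR_period hy
  rw [← hS] at e2
  have hA := A2_pos hSp
  have e3 : ((etaR y * etaR (3*y)) / (etaR (2*y) * etaR (6*y))) ^ 6 =
      ((etaR y ^ 2 / etaR (2*y)) ^ 2 * (etaR (3*y) ^ 2 / etaR (6*y)) ^ 2) /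
      ((etaR (2*y) * etaR (6*y)) ^ 4 / (etaR y * etaR (3*y)) ^ 2) := by
    field_simp
  rw [e3, e, e2, tt]
  field_simp
  ring

end

lemma tHaupt_eq {y : ℝ} (hy : 0 < y) : tHaupt (Complex.I * y) = (tt (π / (3*y)) : ℂ) := by
  rw [← etaR_haupt hy, tHaupt]
  have e : ∀ c : ℝ, (c:ℂ) * (Complex.I * y) = Complex.I * ((c * y : ℝ) : ℂ) := fun c => by push_cast; ring
  have e2 := e 2
  have e3 := e 3
  have e6 := e 6
  push_cast at e2 e3 e6
  rw [e2, e3, e6]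
  have d2 := dedekindEta_I_mul (show 0 < 2 * y by positivity)
  have d3 := dedekindEta_I_mul (show 0 < 3 * y by positivity)
  have d6 := dedekindEta_I_mul (show 0 < 6 * y by positivity)
  push_cast at d2 d3 d6
  rw [d2, d3, d6, dedekindEta_I_mul hy]
  push_cast
  rfl

lemma varpi1_eq {y : ℝ} (hy : 0 < y) :
    varpi1 (Complex.I * y) = ((A2 (π / (3*y)) / (48 * y^2) : ℝ) : ℂ) := by
  rw [← etaR_period hy, varpi1]
  have e : ∀ c : ℝ, (c:ℂ) * (Complex.I * y) = Complex.I * ((c * y : ℝ) : ℂ) := fun c => by push_cast; ring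
  have e2 := e 2
  have e3 := e 3
  have e6 := e 6
  push_cast at e2 e3 e6
  rw [e2, e3, e6]
  have d2 := dedekindEta_I_mul (show 0 < 2 * y by positivity)
  have d3 := dedekindEta_I_mul (show 0 < 3 * y by positivity)
  have d6 := dedekindEta_I_mul (show 0 < 6 * y by positivity)
  push_cast at d2 d3 d6
  rw [d2, d3, d6, dedekindEta_I_mul hy]
  push_cast
  rfl

lemma hasSum_coth {w : ℝ} (hw : 0 < w) :
    HasSum (fun k : ℕ => 2 * w / (w^2 + 4 * π^2 * ((k:ℝ)+1)^2))
      (1/2 + exp (-w) / (1 - exp (-w)) - 1/w) := by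
  have hz : 0 < (((w / (2*π) : ℝ) : ℂ) * Complex.I).im := by
    simp only [Complex.mul_I_im, Complex.ofReal_re]; positivity
  have hwpi : (π:ℂ) ≠ 0 := by exact_mod_cast pi_ne_zero
  have hwc : (w:ℂ) ≠ 0 := by exact_mod_cast hw.ne'
  set z : UpperHalfPlane := ⟨((w / (2*π) : ℝ) : ℂ) * Complex.I, hz⟩ with hzd
  have hzc : (z : ℂ) = ((w / (2*π) : ℝ) : ℂ) * Complex.I := rfl
  have hmem := UpperHalfPlane.coe_mem_integerComplement z
  have h1 := cot_series_rep' hmem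
  have hs := (summable_cotTerm hmem).hasSum
  rw [show ∑' n, cotTerm z n = _ from h1.symm, pi_mul_cot_pi_q_exp] at hs
  have he : Complex.exp (2 * π * Complex.I * z) = ((exp (-w) : ℝ) : ℂ) := by
    rw [hzc, Complex.ofReal_exp]
    congr 1
    push_cast
    field_simp
    linear_combination Complex.I_sq
  rw [he, tsum_geometric_of_norm_lt_one (by
    rw [Complex.norm_real, Real.norm_eq_abs, abs_exp]; exact exp_neg_lt_one hw)] at hs
  have hs2 := hs.mul_left (Complex.I / (2 * π))
  rw [← Complex.hasSum_ofReal]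
  convert! hs2 using 1
  · ext k
    rw [cotTerm_identity hmem, hzc]
    have hne : (w:ℂ)^2 + 4 * π^2 * ((k:ℂ)+1)^2 ≠ 0 := by
      have : w^2 + 4 * π^2 * ((k:ℝ)+1)^2 ≠ 0 := by positivity
      exact_mod_cast this
    have e : ((w / (2*π) : ℝ) : ℂ) * Complex.I * (((w / (2*π) : ℝ) : ℂ) * Complex.I) =
      -((w:ℂ)^2 / (4 * π^2)) := by
      push_cast
      field_simp
      linear_combination (4:ℂ) * Complex.I_sq
    rw [show (((w / (2*π) : ℝ) : ℂ) * Complex.I + ((k:ℂ)+1)) * (((w / (2*π) : ℝ) : ℂ) * Complex.I - ((k:ℂ)+1)) =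
      -(((w:ℂ)^2 + 4 * π^2 * ((k:ℂ)+1)^2) / (4 * π^2)) by
        rw [show ∀ a b : ℂ, (a + b) * (a - b) = a * a - b^2 by intros; ring, e]; field_simp; ring]
    push_cast
    field_simp
    linear_combination (4 : ℂ) * Complex.I_sq
  · rw [hzc]
    have h1e : (1:ℂ) - ((exp (-w) : ℝ) : ℂ) ≠ 0 := by
      have : 1 - exp (-w) ≠ 0 := by have := exp_neg_lt_one hw; linarith
      exact_mod_cast this
    push_cast at h1e ⊢
    field_simp
    linear_combination ((w:ℂ) + w*Complex.exp (-w)) * Complex.I_sq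

/-- The terms of `lamR`. -/
noncomputable def gR (x : ℝ) (n : ℕ) : ℝ := 1 / (n:ℝ)^3 * (exp (-x * n) / (1 - exp (-x * n)))

section
variable {x : ℝ} (hx : 0 < x)
include hx

lemma hasSum_gR_succ : HasSum (fun n : ℕ => gR x (n+1)) (lamR x) := by
  refine (expSummable_lamR.hasSum hx).prod_fiberwise fun n => ?_
  have h := (hasSum_geometric_of_lt_one (exp_pos (-(x * (n+1)))).le
    (exp_neg_lt_one (by positivity))).mul_left (1 / ((n:ℝ)+1)^3 * exp (-(x * (n+1))))
  convert! h using 1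
  · ext m
    rw [mul_assoc, ← exp_nat_mul, ← exp_add]
    congr 2
    unfold lamExp
    ring
  · rw [gR]; push_cast; rw [neg_mul]; ring

lemma hasSum_gR : HasSum (gR x) (lamR x) := by
  have := (hasSum_nat_add_iff (f := gR x) 1).1 (hasSum_gR_succ hx)
  simpa [gR] using this

lemma hasSum_gR_dvd {c : ℕ} (hc : c ≠ 0) :
    HasSum (fun n => if c ∣ n then gR x n else 0) (lamR (c * x) / c^3) := by
  have hinj : Function.Injective fun n : ℕ => c * n := mul_right_injective₀ hc
  rw [← hinj.hasSum_iff]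
  · convert! (hasSum_gR (by positivity : 0 < (c:ℝ) * x)).div_const ((c:ℝ)^3) using 1
    ext n
    have : (c:ℝ) ≠ 0 := by exact_mod_cast hc
    simp only [Function.comp_apply, dvd_mul_right, if_true, gR]
    push_cast
    rw [show -x * ((c:ℝ) * n) = -(c * x) * n by ring]
    field_simp
  · intro n hn
    rw [if_neg]
    rintro ⟨m, rfl⟩
    exact hn ⟨m, rfl⟩

omit hx in
lemma psi_eq (n : ℕ) : (psi n : ℝ) = -48 * ((if 1 ∣ n then 1 else 0) - 16 * (if 2 ∣ n then 1 else 0) -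
    9 * (if 3 ∣ n then 1 else 0) + 144 * (if 6 ∣ n then 1 else 0)) := by
  have h6 : n % 6 < 6 := Nat.mod_lt _ (by norm_num)
  have e2 : 2 ∣ n ↔ (n % 6) % 2 = 0 := by omega
  have e3 : 3 ∣ n ↔ (n % 6) % 3 = 0 := by omega
  have e6 : 6 ∣ n ↔ n % 6 = 0 := by omega
  rw [psi]
  simp only [e2, e3, e6, one_dvd, if_true]
  interval_cases (n % 6) <;> norm_num

lemma hasSum_psi : HasSum (fun n : ℕ => (psi (n+1) : ℝ) * gR x (n+1))
    (-48 * (lamR x - 2 * lamR (2*x) - 1/3 * lamR (3*x) + 2/3 * lamR (6*x))) := by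
  have h := ((((hasSum_gR_dvd hx one_ne_zero).sub ((hasSum_gR_dvd hx two_ne_zero).mul_left 16)).sub
    ((hasSum_gR_dvd hx three_ne_zero).mul_left 9)).add
    ((hasSum_gR_dvd hx (by norm_num : 6 ≠ 0)).mul_left 144)).mul_left (-48)
  have h2 : HasSum (fun n : ℕ => (psi n : ℝ) * gR x n)
      (-48 * (lamR x - 2 * lamR (2*x) - 1/3 * lamR (3*x) + 2/3 * lamR (6*x))) := by
    convert! h using 1
    · ext n
      rw [psi_eq]
      split_ifs <;> ring
    · norm_num; ring
  have := (hasSum_nat_add_iff' (f := fun n : ℕ => (psi n : ℝ) * gR x n) 1).2 h2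
  simpa [gR] using this

omit hx in
lemma summable_zeta3 : Summable fun k : ℕ => 1 / ((k:ℝ)+1)^3 := sum_zeta3_pos

omit hx in
lemma hasSum_succ_pow {j : ℕ} {a : ℝ} (hj : j ≠ 0) (h : HasSum (fun n : ℕ => 1 / (n:ℝ)^j) a) :
    HasSum (fun n : ℕ => 1 / ((n:ℝ)+1)^j) a := by
  have := (hasSum_nat_add_iff' 1).2 h
  simpa [hj] using this

omit hx in
lemma hasSum_zeta_two_mul : HasSum (fun p : ℕ × ℕ => 1 / ((p.1:ℝ)+1)^2 * (1 / ((p.2:ℝ)+1)^2))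
    (π^2/6 * (π^2/6)) := by
  have h := hasSum_succ_pow two_ne_zero hasSum_zeta_two
  have hn : (0 : ℕ → ℝ) ≤ fun n : ℕ => 1 / ((n:ℝ)+1)^2 := fun n => by
    simp only [Pi.zero_apply]; positivity
  have hs : Summable fun p : ℕ × ℕ => 1 / ((p.1:ℝ)+1)^2 * (1 / ((p.2:ℝ)+1)^2) :=
    h.summable.mul_of_nonneg h.summable hn hn
  exact HasSum.mul (f := fun n : ℕ => 1 / ((n:ℝ)+1)^2) (g := fun n : ℕ => 1 / ((n:ℝ)+1)^2) h h hs

/-- The double series in the transformation of `lamV`. -/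
noncomputable def lamM (x : ℝ) (p : ℕ × ℕ) : ℝ :=
  1 / (((p.1:ℝ)+1)^2 * (((p.1:ℝ)+1)^2 * x^2 + 4 * π^2 * ((p.2:ℝ)+1)^2))

lemma summable_lamM : Summable (lamM x) := by
  refine Summable.of_nonneg_of_le (fun p => by unfold lamM; positivity) (fun p => ?_)
    hasSum_zeta_two_mul.summable
  rw [lamM, ← one_div_mul_one_div]
  gcongr
  have := pi_gt_three
  nlinarith [sq_nonneg (((p.1:ℝ)+1) * x), sq_nonneg ((p.2:ℝ)+1), mul_nonneg (sq_nonneg ((p.2:ℝ)+1)) (by nlinarith : 0 ≤ 4 * π^2 - 1)]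

lemma lamV_eq : lamV x = π^4/90 / x + 2 * x * ∑' p, lamM x p := by
  have h1 := (summable_zeta3.hasSum.mul_left (1/2)).add (hasSum_gR_succ hx)
  have h2 := ((hasSum_succ_pow four_ne_zero hasSum_zeta_four).div_const x).add
    (((summable_lamM hx).hasSum.mul_left (2 * x)).prod_fiberwise fun n => by
      have h := (hasSum_coth (w := x * (n+1)) (by positivity)).div_const (((n:ℝ)+1)^3)
      have e : (fun k : ℕ => 2 * (x * ((n:ℝ)+1)) / ((x * ((n:ℝ)+1))^2 + 4 * π^2 * ((k:ℝ)+1)^2) / ((n:ℝ)+1)^3) =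
          fun k => 2 * x * lamM x (n, k) := by
        ext k
        have : 0 < (x * ((n:ℝ)+1))^2 + 4 * π^2 * ((k:ℝ)+1)^2 := by positivity
        have : 0 < x^2 * ((n:ℝ)+1)^2 + 4 * π^2 * ((k:ℝ)+1)^2 := by positivity
        rw [lamM]
        field_simp
      rw [e] at h
      exact h)
  refine h1.unique ?_
  convert! h2 using 1
  ext n
  have hn : (n:ℝ) + 1 ≠ 0 := by positivity
  rw [gR]
  push_cast
  rw [neg_mul]
  have := exp_neg_lt_one (show 0 < x * ((n:ℝ)+1) by positivity)
  generalize exp (-(x * ((n:ℝ)+1))) = E at *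
  have h1e : 1 - E ≠ 0 := by linarith
  field_simp
  ring

lemma lamM_add : ∑' p, lamM x p + ∑' p, lamM (4 * π^2 / x) p =
    π^2/6 * (π^2/6) / (4 * π^2) := by
  have h1 := (summable_lamM hx).hasSum
  have h2 := (summable_lamM (show 0 < 4 * π^2 / x by positivity)).hasSum
  have h2' := (Equiv.prodComm ℕ ℕ).hasSum_iff.2 h2
  refine (h1.add h2').unique ?_
  convert! hasSum_zeta_two_mul.div_const (4 * π^2) using 1
  ext p
  simp only [Function.comp_apply, Equiv.prodComm_apply, Prod.fst_swap, Prod.snd_swap, lamM]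
  have : 0 < x^2 * ((p.1:ℝ)+1)^2 + 4 * π^2 * ((p.2:ℝ)+1)^2 := by positivity
  have e : ((p.2:ℝ)+1)^2 * (4 * π^2 / x)^2 + 4 * π^2 * ((p.1:ℝ)+1)^2 =
    4 * π^2 / x^2 * (x^2 * ((p.1:ℝ)+1)^2 + 4 * π^2 * ((p.2:ℝ)+1)^2) := by
    field_simp; ring
  rw [e, mul_comm (((p.1:ℝ)+1)^2) (x^2)]
  field_simp
  ring

lemma lamV_modular : lamV x = π^4/90 / x + x * π^2/72 + x^3/1440 -
    x^2 / (4 * π^2) * lamV (4 * π^2 / x) := by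
  have h := lamM_add hx
  rw [lamV_eq hx, lamV_eq (show 0 < 4 * π^2 / x by positivity)]
  generalize ∑' p, lamM x p = a at *
  generalize ∑' p, lamM (4 * π^2 / x) p = b at *
  rw [← sub_eq_zero] at h ⊢
  have e : a + b = π^2 / 144 := by
    rw [sub_eq_zero.1 h]; field_simp; norm_num
  rw [show a = π^2 / 144 - b by linarith]
  field_simp
  ring

end

lemma period_sum_eq {y : ℝ} (hy : 0 < y) : 16 * zeta3
          + ∑' n : ℕ, ((psi (n+1) : ℝ) / ((n:ℝ)+1)^3) *
              (Real.exp (-2*Real.pi*y))^(n+1) / (1 - (Real.exp (-2*Real.pi*y))^(n+1))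
          + 32 * Real.pi^3 * y^3 = 48 * y^2 * GG (π / (3*y)) := by
  have hx : 0 < 2 * π * y := by positivity
  have e : ∑' n : ℕ, ((psi (n+1) : ℝ) / ((n:ℝ)+1)^3) *
              (Real.exp (-2*Real.pi*y))^(n+1) / (1 - (Real.exp (-2*Real.pi*y))^(n+1)) =
      ∑' n : ℕ, (psi (n+1) : ℝ) * gR (2 * π * y) (n+1) := by
    refine tsum_congr fun n => ?_
    rw [gR, ← exp_nat_mul]
    push_cast
    rw [show -(2 * π * y) * ((n:ℝ)+1) = ((n:ℝ)+1) * (-2 * π * y) by ring]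
    ring
  rw [e, (hasSum_psi hx).tsum_eq]
  have v1 := lamV_modular hx
  have v2 := lamV_modular (show 0 < 2 * (2 * π * y) by positivity)
  have v3 := lamV_modular (show 0 < 3 * (2 * π * y) by positivity)
  have v6 := lamV_modular (show 0 < 6 * (2 * π * y) by positivity)
  rw [show 4 * π^2 / (2 * π * y) = 6 * (π / (3*y)) by field_simp; norm_num] at v1
  rw [show 4 * π^2 / (2 * (2 * π * y)) = 3 * (π / (3*y)) by field_simp; norm_num] at v2
  rw [show 4 * π^2 / (3 * (2 * π * y)) = 2 * (π / (3*y)) by field_simp; norm_num] at v3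
  rw [show 4 * π^2 / (6 * (2 * π * y)) = π / (3*y) by field_simp; norm_num] at v6
  rw [GG]
  have r : ∀ s, lamR s = lamV s - 1/2 * zeta3 := fun s => by rw [lamV]; ring
  rw [r, r, r, r, v1, v2, v3, v6]
  field_simp
  ring

section
variable {α : Type*} [MeasurableSpace α] {μ : Measure α} {P w : α → ℝ}

/-- `k!` times the integral of `w / (P - t)^(k+1)`. -/
noncomputable def resolvInt (μ : Measure α) (P w : α → ℝ) (k : ℕ) (t : ℂ) : ℂ :=
  k.factorial * ∫ a, (w a : ℂ) * (((P a : ℂ) - t)^(k+1))⁻¹ ∂μ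

lemma exists_mul_le_sub {r : ℝ} (hr : r < 16) : ∃ δ > 0, ∀ p ≥ (16:ℝ), δ * p ≤ p - r := by
  rcases le_or_gt r 0 with h | h
  · exact ⟨1, one_pos, fun p hp => by linarith⟩
  · refine ⟨1 - r/16, by linarith, fun p hp => ?_⟩
    nlinarith

lemma norm_inv_pow_le {r : ℝ} {δ : ℝ} (hδ : 0 < δ) (h : ∀ p ≥ (16:ℝ), δ * p ≤ p - r)
    {p : ℝ} (hp : 16 ≤ p) {t : ℂ} (ht : t.re ≤ r) (k : ℕ) :
    ‖(((p : ℂ) - t)^(k+1))⁻¹‖ ≤ (δ^(k+1))⁻¹ * p⁻¹ := by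
  have h1 : δ * p ≤ ‖(p:ℂ) - t‖ := by
    refine (h p hp).trans ?_
    refine le_trans ?_ (Complex.re_le_norm _)
    simp only [Complex.sub_re, Complex.ofReal_re]
    linarith
  rw [norm_inv, norm_pow, ← mul_inv]
  have h2 : δ^(k+1) * p ≤ (δ * p)^(k+1) := by
    rw [mul_pow]
    have : p^1 ≤ p^(k+1) := pow_le_pow_right₀ (by linarith) (by omega)
    rw [pow_one] at this
    gcongr
  have h3 : (δ * p)^(k+1) ≤ ‖(p:ℂ) - t‖^(k+1) := by gcongr
  have : 0 < p := by linarith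
  exact inv_anti₀ (by positivity) (h2.trans h3)

variable (hPm : Measurable P) (hwm : Measurable w) (hP : ∀ᵐ a ∂μ, 16 ≤ P a)
  (hi : Integrable (fun a => w a * (P a)⁻¹) μ)
include hPm hwm hP hi

lemma integrable_resolv (k : ℕ) {t : ℂ} (ht : t.re < 16) :
    Integrable (fun a => (w a : ℂ) * (((P a : ℂ) - t)^(k+1))⁻¹) μ := by
  obtain ⟨δ, hδ, h⟩ := exists_mul_le_sub ht
  refine (hi.norm.const_mul ((δ^(k+1))⁻¹)).mono' (by fun_prop) ?_
  filter_upwards [hP] with a ha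
  rw [norm_mul, Complex.norm_real, norm_mul, Real.norm_eq_abs (P a)⁻¹,
    abs_of_nonneg (inv_nonneg.2 (by linarith : 0 ≤ P a))]
  calc _ ≤ ‖w a‖ * ((δ^(k+1))⁻¹ * (P a)⁻¹) := by
        gcongr; exact norm_inv_pow_le hδ h ha le_rfl k
    _ = _ := by ring

lemma hasDerivAt_resolvInt (k : ℕ) {t : ℂ} (ht : t.re < 16) :
    HasDerivAt (resolvInt μ P w k) (resolvInt μ P w (k+1) t) t := by
  obtain ⟨δ, hδ, h⟩ := exists_mul_le_sub (show (t.re + 16) / 2 < 16 by linarith)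
  have hs : Metric.ball t ((16 - t.re)/2) ∈ 𝓝 t := Metric.ball_mem_nhds _ (by linarith)
  have hre : ∀ z ∈ Metric.ball t ((16 - t.re)/2), z.re ≤ (t.re + 16)/2 := fun z hz => by
    rw [Metric.mem_ball, Complex.dist_eq] at hz
    have := (Complex.re_le_norm (z - t)).trans hz.le
    rw [Complex.sub_re] at this
    linarith
  have key := (hasDerivAt_integral_of_dominated_loc_of_deriv_le (μ := μ) (𝕜 := ℂ)
    (F := fun z a => (w a : ℂ) * (((P a : ℂ) - z)^(k+1))⁻¹)
    (F' := fun z a => (w a : ℂ) * ((k+1) * (((P a : ℂ) - z)^(k+1+1))⁻¹))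
    (bound := fun a => ((k:ℝ)+1) * ((δ^(k+1+1))⁻¹ * ‖w a * (P a)⁻¹‖)) hs
    (Eventually.of_forall fun z => by fun_prop)
    (integrable_resolv hPm hwm hP hi k ht) (by fun_prop) ?_
    ((hi.norm.const_mul _).const_mul _) ?_).2
  · have e : resolvInt μ P w (k+1) t = k.factorial *
        ∫ a, (w a : ℂ) * ((k+1) * (((P a : ℂ) - t)^(k+1+1))⁻¹) ∂μ := by
      rw [resolvInt, Nat.factorial_succ]
      simp_rw [mul_left_comm _ ((k:ℂ)+1)]
      rw [integral_const_mul]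
      push_cast
      ring
    rw [e]
    exact key.const_mul _
  · filter_upwards [hP] with a ha z hz
    have hn : ‖((k:ℂ)+1)‖ = (k:ℝ)+1 := by
      rw [show ((k:ℂ)+1) = (((k:ℝ)+1 : ℝ):ℂ) by push_cast; rfl, Complex.norm_real]
      exact abs_of_nonneg (by positivity)
    rw [norm_mul, norm_mul, hn, Complex.norm_real, norm_mul, Real.norm_eq_abs (P a)⁻¹,
      abs_of_nonneg (inv_nonneg.2 (by linarith : 0 ≤ P a))]
    calc _ ≤ ‖w a‖ * (((k:ℝ)+1) * ((δ^(k+1+1))⁻¹ * (P a)⁻¹)) := by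
          gcongr; exact norm_inv_pow_le hδ h ha (hre z hz) (k+1)
      _ = _ := by ring
  · filter_upwards [hP] with a ha z hz
    have hne : (P a : ℂ) - z ≠ 0 := fun h0 => by
      have := hre z hz
      rw [sub_eq_zero] at h0
      rw [← h0] at this
      simp at this
      linarith
    have := (((((hasDerivAt_id z).const_sub (P a : ℂ)).fun_pow (k+1)).fun_inv
      (pow_ne_zero _ hne)).const_mul (w a : ℂ))
    convert! this using 1
    simp only [id]
    push_cast
    field_simp
    ring_nf

/-- The Picard-Fuchs operator applied to the resolvent integral. -/
lemma resolvInt_ode {c : ℕ → ℝ} (hc : ∀ n, ∫ a, w a * ((P a)^(n+1))⁻¹ ∂μ = c n)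
    (h0 : 64 * c 1 - 4 * c 0 = -24)
    (hr : ∀ n : ℕ, ((n:ℝ)+1)^3 * c n - 2 * (2 * ((n:ℝ)+1) + 1) * (5 * ((n:ℝ)+1)^2 + 5 * ((n:ℝ)+1) + 2) * c (n+1)
      + 64 * ((n:ℝ)+2)^3 * c (n+2) = 0) {t : ℂ} (ht : t.re < 16) :
    t^2*(t-4)*(t-16) * resolvInt μ P w 3 t + 6*t*(t^2-15*t+32) * resolvInt μ P w 2 t
      + (7*t^2-68*t+64) * resolvInt μ P w 1 t + (t-4) * resolvInt μ P w 0 t = -24 := by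
  set j := resolvInt μ P w with hj
  have hd : ∀ k, ∀ t : ℂ, t.re < 16 → HasDerivAt (j k) (j (k+1) t) t :=
    fun k t ht => hasDerivAt_resolvInt hPm hwm hP hi k ht
  have hj0 : ∀ k, j k 0 = k.factorial * (c k : ℂ) := fun k => by
    rw [hj, resolvInt, ← hc, ← integral_complex_ofReal]
    congr 2
    ext a
    push_cast
    simp
  set F : ℂ → ℂ := fun t => t^2*(t-4)*(t-16) * j 3 t + 6*t*(t^2-15*t+32) * j 2 t
      + (7*t^2-68*t+64) * j 1 t + (t-4) * j 0 t with hF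
  set G : ℕ → ℂ → ℂ := fun n t =>
    (t^4 - 20*t^3 + 64*t^2) * j (n+4) t
    + (((n:ℂ)+1) * (4*t^3 - 60*t^2 + 128*t) + (6*t^3 - 90*t^2 + 192*t)) * j (n+3) t
    + (((n:ℂ)+1)*n*(6*t^2 - 60*t + 64) + ((n:ℂ)+1)*(18*t^2 - 180*t + 192) + (7*t^2 - 68*t + 64)) * j (n+2) t
    + (((n:ℂ)+1)*n*(n-1)*(4*t-20) + ((n:ℂ)+1)*n*(18*t-90) + ((n:ℂ)+1)*(14*t-68) + (t-4)) * j (n+1) t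
    + ((n:ℂ)+1)^4 * j n t with hG
  have dF : ∀ t : ℂ, t.re < 16 → HasDerivAt F (G 0 t) t := fun t ht => by
    have x := hasDerivAt_id t
    have := (((((x.fun_pow 2).fun_mul (x.sub_const 4)).fun_mul (x.sub_const 16)).fun_mul (hd 3 t ht)).fun_add
      (((x.const_mul 6).fun_mul (((x.fun_pow 2).fun_sub (x.const_mul 15)).add_const 32)).fun_mul (hd 2 t ht))).fun_add
      (((((x.fun_pow 2).const_mul 7).fun_sub (x.const_mul 68)).add_const 64).fun_mul (hd 1 t ht)) |>.fun_add
      ((x.sub_const 4).fun_mul (hd 0 t ht))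
    convert! this using 1
    simp only [hG, id]
    push_cast
    ring
  have dG : ∀ n, ∀ t : ℂ, t.re < 16 → HasDerivAt (G n) (G (n+1) t) t := fun n t ht => by
    have x := hasDerivAt_id t
    have c0 := fun a b c : ℂ => (((x.fun_pow 2).const_mul a).fun_add (x.const_mul b)).add_const c
    have c1 := fun a b c : ℂ => ((x.fun_pow 3).const_mul a).fun_add (((x.fun_pow 2).const_mul b).fun_add (x.const_mul c))
    have c2 := fun a b : ℂ => (x.const_mul a).add_const b
    have := ((((((x.fun_pow 4).fun_add (c1 (-20) 64 0)).fun_mul (hd (n+4) t ht)).fun_add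
      ((((c1 4 (-60) 128).const_mul ((n:ℂ)+1)).fun_add (c1 6 (-90) 192)).fun_mul (hd (n+3) t ht))).fun_add
      (((((c0 6 (-60) 64).const_mul (((n:ℂ)+1)*n)).fun_add ((c0 18 (-180) 192).const_mul ((n:ℂ)+1))).fun_add
        (c0 7 (-68) 64)).fun_mul (hd (n+2) t ht))).fun_add
      ((((((c2 4 (-20)).const_mul (((n:ℂ)+1)*n*(n-1))).fun_add ((c2 18 (-90)).const_mul (((n:ℂ)+1)*n))).fun_add
        ((c2 14 (-68)).const_mul ((n:ℂ)+1))).fun_add (c2 1 (-4))).fun_mul (hd (n+1) t ht))).fun_add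
      ((hd n t ht).const_mul (((n:ℂ)+1)^4))
    convert! this using 1
    · ext z
      simp only [hG, id]
      ring
    · simp only [hG, id]
      push_cast
      ring
  have hU : IsOpen {t : ℂ | t.re < 16} := isOpen_lt Complex.continuous_re continuous_const
  have hdF : DifferentiableOn ℂ F {t : ℂ | t.re < 16} := fun t ht =>
    (dF t ht).differentiableAt.differentiableWithinAt
  have hG0 : ∀ n, G n 0 = 0 := fun n => by
    simp only [hG, hj0]
    have h := congrArg (fun x : ℝ => (x:ℂ)) (hr n)
    push_cast at h
    rw [show (n+2).factorial = (n+2)*((n+1)*n.factorial) by rw [Nat.factorial_succ, Nat.factorial_succ],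
      show (n+1).factorial = (n+1)*n.factorial by rw [Nat.factorial_succ]]
    push_cast
    linear_combination ((n:ℂ)+1) * n.factorial * h
  have hit : ∀ n, ∀ t : ℂ, t.re < 16 → iteratedDeriv (n+1) F t = G n t := by
    intro n
    induction n with
    | zero => intro t ht; rw [iteratedDeriv_one]; exact (dF t ht).deriv
    | succ n ih =>
      intro t ht
      rw [iteratedDeriv_succ]
      have : iteratedDeriv (n+1) F =ᶠ[𝓝 t] G n := by
        filter_upwards [hU.mem_nhds ht] with z hz using ih z hz
      rw [this.deriv_eq]
      exact (dG n t ht).deriv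
  have hball : ∀ t ∈ Metric.ball (0:ℂ) 16, F t = -24 := fun t ht => by
    have hsub : Metric.ball (0:ℂ) 16 ⊆ {t : ℂ | t.re < 16} := fun z hz => by
      rw [mem_ball_zero_iff] at hz
      exact (Complex.re_le_norm z).trans_lt hz
    have h := Complex.hasSum_taylorSeries_on_ball (hdF.mono hsub) ht
    refine h.unique ?_
    convert! hasSum_single (f := fun n => ((n.factorial : ℂ))⁻¹ • (t - 0)^n • iteratedDeriv n F 0) 0 ?_ using 1
    · have h0' := congrArg (fun x : ℝ => (x:ℂ)) h0
      push_cast at h0'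
      simp [hF, hj0]
      linear_combination -h0'
    · intro n hn
      obtain ⟨m, rfl⟩ := Nat.exists_eq_succ_of_ne_zero hn
      rw [Nat.succ_eq_add_one, hit m 0 (by simp), hG0]
      simp
  have hconv : IsPreconnected {t : ℂ | t.re < 16} := (convex_halfSpace_re_lt 16).isPreconnected
  have := (hdF.analyticOnNhd hU).eqOn_of_preconnected_of_eventuallyEq
    (analyticOnNhd_const (v := (-24:ℂ))) hconv (z₀ := 0) (by simp)
    (by filter_upwards [Metric.ball_mem_nhds (0:ℂ) (by norm_num : (0:ℝ) < 16)] with t ht using hball t ht)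
  exact this ht

omit hPm hwm hP hi in
lemma integral_resolv_ofReal (k : ℕ) (t : ℝ) : resolvInt μ P w k t =
    ((k.factorial * ∫ a, w a * ((P a - t)^(k+1))⁻¹ ∂μ : ℝ) : ℂ) := by
  rw [resolvInt]
  push_cast
  rw [← integral_complex_ofReal]
  push_cast
  rfl

end

lemma lintegral_comp_mul_Ioi {c : ℝ} (hc : 0 < c) (g : ℝ → ENNReal) :
    ∫⁻ x in Set.Ioi (0:ℝ), ENNReal.ofReal c * g (c * x) = ∫⁻ x in Set.Ioi (0:ℝ), g x := by
  have him : (fun x : ℝ => c * x) '' Set.Ioi 0 = Set.Ioi 0 := by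
    rw [Set.image_mul_left_Ioi hc, mul_zero]
  have h := lintegral_image_eq_lintegral_abs_deriv_mul (s := Set.Ioi (0:ℝ)) (f := fun x => c * x)
    (f' := fun _ => c) measurableSet_Ioi
    (fun x _ => by simpa using ((hasDerivAt_id x).const_mul c).hasDerivWithinAt)
    ((mul_right_injective₀ hc.ne').injOn) g
  rw [him, abs_of_pos hc] at h
  exact h.symm

lemma lintegral_comp_div_Ioi {c : ℝ} (hc : 0 < c) (g : ℝ → ENNReal) :
    ∫⁻ x in Set.Ioi (0:ℝ), ENNReal.ofReal (c / x^2) * g (c / x) = ∫⁻ x in Set.Ioi (0:ℝ), g x := by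
  have him : (fun x : ℝ => c / x) '' Set.Ioi 0 = Set.Ioi 0 := by
    ext y
    constructor
    · rintro ⟨x, hx, rfl⟩
      exact div_pos hc hx
    · intro hy
      have hy' : 0 < y := hy
      exact ⟨c / y, div_pos hc hy, by field_simp⟩
  have h := lintegral_image_eq_lintegral_abs_deriv_mul (s := Set.Ioi (0:ℝ)) (f := fun x => c / x)
    (f' := fun x => -(c / x^2)) measurableSet_Ioi
    (fun x hx => by
      have hx' : x ≠ 0 := (show (0:ℝ) < x from hx).ne'
      have := (hasDerivAt_const x c).fun_div (hasDerivAt_id x) hx'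
      refine (HasDerivAt.congr_deriv this ?_).hasDerivWithinAt
      simp [neg_div])
    (fun x hx y hy hxy => by
      have hx' : x ≠ 0 := (show (0:ℝ) < x from hx).ne'
      have hy' : y ≠ 0 := (show (0:ℝ) < y from hy).ne'
      have hxy' : c / x = c / y := hxy
      field_simp at hxy'
      exact hxy'.symm) g
  rw [him] at h
  rw [h]
  refine setLIntegral_congr_fun measurableSet_Ioi fun x hx => ?_
  have hx' : (0:ℝ) < x := hx
  rw [abs_neg, abs_of_nonneg (by positivity)]

lemma lintegral_Ioi_of_deriv {f f' : ℝ → ℝ} {a m : ℝ} (hc : ContinuousWithinAt f (Set.Ici a) a)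
    (hd : ∀ x ∈ Set.Ioi a, HasDerivAt f (f' x) x) (h0 : ∀ x ∈ Set.Ioi a, 0 ≤ f' x)
    (hm : Tendsto f atTop (𝓝 m)) :
    ∫⁻ x in Set.Ioi a, ENNReal.ofReal (f' x) = ENNReal.ofReal (m - f a) := by
  rw [← integral_Ioi_of_hasDerivAt_of_nonneg hc hd h0 hm,
    ofReal_integral_eq_lintegral_ofReal (integrableOn_Ioi_deriv_of_nonneg hc hd h0 hm)
      ((ae_restrict_iff' measurableSet_Ioi).2 (Eventually.of_forall h0))]

lemma lintegral_linear_inv {a b s : ℝ} (ha : 0 < a) (hb : 0 < b) (hs : 0 < s) (hab : b < a * s) :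
    ∫⁻ z in Set.Ioi (0:ℝ), ENNReal.ofReal (1 / ((a + z) * (b + s * z))) =
      ENNReal.ofReal (log (a * s / b) / (a * s - b)) := by
  have hD : 0 < a * s - b := sub_pos.2 hab
  have hd : ∀ x : ℝ, 0 ≤ x → HasDerivAt (fun z => (log (b + s * z) - log (a + z)) / (a * s - b))
      (1 / ((a + x) * (b + s * x))) x := fun x hx => by
    have h1 : 0 < b + s * x := by positivity
    have h2 : 0 < a + x := by positivity
    have := (((((hasDerivAt_id x).const_mul s).const_add b).log h1.ne').fun_sub
      (((hasDerivAt_id x).const_add a).log h2.ne')).div_const (a * s - b)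
    refine this.congr_deriv ?_
    simp only [id]
    rw [div_eq_iff hD.ne']
    field_simp
    ring
  have hm : Tendsto (fun z => (log (b + s * z) - log (a + z)) / (a * s - b)) atTop
      (𝓝 (log s / (a * s - b))) := by
    have h1 : Tendsto (fun z : ℝ => (b - s * a) / (a + z) + s) atTop (𝓝 (0 + s)) :=
      (tendsto_const_nhds.div_atTop (tendsto_atTop_add_const_left _ a tendsto_id)).add_const s
    rw [zero_add] at h1
    refine ((h1.log hs.ne').congr' ?_).div_const _
    filter_upwards [eventually_gt_atTop 0] with z hz
    rw [← log_div (by positivity) (by positivity)]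
    congr 1
    field_simp
    ring
  rw [lintegral_Ioi_of_deriv (hd 0 le_rfl).continuousAt.continuousWithinAt
    (fun x hx => hd x (le_of_lt hx)) (fun x hx => ?_) hm]
  · rw [mul_zero, add_zero, add_zero, log_div (by positivity) (by positivity), log_mul ha.ne' hs.ne']
    congr 1
    ring
  · have : (0:ℝ) < x := hx
    positivity

lemma lintegral_pow_mul_exp (n : ℕ) {c : ℝ} (hc : 0 < c) :
    ∫⁻ x in Set.Ioi (0:ℝ), ENNReal.ofReal (x^n * exp (-(c * x))) =
      ENNReal.ofReal (n.factorial / c^(n+1)) := by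
  have h1 : ∫⁻ x in Set.Ioi (0:ℝ), ENNReal.ofReal (exp (-x) * x^n) = ENNReal.ofReal n.factorial := by
    have hg := Real.GammaIntegral_convergent (show (0:ℝ) < n + 1 by positivity)
    have e := Real.Gamma_eq_integral (show (0:ℝ) < n + 1 by positivity)
    rw [Real.Gamma_nat_eq_factorial] at e
    simp only [add_sub_cancel_right, rpow_natCast] at e hg
    rw [e, ofReal_integral_eq_lintegral_ofReal hg]
    refine (ae_restrict_iff' measurableSet_Ioi).2 (Eventually.of_forall fun x hx => ?_)
    have : (0:ℝ) < x := hx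
    simp only [Pi.zero_apply]
    positivity
  rw [show (n.factorial : ℝ) / c^(n+1) = (c^(n+1))⁻¹ * n.factorial by ring,
    ENNReal.ofReal_mul (by positivity), ← h1,
    ← lintegral_comp_mul_Ioi hc (fun x => ENNReal.ofReal (exp (-x) * x^n)),
    ← lintegral_const_mul' _ _ ENNReal.ofReal_ne_top]
  refine setLIntegral_congr_fun measurableSet_Ioi fun x hx => ?_
  have hx' : (0:ℝ) < x := hx
  rw [← ENNReal.ofReal_mul hc.le, ← ENNReal.ofReal_mul (by positivity)]
  congr 1
  rw [mul_pow]
  field_simp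
  ring

lemma zeta3_nonneg : 0 ≤ zeta3 := tsum_nonneg fun k => by positivity

lemma lintegral_log_sq : ∫⁻ s in Set.Ioi (0:ℝ), ENNReal.ofReal (2 * log (1 + s)^2 / (s * (s + 2))) =
    ENNReal.ofReal (7/2 * zeta3) := by
  have him : (fun x : ℝ => exp x - 1) '' Set.Ioi 0 = Set.Ioi 0 := by
    ext y
    constructor
    · rintro ⟨x, hx, rfl⟩
      exact sub_pos.2 (one_lt_exp_iff.2 hx)
    · intro hy
      have hy' : 0 < y := hy
      exact ⟨log (1 + y), log_pos (by linarith), by simp only; rw [exp_log (by linarith)]; ring⟩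
  have h := lintegral_image_eq_lintegral_abs_deriv_mul (s := Set.Ioi (0:ℝ)) (f := fun x => exp x - 1)
    (f' := fun x => exp x) measurableSet_Ioi
    (fun x hx => ((hasDerivAt_exp x).sub_const 1).hasDerivWithinAt)
    (fun x hx y hy hxy => exp_injective (by simpa using hxy))
    (fun s => ENNReal.ofReal (2 * log (1 + s)^2 / (s * (s + 2))))
  rw [him] at h
  rw [h]
  have e : ∀ w ∈ Set.Ioi (0:ℝ), ENNReal.ofReal |exp w| *
      ENNReal.ofReal (2 * log (1 + (exp w - 1))^2 / ((exp w - 1) * (exp w - 1 + 2))) =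
      ∑' k : ℕ, ENNReal.ofReal (2 * (w^2 * exp (-((2*k+1) * w)))) := fun w hw => by
    have hw' : (0:ℝ) < w := hw
    have hE := one_lt_exp_iff.2 hw'
    have h2 : exp (-(2*w)) < 1 := exp_neg_lt_one (by positivity)
    have hs : HasSum (fun k : ℕ => 2 * (w^2 * exp (-((2*k+1) * w))))
        (2 * w^2 * exp (-w) * (1 - exp (-(2*w)))⁻¹) := by
      convert! (hasSum_geometric_of_lt_one (exp_pos (-(2*w))).le h2).mul_left (2 * w^2 * exp (-w)) using 1
      ext k
      rw [← exp_nat_mul, mul_assoc, mul_assoc, ← exp_add]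
      congr 4
      ring
    rw [← ENNReal.ofReal_tsum_of_nonneg (fun k => by positivity) hs.summable, hs.tsum_eq, abs_exp,
      ← ENNReal.ofReal_mul (exp_pos w).le]
    congr 1
    rw [show 1 + (exp w - 1) = exp w by ring, log_exp, show exp (-(2*w)) = (exp w)⁻¹^2 by
      rw [← exp_neg, ← exp_nat_mul]; congr 1; push_cast; ring, exp_neg]
    have h3 : exp w - 1 ≠ 0 := by linarith
    have h4 : exp w + 1 ≠ 0 := by positivity
    have h5 : 1 - (exp w)⁻¹^2 = (exp w - 1) * (exp w + 1) / exp w^2 := by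
      field_simp; ring
    rw [h5, show exp w - 1 + 2 = exp w + 1 by ring]
    field_simp
  rw [setLIntegral_congr_fun measurableSet_Ioi e, lintegral_tsum (fun k => by fun_prop)]
  have e2 : ∀ k : ℕ, ∫⁻ w in Set.Ioi (0:ℝ), ENNReal.ofReal (2 * (w^2 * exp (-((2*k+1) * w)))) =
      ENNReal.ofReal (4 * (1 / (2*(k:ℝ)+1)^3)) := fun k => by
    simp_rw [ENNReal.ofReal_mul (show (0:ℝ) ≤ 2 by norm_num)]
    rw [lintegral_const_mul' _ _ ENNReal.ofReal_ne_top, lintegral_pow_mul_exp 2 (by positivity),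
      ← ENNReal.ofReal_mul (by norm_num)]
    congr 1
    norm_num [Nat.factorial]
    ring
  simp_rw [e2]
  have hz := sum_zeta3_pos.hasSum
  have hodd : HasSum (fun k : ℕ => 1 / (2*(k:ℝ)+1)^3) (7/8 * zeta3) := by
    have he : HasSum (fun k : ℕ => 1 / ((2*k+1 : ℕ) + 1 : ℝ)^3) (1/8 * zeta3) := by
      convert! hz.mul_left (1/8) using 1
      ext k
      push_cast
      rw [show (2 * (k:ℝ) + 1 + 1) = 2 * (k + 1) by ring, mul_pow]
      field_simp
      norm_num
    have hso : Summable (fun k : ℕ => 1 / (2*(k:ℝ)+1)^3) := by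
      have := sum_zeta3_pos.comp_injective (mul_right_injective₀ (two_ne_zero (α := ℕ)))
      refine this.congr fun k => ?_
      simp
    have := HasSum.even_add_odd (f := fun k : ℕ => 1 / ((k:ℝ)+1)^3) (m := ∑' k : ℕ, 1 / (2*(k:ℝ)+1)^3)
      (by convert! hso.hasSum using 1; ext k; push_cast; rfl) he
    have e := this.unique hz
    convert! hso.hasSum using 1
    have : zeta3 = ∑' k : ℕ, 1 / ((k:ℝ)+1)^3 := rfl
    linarith
  rw [← ENNReal.ofReal_tsum_of_nonneg (fun k => by positivity) (hodd.mul_left 4).summable,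
    (hodd.mul_left 4).tsum_eq]
  congr 1
  ring

lemma lintegral_log_kernel : ∫⁻ x in Set.Ioi (0:ℝ), ∫⁻ y in Set.Ioi (0:ℝ),
    ENNReal.ofReal (log (1 + x + y) / ((x + y) * (1 + x) * (1 + y))) = ENNReal.ofReal (7/2 * zeta3) := by
  have e1 : ∀ x ∈ Set.Ioi (0:ℝ), ∫⁻ y in Set.Ioi (0:ℝ),
      ENNReal.ofReal (log (1 + x + y) / ((x + y) * (1 + x) * (1 + y))) =
      ∫⁻ v in Set.Ioi (0:ℝ), ENNReal.ofReal (log (1 + (1 + v) * x) / ((1 + v) * (1 + x) * (1 + x * v))) :=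
    fun x hx => by
    have hx' : (0:ℝ) < x := hx
    rw [← lintegral_comp_mul_Ioi hx']
    refine setLIntegral_congr_fun measurableSet_Ioi fun v hv => ?_
    have hv' : (0:ℝ) < v := hv
    rw [← ENNReal.ofReal_mul hx'.le]
    congr 1
    rw [show 1 + x + x * v = 1 + (1 + v) * x by ring]
    field_simp
  rw [setLIntegral_congr_fun measurableSet_Ioi e1, lintegral_lintegral_swap (by fun_prop)]
  have e2 : ∀ v ∈ Set.Ioi (0:ℝ), ∫⁻ x in Set.Ioi (0:ℝ),
      ENNReal.ofReal (log (1 + (1 + v) * x) / ((1 + v) * (1 + x) * (1 + x * v))) =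
      ∫⁻ s in Set.Ioi (0:ℝ), ENNReal.ofReal (log (1 + s)) *
        ENNReal.ofReal (1 / ((1 + s + v) * (1 + (1 + s) * v))) :=
    fun v hv => by
    have hv' : (0:ℝ) < v := hv
    rw [← lintegral_comp_mul_Ioi (show 0 < 1 + v by positivity)
      (fun s => ENNReal.ofReal (log (1 + s)) * ENNReal.ofReal (1 / ((1 + s + v) * (1 + (1 + s) * v))))]
    refine setLIntegral_congr_fun measurableSet_Ioi fun x hx => ?_
    have hx' : (0:ℝ) < x := hx
    have hl : 0 ≤ log (1 + (1 + v) * x) := log_nonneg (by nlinarith [mul_pos hv' hx'])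
    rw [← ENNReal.ofReal_mul hl, ← ENNReal.ofReal_mul (by positivity)]
    congr 1
    rw [show 1 + (1 + v) * x + v = (1 + v) * (1 + x) by ring,
      show 1 + (1 + (1 + v) * x) * v = (1 + v) * (1 + x * v) by ring]
    field_simp
  rw [setLIntegral_congr_fun measurableSet_Ioi e2, lintegral_lintegral_swap (by fun_prop), ← lintegral_log_sq]
  refine setLIntegral_congr_fun measurableSet_Ioi fun s hs => ?_
  have hs' : (0:ℝ) < s := hs
  have hl : 0 ≤ log (1 + s) := log_nonneg (by linarith)
  rw [lintegral_const_mul' _ _ ENNReal.ofReal_ne_top,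
    lintegral_linear_inv (by positivity) one_pos (by positivity) (by nlinarith), ← ENNReal.ofReal_mul hl]
  congr 1
  rw [div_one, log_mul (by positivity) (by positivity), show (1 + s) * (1 + s) - 1 = s * (s + 2) by ring]
  ring

lemma lintegral_banana_zero : ∫⁻ x in Set.Ioi (0:ℝ), ∫⁻ y in Set.Ioi (0:ℝ), ∫⁻ z in Set.Ioi (0:ℝ),
    ENNReal.ofReal (((1 + x + y + z) * (1 + 1/x + 1/y + 1/z))⁻¹ / (x * y * z)) =
      ENNReal.ofReal (7 * zeta3) := by
  set h : ℝ → ℝ → ENNReal := fun x y =>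
    ENNReal.ofReal (log (1 + x + y) / ((x + y) * (1 + x) * (1 + y))) with hh
  have e : ∀ x ∈ Set.Ioi (0:ℝ), ∫⁻ y in Set.Ioi (0:ℝ), ∫⁻ z in Set.Ioi (0:ℝ),
      ENNReal.ofReal (((1 + x + y + z) * (1 + 1/x + 1/y + 1/z))⁻¹ / (x * y * z)) =
      (∫⁻ y in Set.Ioi (0:ℝ), h x y) + ENNReal.ofReal (1 / x^2) * ∫⁻ y in Set.Ioi (0:ℝ), h (1/x) y :=
    fun x hx => by
    have hx' : (0:ℝ) < x := hx
    rw [← lintegral_comp_div_Ioi one_pos (h (1/x)), ← lintegral_const_mul' _ _ ENNReal.ofReal_ne_top,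
      ← lintegral_add_left (by fun_prop)]
    refine setLIntegral_congr_fun measurableSet_Ioi fun y hy => ?_
    have hy' : (0:ℝ) < y := hy
    have e3 : ∀ z ∈ Set.Ioi (0:ℝ),
        ENNReal.ofReal (((1 + x + y + z) * (1 + 1/x + 1/y + 1/z))⁻¹ / (x * y * z)) =
        ENNReal.ofReal (1 / ((1 + x + y + z) * (x * y + (x * y + x + y) * z))) := fun z hz => by
      have hz' : (0:ℝ) < z := hz
      congr 1
      field_simp
      ring
    have hl1 : 0 ≤ log (1 + x + y) := log_nonneg (by linarith)
    have hl2 : 0 ≤ log (1 + 1/x + 1/y) := log_nonneg (by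
      have : 0 < 1/x := by positivity
      have : 0 < 1/y := by positivity
      linarith)
    rw [setLIntegral_congr_fun measurableSet_Ioi e3,
      lintegral_linear_inv (by positivity) (by positivity) (by positivity)
        (by nlinarith [mul_pos hx' hy', mul_pos (mul_pos hx' hy') hx', mul_pos (mul_pos hx' hy') hy']), hh]
    simp only
    rw [← ENNReal.ofReal_mul (by positivity), ← ENNReal.ofReal_mul (by positivity),
      ← ENNReal.ofReal_add (by positivity) (by positivity)]
    congr 1
    rw [show (1 + x + y) * (x * y + x + y) / (x * y) = (1 + x + y) * (1 + 1/x + 1/y) by field_simp; ring,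
      log_mul (by positivity) (by positivity),
      show (1 + x + y) * (x * y + x + y) - x * y = (x + y) * (1 + x) * (1 + y) by ring]
    generalize log (1 + 1/x + 1/y) = l
    field_simp
    ring
  have hm : Measurable fun x => ∫⁻ y in Set.Ioi (0:ℝ), h x y :=
    Measurable.lintegral_prod_right' (f := fun p : ℝ × ℝ => h p.1 p.2) (by fun_prop)
  rw [setLIntegral_congr_fun measurableSet_Ioi e, lintegral_add_left hm,
    lintegral_comp_div_Ioi one_pos (fun x => ∫⁻ y in Set.Ioi (0:ℝ), h x y), hh, lintegral_log_kernel,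
    ← ENNReal.ofReal_add (by have := zeta3_nonneg; positivity) (by have := zeta3_nonneg; positivity)]
  congr 1
  ring

/-- The Bessel-type integrals `∫₀^∞ exp(-u - p/u) u^{-i} du`. -/
noncomputable def bes (i : ℕ) (p : ℝ) : ℝ := ∫ u in Set.Ioi (0:ℝ), exp (-u - p/u) / u^i

lemma aesm_bes_integrand (i : ℕ) (p : ℝ) :
    AEStronglyMeasurable (fun u : ℝ => exp (-u - p/u) / u^i) (volume.restrict (Set.Ioi 0)) :=
  (by fun_prop : Measurable fun u : ℝ => exp (-u - p/u) / u^i).aestronglyMeasurable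

lemma bes_integrand_le (i : ℕ) {p u : ℝ} (hp : 0 < p) (hu : 0 < u) :
    exp (-u - p/u) / u^i ≤ i.factorial / p^i * exp (-u) := by
  have h := pow_div_factorial_le_exp (p/u) (by positivity) i
  rw [sub_eq_add_neg, exp_add, exp_neg (p/u)]
  have hf : (0:ℝ) < i.factorial := by exact_mod_cast i.factorial_pos
  have : (exp (p/u))⁻¹ ≤ ((p/u)^i / i.factorial)⁻¹ := inv_anti₀ (by positivity) h
  calc _ ≤ exp (-u) * ((p/u)^i / i.factorial)⁻¹ / u^i := by gcongr
    _ = _ := by rw [div_pow]; field_simp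

lemma integrableOn_exp_neg : IntegrableOn (fun u : ℝ => exp (-u)) (Set.Ioi 0) :=
  integrableOn_exp_neg_Ioi 0

lemma integrableOn_bes (i : ℕ) {p : ℝ} (hp : 0 < p) :
    IntegrableOn (fun u : ℝ => exp (-u - p/u) / u^i) (Set.Ioi 0) := by
  refine (integrableOn_exp_neg.const_mul (i.factorial / p^i)).mono' (aesm_bes_integrand i p) ?_
  refine (ae_restrict_iff' measurableSet_Ioi).2 (Eventually.of_forall fun u hu => ?_)
  have hu' : (0:ℝ) < u := hu
  rw [norm_of_nonneg (by positivity)]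
  exact bes_integrand_le i hp hu

lemma bes_nonneg (i : ℕ) (p : ℝ) : 0 ≤ bes i p :=
  setIntegral_nonneg measurableSet_Ioi fun u hu => by
    have hu' : (0:ℝ) < u := hu
    positivity

lemma hasDerivAt_bes (i : ℕ) {p : ℝ} (hp : 0 < p) : HasDerivAt (bes i) (-bes (i+1) p) p := by
  have hs : Set.Ioi (p/2) ∈ 𝓝 p := Ioi_mem_nhds (by linarith)
  have key := (hasDerivAt_integral_of_dominated_loc_of_deriv_le
    (μ := volume.restrict (Set.Ioi (0:ℝ))) (𝕜 := ℝ) (x₀ := p)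
    (F := fun q u => exp (-u - q/u) / u^i) (F' := fun q u => -(exp (-u - q/u) / u^(i+1)))
    (bound := fun u => exp (-u - (p/2)/u) / u^(i+1)) hs
    (Eventually.of_forall fun q => aesm_bes_integrand i q) (integrableOn_bes i hp)
    (aesm_bes_integrand (i+1) p).neg ?_
    (integrableOn_bes (i+1) (by positivity)) ?_).2
  · rw [integral_neg] at key
    exact key
  · refine (ae_restrict_iff' measurableSet_Ioi).2 (Eventually.of_forall fun u hu q hq => ?_)
    have hu' : (0:ℝ) < u := hu
    have hq' : p/2 < q := hq
    rw [norm_neg, norm_of_nonneg (by positivity)]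
    gcongr
  · refine (ae_restrict_iff' measurableSet_Ioi).2 (Eventually.of_forall fun u hu q hq => ?_)
    have hu' : (0:ℝ) < u := hu
    have := ((((hasDerivAt_id q).div_const u).const_sub (-u)).exp).div_const (u^i)
    refine this.congr_deriv ?_
    simp only [id]
    field_simp
    ring

lemma bes_two {p : ℝ} (hp : 0 < p) : bes 2 p = bes 0 p / p := by
  have h0 : ∀ i, bes i p = (∫⁻ u in Set.Ioi (0:ℝ), ENNReal.ofReal (exp (-u - p/u) / u^i)).toReal := fun i => by
    rw [bes, integral_eq_lintegral_of_nonneg_ae _ (aesm_bes_integrand i p)]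
    refine (ae_restrict_iff' measurableSet_Ioi).2 (Eventually.of_forall fun u hu => ?_)
    have hu' : (0:ℝ) < u := hu
    simp only [Pi.zero_apply]
    positivity
  rw [h0, h0, ← lintegral_comp_div_Ioi hp (fun u => ENNReal.ofReal (exp (-u - p/u) / u^0)),
    div_eq_inv_mul, ← ENNReal.toReal_ofReal (inv_nonneg.2 hp.le), ← ENNReal.toReal_mul,
    ← lintegral_const_mul' _ _ ENNReal.ofReal_ne_top]
  congr 1
  refine setLIntegral_congr_fun measurableSet_Ioi fun u hu => ?_
  have hu' : (0:ℝ) < u := hu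
  rw [← ENNReal.ofReal_mul (by positivity), ← ENNReal.ofReal_mul (by positivity)]
  congr 1
  rw [show -(p/u) - p/(p/u) = -u - p/u by field_simp; ring]
  field_simp

lemma bes_exponent_le {p u : ℝ} (hp : 0 < p) (hu : 0 < u) :
    -u - p/u ≤ -(1/2*u) - √p - p/u/2 := by
  have h : 2 * √p * u ≤ u * u + p := by nlinarith [sq_nonneg (√p - u), sq_sqrt hp.le]
  have : 2 * √p ≤ u + p/u := by
    rw [show u + p/u = (u * u + p) / u by field_simp, le_div_iff₀ hu]
    exact h
  linarith

lemma bes_zero_le {p : ℝ} (hp : 0 < p) : bes 0 p ≤ 2 * exp (-√p) := by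
  have hi : IntegrableOn (fun u : ℝ => exp (-(1/2) * u)) (Set.Ioi 0) := integrableOn_exp_mul_Ioi (by norm_num) 0
  have : ∫ u in Set.Ioi (0:ℝ), exp (-√p) * exp (-(1/2) * u) = 2 * exp (-√p) := by
    rw [integral_const_mul, integral_exp_mul_Ioi (by norm_num)]
    norm_num
    ring
  rw [← this, bes]
  refine setIntegral_mono_on (integrableOn_bes 0 hp) (hi.const_mul _) measurableSet_Ioi fun u hu => ?_
  have hu' : (0:ℝ) < u := hu
  rw [pow_zero, div_one, ← exp_add]
  have := bes_exponent_le hp hu'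
  have : 0 < p/u/2 := by positivity
  exact exp_le_exp.2 (by linarith)

lemma exp_neg_le_rpow {x : ℝ} (hx : 0 < x) : exp (-x) ≤ x ^ (-(1/8) : ℝ) := by
  rw [rpow_neg hx.le, exp_neg]
  refine inv_anti₀ (by positivity) ?_
  have := add_one_le_exp x
  rcases le_or_gt x 1 with h | h
  · have := rpow_le_one hx.le h (show (0:ℝ) ≤ 1/8 by norm_num)
    linarith
  · have h2 := rpow_le_rpow_of_exponent_le h.le (show (1/8 : ℝ) ≤ 1 by norm_num)
    rw [rpow_one] at h2
    linarith

lemma exists_bes_one_le : ∃ C : ℝ, 0 < C ∧ ∀ p : ℝ, 0 < p → bes 1 p ≤ C * (p ^ (-(1/8) : ℝ) * exp (-√p)) := by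
  have hi : IntegrableOn (fun u : ℝ => u ^ (-(7/8) : ℝ) * exp (-(1/2) * u ^ (1:ℝ))) (Set.Ioi 0) :=
    integrableOn_rpow_mul_exp_neg_mul_rpow (by norm_num) one_pos (by norm_num)
  set D := ∫ u in Set.Ioi (0:ℝ), u ^ (-(7/8) : ℝ) * exp (-(1/2) * u ^ (1:ℝ)) with hD
  have hD0 : 0 ≤ D := setIntegral_nonneg measurableSet_Ioi fun u hu => by
    have hu' : (0:ℝ) < u := hu
    positivity
  refine ⟨2 ^ (1/8 : ℝ) * D + 1, by positivity, fun p hp => ?_⟩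
  have e : bes 1 p ≤ ∫ u in Set.Ioi (0:ℝ), 2 ^ (1/8 : ℝ) * (p ^ (-(1/8) : ℝ) * exp (-√p)) *
      (u ^ (-(7/8) : ℝ) * exp (-(1/2) * u ^ (1:ℝ))) := by
    refine setIntegral_mono_on (integrableOn_bes 1 hp) (hi.const_mul _) measurableSet_Ioi fun u hu => ?_
    have hu' : (0:ℝ) < u := hu
    have h1 := exp_le_exp.2 (bes_exponent_le hp hu')
    rw [show -(1/2*u) - √p - p/u/2 = -(1/2) * u ^ (1:ℝ) + -√p + -(p/u/2) by rw [rpow_one]; ring, exp_add, exp_add] at h1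
    have h2 := exp_neg_le_rpow (show 0 < p/u/2 by positivity)
    have e2 : (p/u/2) ^ (-(1/8) : ℝ) / u = 2 ^ (1/8 : ℝ) * p ^ (-(1/8) : ℝ) * u ^ (-(7/8) : ℝ) := by
      rw [div_rpow (by positivity) (by norm_num), div_rpow hp.le hu'.le, rpow_neg (by norm_num : (0:ℝ) ≤ 2),
        rpow_neg hu'.le (1/8), show (-(7/8):ℝ) = 1/8 - 1 by norm_num, rpow_sub_one hu'.ne']
      field_simp
    calc exp (-u - p/u) / u^1 ≤ exp (-(1/2) * u ^ (1:ℝ)) * exp (-√p) * (p/u/2) ^ (-(1/8) : ℝ) / u := by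
          rw [pow_one]
          gcongr
          exact h1.trans (by gcongr)
      _ = exp (-(1/2) * u ^ (1:ℝ)) * exp (-√p) * ((p/u/2) ^ (-(1/8) : ℝ) / u) := by ring
      _ = _ := by rw [e2]; ring
  rw [integral_const_mul, ← hD] at e
  have : 0 ≤ p ^ (-(1/8) : ℝ) * exp (-√p) := by positivity
  nlinarith

lemma bes_zero_zero : bes 0 0 = 1 := by
  rw [bes]
  simpa using integral_exp_neg_Ioi 0

lemma tendsto_bes_zero : Tendsto (bes 0) (𝓝[>] 0) (𝓝 1) := by
  rw [← bes_zero_zero]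
  refine tendsto_integral_filter_of_dominated_convergence (fun u => exp (-u))
    (Eventually.of_forall fun q => aesm_bes_integrand 0 q) ?_ integrableOn_exp_neg ?_
  · filter_upwards [self_mem_nhdsWithin] with p hp
    refine (ae_restrict_iff' measurableSet_Ioi).2 (Eventually.of_forall fun u hu => ?_)
    have hu' : (0:ℝ) < u := hu
    have hp' : (0:ℝ) < p := hp
    rw [norm_of_nonneg (by positivity), pow_zero, div_one]
    have : 0 < p/u := by positivity
    exact exp_le_exp.2 (by linarith)
  · refine (Eventually.of_forall fun u => ?_)
    refine Tendsto.mono_left ?_ nhdsWithin_le_nhds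
    have : Continuous fun p : ℝ => exp (-u - p/u) / u^0 := by
      simp only [pow_zero, div_one]; fun_prop
    exact this.tendsto 0

/-- The moments of products of `bes 1` and `bes 0`. -/
noncomputable def besMom (a b s : ℕ) : ℝ := ∫ p in Set.Ioi (0:ℝ), p^s * (bes 1 p)^a * (bes 0 p)^b

lemma exists_bes_mul_le (a b s : ℕ) (hab : 1 ≤ a + b) : ∃ C : ℝ, 0 < C ∧ ∀ p : ℝ, 0 < p →
    p^s * (bes 1 p)^a * (bes 0 p)^b ≤ C * (p ^ ((s:ℝ) - a/8) * exp (-1 * p ^ (1/2 : ℝ))) := by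
  obtain ⟨C, hC, h⟩ := exists_bes_one_le
  refine ⟨C^a * 2^b, by positivity, fun p hp => ?_⟩
  have hE : exp (-√p) ≤ 1 := exp_le_one_iff.2 (by have := sqrt_nonneg p; linarith)
  have h1 : exp (-√p)^(a+b) ≤ exp (-√p) := pow_le_of_le_one (exp_pos _).le hE (by omega)
  have hk := bes_nonneg 1 p
  have hl := bes_nonneg 0 p
  calc p^s * (bes 1 p)^a * (bes 0 p)^b ≤
      p^s * (C * (p ^ (-(1/8) : ℝ) * exp (-√p)))^a * (2 * exp (-√p))^b := by
        gcongr
        · exact h p hp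
        · exact bes_zero_le hp
    _ = C^a * 2^b * (p^s * (p ^ (-(1/8) : ℝ))^a * exp (-√p)^(a+b)) := by
      rw [mul_pow, mul_pow, mul_pow, pow_add]; ring
    _ ≤ C^a * 2^b * (p^s * (p ^ (-(1/8) : ℝ))^a * exp (-√p)) := by gcongr
    _ = _ := by
      rw [← rpow_natCast p s, ← rpow_natCast (p ^ (-(1/8) : ℝ)) a, ← rpow_mul hp.le, ← rpow_add hp, sqrt_eq_rpow,
        neg_one_mul]
      congr 4
      ring

lemma aesm_bes (i : ℕ) : AEStronglyMeasurable (bes i) (volume.restrict (Set.Ioi 0)) :=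
  ContinuousOn.aestronglyMeasurable
    (fun _ hp => (hasDerivAt_bes i hp).continuousAt.continuousWithinAt) measurableSet_Ioi

lemma integrableOn_besMom (a b s : ℕ) (hab : 1 ≤ a + b) (ha : a ≤ 7) :
    IntegrableOn (fun p => p^s * (bes 1 p)^a * (bes 0 p)^b) (Set.Ioi 0) := by
  obtain ⟨C, hC, h⟩ := exists_bes_mul_le a b s hab
  have ha' : (a:ℝ) ≤ 7 := by exact_mod_cast ha
  have hs : (0:ℝ) ≤ s := s.cast_nonneg
  refine ((integrableOn_rpow_mul_exp_neg_mul_rpow (s := (s:ℝ) - a/8) (by linarith)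
    (by norm_num : (0:ℝ) < 1/2) one_pos).const_mul C).mono' ?_ ?_
  · exact ((by fun_prop : AEStronglyMeasurable (fun p : ℝ => p^s) _).mul ((aesm_bes 1).pow a)).mul
      ((aesm_bes 0).pow b)
  · refine (ae_restrict_iff' measurableSet_Ioi).2 (Eventually.of_forall fun p hp => ?_)
    have hp' : (0:ℝ) < p := hp
    have hk := bes_nonneg 1 p
    have hl := bes_nonneg 0 p
    rw [norm_of_nonneg (by positivity)]
    exact h p hp

lemma tendsto_besMom_atTop (a b s : ℕ) (hab : 1 ≤ a + b) :
    Tendsto (fun p => p^s * (bes 1 p)^a * (bes 0 p)^b) atTop (𝓝 0) := by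
  obtain ⟨C, hC, h⟩ := exists_bes_mul_le a b s hab
  have h1 := ((tendsto_rpow_mul_exp_neg_mul_atTop_nhds_zero (2 * ((s:ℝ) - a/8)) 1 one_pos).comp
    (tendsto_rpow_atTop (by norm_num : (0:ℝ) < 1/2))).const_mul C
  rw [mul_zero] at h1
  refine squeeze_zero' ?_ ?_ h1
  · filter_upwards [eventually_gt_atTop 0] with p hp
    have hk := bes_nonneg 1 p
    have hl := bes_nonneg 0 p
    positivity
  · filter_upwards [eventually_gt_atTop 0] with p hp
    refine (h p hp).trans_eq ?_
    simp only [Function.comp_apply]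
    rw [← rpow_mul hp.le]
    congr 3
    ring

lemma tendsto_besMom_zero (a b s : ℕ) (hab : 1 ≤ a + b) (ha : a ≤ 7) :
    Tendsto (fun p => p^(s+1) * (bes 1 p)^a * (bes 0 p)^b) (𝓝[>] 0) (𝓝 0) := by
  obtain ⟨C, hC, h⟩ := exists_bes_mul_le a b (s+1) hab
  have ha' : (a:ℝ) ≤ 7 := by exact_mod_cast ha
  have hs : (0:ℝ) ≤ s := s.cast_nonneg
  have hpos : 0 < ((s+1:ℕ):ℝ) - a/8 := by push_cast; linarith
  have h1 : Tendsto (fun p : ℝ => C * p ^ (((s+1:ℕ):ℝ) - a/8)) (𝓝[>] 0) (𝓝 0) := by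
    have := ((continuousAt_rpow_const (0:ℝ) (((s+1:ℕ):ℝ) - a/8) (Or.inr hpos.le)).tendsto.mono_left
      (nhdsWithin_le_nhds (s := Set.Ioi 0))).const_mul C
    rwa [zero_rpow hpos.ne', mul_zero] at this
  refine squeeze_zero' ?_ ?_ h1
  · filter_upwards [self_mem_nhdsWithin] with p hp
    have hp' : (0:ℝ) < p := hp
    have hk := bes_nonneg 1 p
    have hl := bes_nonneg 0 p
    positivity
  · filter_upwards [self_mem_nhdsWithin] with p hp
    have hp' : (0:ℝ) < p := hp
    refine (h p hp).trans ?_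
    have : exp (-1 * p ^ (1/2 : ℝ)) ≤ 1 := exp_le_one_iff.2 (by
      have : 0 ≤ p ^ (1/2 : ℝ) := by positivity
      linarith)
    have h3 : 0 ≤ p ^ (((s+1:ℕ):ℝ) - a/8) := by positivity
    gcongr
    nlinarith

lemma hasDerivAt_besMom (a b s : ℕ) {p : ℝ} (hp : 0 < p) :
    HasDerivAt (fun p => p^s * (bes 1 p)^a * (bes 0 p)^b)
      (s * (p^(s-1) * (bes 1 p)^a * (bes 0 p)^b) - a * (p^s * (bes 1 p)^(a-1) * (bes 0 p)^(b+1)) / p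
        - b * (p^s * (bes 1 p)^(a+1) * (bes 0 p)^(b-1))) p := by
  have := ((((hasDerivAt_id p).fun_pow s).fun_mul ((hasDerivAt_bes 1 hp).fun_pow a)).fun_mul
    ((hasDerivAt_bes 0 hp).fun_pow b))
  refine this.congr_deriv ?_
  rw [show 1 + 1 = 2 from rfl, bes_two hp]
  simp only [id, pow_succ]
  field_simp
  ring

lemma besMom_ibp (a b s : ℕ) (hab : 2 ≤ a + b) (ha : a ≤ 6) : ((s:ℝ)+1) * besMom a b s =
    a * besMom (a-1) (b+1) s + b * besMom (a+1) (b-1) (s+1) := by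
  have i1 := (integrableOn_besMom a b s (by omega) (by omega)).const_mul ((s:ℝ)+1)
  have i2 := (integrableOn_besMom (a-1) (b+1) s (by omega) (by omega)).const_mul (a:ℝ)
  have i3 := (integrableOn_besMom (a+1) (b-1) (s+1) (by omega) (by omega)).const_mul (b:ℝ)
  have key := integral_Ioi_of_hasDerivAt_of_tendsto (a := 0) (m := 0)
    (f := fun p => p^(s+1) * (bes 1 p)^a * (bes 0 p)^b)
    (f' := fun p => ((s:ℝ)+1) * (p^s * (bes 1 p)^a * (bes 0 p)^b) -
      a * (p^s * (bes 1 p)^(a-1) * (bes 0 p)^(b+1)) - b * (p^(s+1) * (bes 1 p)^(a+1) * (bes 0 p)^(b-1)))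
    (by
      rw [← continuousWithinAt_Ioi_iff_Ici, ContinuousWithinAt]
      simp only [ne_eq, Nat.add_eq_zero_iff, one_ne_zero, and_false, not_false_eq_true, zero_pow, zero_mul]
      exact tendsto_besMom_zero a b s (by omega) (by omega))
    (fun p hp => by
      have hp' : (0:ℝ) < p := hp
      refine (hasDerivAt_besMom a b (s+1) hp).congr_deriv ?_
      rw [Nat.add_sub_cancel]
      push_cast
      rw [pow_succ]
      field_simp)
    ((i1.sub i2).sub i3) (tendsto_besMom_atTop a b (s+1) (by omega))
  have i12 : IntegrableOn (fun p => ((s:ℝ)+1) * (p^s * (bes 1 p)^a * (bes 0 p)^b) -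
      a * (p^s * (bes 1 p)^(a-1) * (bes 0 p)^(b+1))) (Set.Ioi 0) := i1.sub i2
  rw [integral_sub i12 i3, integral_sub i1 i2, integral_const_mul, integral_const_mul,
    integral_const_mul] at key
  simp only [ne_eq, Nat.add_eq_zero_iff, one_ne_zero, and_false, not_false_eq_true, zero_pow, zero_mul, sub_zero] at key
  simp only [besMom]
  linarith

lemma besMom_one_three : besMom 1 3 0 = 1/4 := by
  have i := (integrableOn_besMom 1 3 0 (by omega) (by omega)).const_mul (-4)
  set f : ℝ → ℝ := fun p => if p = 0 then 1 else (bes 0 p)^4 with hf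
  have hfe : ∀ p > 0, f p = (bes 0 p)^4 := fun p hp => if_neg hp.ne'
  have key := integral_Ioi_of_hasDerivAt_of_tendsto (a := 0) (m := 0) (f := f)
    (f' := fun p => (-4) * (p^0 * (bes 1 p)^1 * (bes 0 p)^3))
    (by
      rw [← continuousWithinAt_Ioi_iff_Ici, ContinuousWithinAt, show f 0 = 1^4 by simp [hf]]
      refine (tendsto_bes_zero.pow 4).congr' ?_
      filter_upwards [self_mem_nhdsWithin] with p hp using (hfe p hp).symm)
    (fun p hp => by
      have hp' : (0:ℝ) < p := hp
      have h := (hasDerivAt_bes 0 hp').fun_pow 4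
      refine (h.congr_deriv ?_).congr_of_eventuallyEq ?_
      · simp; ring
      · filter_upwards [Ioi_mem_nhds hp'] with q hq using hfe q hq) i
    (by
      have := tendsto_besMom_atTop 0 4 0 (by omega)
      refine this.congr' ?_
      filter_upwards [eventually_gt_atTop 0] with p hp
      rw [hfe p hp]; simp)
  rw [integral_const_mul, show f 0 = 1 by simp [hf]] at key
  rw [besMom]
  linarith

lemma besMom_rec (n : ℕ) : ((n:ℝ)+1)^5 * besMom 4 0 n
    - 2 * (2 * ((n:ℝ)+1) + 1) * (5 * ((n:ℝ)+1)^2 + 5 * ((n:ℝ)+1) + 2) * besMom 4 0 (n+1)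
      + 64 * ((n:ℝ)+2) * besMom 4 0 (n+2) = 0 := by
  have a0 := fun s => besMom_ibp 4 0 s (by norm_num) (by norm_num)
  have a1 := fun s => besMom_ibp 3 1 s (by norm_num) (by norm_num)
  have a2 := fun s => besMom_ibp 2 2 s (by norm_num) (by norm_num)
  have a3 := fun s => besMom_ibp 1 3 s (by norm_num) (by norm_num)
  have a4 := fun s => besMom_ibp 0 4 s (by norm_num) (by norm_num)
  norm_num at a0 a1 a2 a3 a4
  have N10 : besMom 3 1 n = (n+1) * besMom 4 0 n / 4 := by linarith [a0 n]
  have N11 : besMom 3 1 (n+1) = (n+2) * besMom 4 0 (n+1) / 4 := by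
    have := a0 (n+1); push_cast at this; linarith
  have N12 : besMom 3 1 (n+2) = (n+3) * besMom 4 0 (n+2) / 4 := by
    have := a0 (n+2); push_cast at this; linarith
  have N20 : besMom 2 2 n = ((n+1) * besMom 3 1 n - besMom 4 0 (n+1)) / 3 := by linarith [a1 n]
  have N21 : besMom 2 2 (n+1) = ((n+2) * besMom 3 1 (n+1) - besMom 4 0 (n+2)) / 3 := by
    have := a1 (n+1); push_cast at this; linarith
  have N30 : besMom 1 3 n = ((n+1) * besMom 2 2 n - 2 * besMom 3 1 (n+1)) / 2 := by linarith [a2 n]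
  have N31 : besMom 1 3 (n+1) = ((n+2) * besMom 2 2 (n+1) - 2 * besMom 3 1 (n+2)) / 2 := by
    have := a2 (n+1); push_cast at this; linarith
  have N40 : besMom 0 4 n = (n+1) * besMom 1 3 n - 3 * besMom 2 2 (n+1) := by linarith [a3 n]
  have h := a4 n
  rw [N40, N30, N31, N20, N21, N10, N11, N12] at h
  linear_combination 24 * h

lemma besMom_init : 64 * besMom 4 0 1 - 4 * besMom 4 0 0 = -24 := by
  have a0 := fun s => besMom_ibp 4 0 s (by norm_num) (by norm_num)
  have a1 := besMom_ibp 3 1 0 (by norm_num) (by norm_num)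
  have a2 := besMom_ibp 2 2 0 (by norm_num) (by norm_num)
  have h0 := a0 0
  have h1 := a0 1
  norm_num at h0 h1 a1 a2
  have := besMom_one_three
  linarith

/-- Lebesgue measure on the positive half-line. -/
noncomputable abbrev posLeb : Measure ℝ := volume.restrict (Set.Ioi 0)

/-- The Laurent polynomial of the banana graph. -/
noncomputable def bananaP (p : ℝ × ℝ × ℝ) : ℝ :=
  (1 + p.1 + p.2.1 + p.2.2) * (1 + 1/p.1 + 1/p.2.1 + 1/p.2.2)

/-- The density of the multiplicative Haar measure. -/
noncomputable def bananaW (p : ℝ × ℝ × ℝ) : ℝ := 1 / (p.1 * p.2.1 * p.2.2)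

/-- `bes 1` as a lower integral. -/
noncomputable def besE (p : ℝ) : ENNReal := ∫⁻ u in Set.Ioi (0:ℝ), ENNReal.ofReal (exp (-u - p/u) / u)

lemma measurable_besE : Measurable besE :=
  Measurable.lintegral_prod_right' (f := fun q : ℝ × ℝ => ENNReal.ofReal (exp (-q.2 - q.1/q.2) / q.2))
    (by fun_prop)

lemma besE_eq {p : ℝ} (hp : 0 < p) : besE p = ENNReal.ofReal (bes 1 p) := by
  rw [bes, ofReal_integral_eq_lintegral_ofReal (integrableOn_bes 1 hp)]
  · simp only [pow_one, besE]
  · refine (ae_restrict_iff' measurableSet_Ioi).2 (Eventually.of_forall fun u hu => ?_)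
    have hu' : (0:ℝ) < u := hu
    simp only [Pi.zero_apply]
    positivity

lemma lintegral_besE_scaled {α β : ℝ} (hα : 0 < α) :
    ∫⁻ x in Set.Ioi (0:ℝ), ENNReal.ofReal (exp (-(α * x) - β / x) / x) = besE (α * β) := by
  rw [← lintegral_comp_mul_Ioi (inv_pos.2 hα), besE]
  refine setLIntegral_congr_fun measurableSet_Ioi fun u hu => ?_
  have hu' : (0:ℝ) < u := hu
  rw [← ENNReal.ofReal_mul (by positivity)]
  congr 1
  rw [show -(α * (α⁻¹ * u)) - β / (α⁻¹ * u) = -u - α * β / u by field_simp]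
  field_simp

lemma ae_pos : ∀ᵐ x ∂posLeb, 0 < x :=
  (ae_restrict_iff' measurableSet_Ioi).2 (Eventually.of_forall fun _ h => h)

lemma ae_pos_two : ∀ᵐ q ∂posLeb.prod posLeb, 0 < q.1 ∧ 0 < q.2 := by
  refine Measure.ae_prod_iff_ae_ae ?_ |>.2 ?_
  · exact (measurableSet_lt measurable_const measurable_fst).inter
      (measurableSet_lt measurable_const measurable_snd)
  · filter_upwards [ae_pos] with x hx
    filter_upwards [ae_pos] with y hy using ⟨hx, hy⟩

lemma ae_pos_three : ∀ᵐ p ∂posLeb.prod (posLeb.prod posLeb), 0 < p.1 ∧ 0 < p.2.1 ∧ 0 < p.2.2 := by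
  refine Measure.ae_prod_iff_ae_ae ?_ |>.2 ?_
  · exact (measurableSet_lt measurable_const measurable_fst).inter
      ((measurableSet_lt measurable_const (measurable_fst.comp measurable_snd)).inter
      (measurableSet_lt measurable_const (measurable_snd.comp measurable_snd)))
  · filter_upwards [ae_pos] with x hx
    filter_upwards [ae_pos_two] with y hy using ⟨hx, hy⟩

lemma sixteen_le_bananaP {p : ℝ × ℝ × ℝ} (h : 0 < p.1 ∧ 0 < p.2.1 ∧ 0 < p.2.2) : 16 ≤ bananaP p := by
  obtain ⟨x, y, z⟩ := p
  obtain ⟨hx, hy, hz⟩ := h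
  simp only at hx hy hz
  have key : ∀ a b : ℝ, 0 < a → 0 < b → 2 ≤ a/b + b/a := fun a b ha hb => by
    rw [div_add_div _ _ hb.ne' ha.ne', le_div_iff₀ (by positivity)]
    nlinarith [sq_nonneg (a - b)]
  have e : bananaP (x, y, z) = 4 + (x/1 + 1/x) + (y/1 + 1/y) + (z/1 + 1/z) + (x/y + y/x) + (x/z + z/x) + (y/z + z/y) := by
    simp only [bananaP]
    field_simp
    ring
  rw [e]
  linarith [key x 1 hx one_pos, key y 1 hy one_pos, key z 1 hz one_pos, key x y hx hy, key x z hx hz, key y z hy hz]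

lemma measurable_bananaP : Measurable bananaP := by unfold bananaP; fun_prop

lemma measurable_bananaW : Measurable bananaW := by unfold bananaW; fun_prop

lemma lintegral_bananaP_pow (n : ℕ) :
    ∫⁻ p, ENNReal.ofReal (bananaW p * ((bananaP p)^(n+1))⁻¹) ∂posLeb.prod (posLeb.prod posLeb) =
      ENNReal.ofReal (besMom 4 0 n / n.factorial^2) := by
  have hf : (0:ℝ) < n.factorial := by exact_mod_cast n.factorial_pos
  have e1 : ∫⁻ p, ENNReal.ofReal (bananaW p * ((bananaP p)^(n+1))⁻¹) ∂posLeb.prod (posLeb.prod posLeb) =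
      ∫⁻ p, ∫⁻ q, ENNReal.ofReal (1 / n.factorial^2) * (ENNReal.ofReal ((q.1 * q.2)^n * exp (-q.1 - q.2)) *
        (ENNReal.ofReal (exp (-(q.1 * p.1) - q.2 / p.1) / p.1) *
        (ENNReal.ofReal (exp (-(q.1 * p.2.1) - q.2 / p.2.1) / p.2.1) *
        ENNReal.ofReal (exp (-(q.1 * p.2.2) - q.2 / p.2.2) / p.2.2)))) ∂posLeb.prod posLeb
        ∂posLeb.prod (posLeb.prod posLeb) := by
    refine lintegral_congr_ae ?_
    filter_upwards [ae_pos_three] with p hp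
    obtain ⟨x, y, z⟩ := p
    obtain ⟨hx, hy, hz⟩ := hp
    simp only at hx hy hz ⊢
    have hA : 0 < 1 + x + y + z := by positivity
    have hB : 0 < 1 + 1/x + 1/y + 1/z := by positivity
    have h1 : ∫⁻ q, ENNReal.ofReal (1 / n.factorial^2 * (1 / (x * y * z))) *
        (ENNReal.ofReal (q.1^n * exp (-((1 + x + y + z) * q.1))) *
        ENNReal.ofReal (q.2^n * exp (-((1 + 1/x + 1/y + 1/z) * q.2)))) ∂posLeb.prod posLeb =
        ENNReal.ofReal (bananaW (x, y, z) * ((bananaP (x, y, z))^(n+1))⁻¹) := by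
      rw [lintegral_const_mul' _ _ ENNReal.ofReal_ne_top,
        lintegral_prod_mul (f := fun a => ENNReal.ofReal (a^n * exp (-((1 + x + y + z) * a))))
        (g := fun b => ENNReal.ofReal (b^n * exp (-((1 + 1/x + 1/y + 1/z) * b)))) (by fun_prop) (by fun_prop),
        lintegral_pow_mul_exp n hA, lintegral_pow_mul_exp n hB, ← ENNReal.ofReal_mul (by positivity),
        ← ENNReal.ofReal_mul (by positivity)]
      congr 1
      simp only [bananaW, bananaP]
      rw [mul_pow]
      field_simp
    rw [← h1]
    refine lintegral_congr_ae ?_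
    filter_upwards [ae_pos_two] with q hq
    obtain ⟨a, b⟩ := q
    obtain ⟨ha, hb⟩ := hq
    simp only at ha hb ⊢
    rw [← ENNReal.ofReal_mul (by positivity), ← ENNReal.ofReal_mul (by positivity),
      ← ENNReal.ofReal_mul (by positivity), ← ENNReal.ofReal_mul (by positivity),
      ← ENNReal.ofReal_mul (by positivity), ← ENNReal.ofReal_mul (by positivity)]
    congr 1
    have e : exp (-((1 + x + y + z) * a)) * exp (-((1 + 1/x + 1/y + 1/z) * b)) =
        exp (-a - b) * exp (-(a * x) - b / x) * exp (-(a * y) - b / y) * exp (-(a * z) - b / z) := by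
      rw [← exp_add, ← exp_add, ← exp_add, ← exp_add]
      congr 1
      ring
    calc _ = 1 / n.factorial^2 * (1 / (x * y * z)) * (a^n * b^n) *
          (exp (-((1 + x + y + z) * a)) * exp (-((1 + 1/x + 1/y + 1/z) * b))) := by ring
      _ = _ := by rw [e, mul_pow]; field_simp
  rw [e1, lintegral_lintegral_swap (by fun_prop)]
  have e2 : ∫⁻ q, ∫⁻ p, ENNReal.ofReal (1 / n.factorial^2) * (ENNReal.ofReal ((q.1 * q.2)^n * exp (-q.1 - q.2)) *
        (ENNReal.ofReal (exp (-(q.1 * p.1) - q.2 / p.1) / p.1) *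
        (ENNReal.ofReal (exp (-(q.1 * p.2.1) - q.2 / p.2.1) / p.2.1) *
        ENNReal.ofReal (exp (-(q.1 * p.2.2) - q.2 / p.2.2) / p.2.2)))) ∂posLeb.prod (posLeb.prod posLeb)
        ∂posLeb.prod posLeb = ∫⁻ q, ENNReal.ofReal (1 / n.factorial^2) *
          (ENNReal.ofReal ((q.1 * q.2)^n * exp (-q.1 - q.2)) * besE (q.1 * q.2)^3) ∂posLeb.prod posLeb := by
    refine lintegral_congr_ae ?_
    filter_upwards [ae_pos_two] with q hq
    obtain ⟨a, b⟩ := q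
    obtain ⟨ha, hb⟩ := hq
    simp only at ha hb ⊢
    set g : ℝ → ENNReal := fun x => ENNReal.ofReal (exp (-(a * x) - b / x) / x) with hg
    have hgm : AEMeasurable g posLeb := by fun_prop
    have hgi : ∫⁻ x, g x ∂posLeb = besE (a * b) := lintegral_besE_scaled ha
    rw [lintegral_const_mul' _ _ ENNReal.ofReal_ne_top, lintegral_const_mul' _ _ ENNReal.ofReal_ne_top,
      lintegral_prod_mul (f := g) (g := fun r : ℝ × ℝ => g r.1 * g r.2) hgm (by fun_prop),
      lintegral_prod_mul (f := g) (g := g) hgm hgm, hgi]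
    ring
  have hm := measurable_besE
  rw [e2, lintegral_const_mul' _ _ ENNReal.ofReal_ne_top, lintegral_prod _ (by fun_prop)]
  have e3 : ∀ a ∈ Set.Ioi (0:ℝ), ∫⁻ b in Set.Ioi (0:ℝ),
      ENNReal.ofReal ((a * b)^n * exp (-a - b)) * besE (a * b)^3 =
      ∫⁻ p in Set.Ioi (0:ℝ), ENNReal.ofReal (p^n) * besE p^3 * ENNReal.ofReal (exp (-a - p/a) / a) := fun a ha => by
    have ha' : (0:ℝ) < a := ha
    rw [← lintegral_comp_mul_Ioi (inv_pos.2 ha')]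
    refine setLIntegral_congr_fun measurableSet_Ioi fun p hp => ?_
    have hp' : (0:ℝ) < p := hp
    rw [show a * (a⁻¹ * p) = p by field_simp, mul_right_comm (ENNReal.ofReal (p^n)), ← mul_assoc,
      ← ENNReal.ofReal_mul (by positivity), ← ENNReal.ofReal_mul (by positivity)]
    congr 2
    rw [show a⁻¹ * p = p / a by ring]
    field_simp
  rw [setLIntegral_congr_fun measurableSet_Ioi e3, lintegral_lintegral_swap (by fun_prop)]
  have e4 : ∀ p ∈ Set.Ioi (0:ℝ), ∫⁻ a in Set.Ioi (0:ℝ),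
      ENNReal.ofReal (p^n) * besE p^3 * ENNReal.ofReal (exp (-a - p/a) / a) =
      ENNReal.ofReal (p^n * (bes 1 p)^4 * (bes 0 p)^0) := fun p hp => by
    have hp' : (0:ℝ) < p := hp
    have hk := bes_nonneg 1 p
    rw [lintegral_const_mul _ (by fun_prop), ← besE, besE_eq hp', pow_zero, mul_one,
      ENNReal.ofReal_mul (by positivity), ENNReal.ofReal_pow hk]
    ring
  rw [setLIntegral_congr_fun measurableSet_Ioi e4,
    ← ofReal_integral_eq_lintegral_ofReal (integrableOn_besMom 4 0 n (by norm_num) (by norm_num)),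
    ← ENNReal.ofReal_mul (by positivity)]
  · rw [besMom]
    congr 1
    ring
  · refine (ae_restrict_iff' measurableSet_Ioi).2 (Eventually.of_forall fun p hp => ?_)
    have hp' : (0:ℝ) < p := hp
    have hk := bes_nonneg 1 p
    have hl := bes_nonneg 0 p
    simp only [Pi.zero_apply]
    positivity

lemma besMom_nonneg (a b s : ℕ) : 0 ≤ besMom a b s :=
  setIntegral_nonneg measurableSet_Ioi fun p hp => by
    have hp' : (0:ℝ) < p := hp
    have hk := bes_nonneg 1 p
    have hl := bes_nonneg 0 p
    positivity

lemma integrand_nonneg (n : ℕ) :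
    0 ≤ᵐ[posLeb.prod (posLeb.prod posLeb)] fun p => bananaW p * ((bananaP p)^(n+1))⁻¹ := by
  filter_upwards [ae_pos_three] with p hp
  have h1 := sixteen_le_bananaP hp
  obtain ⟨hx, hy, hz⟩ := hp
  simp only [Pi.zero_apply, bananaW]
  positivity

lemma integral_bananaP_pow (n : ℕ) :
    ∫ p, bananaW p * ((bananaP p)^(n+1))⁻¹ ∂posLeb.prod (posLeb.prod posLeb) =
      besMom 4 0 n / n.factorial^2 := by
  have h1 := measurable_bananaP
  have h2 := measurable_bananaW
  have h3 := besMom_nonneg 4 0 n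
  rw [integral_eq_lintegral_of_nonneg_ae (integrand_nonneg n) (by fun_prop), lintegral_bananaP_pow,
    ENNReal.toReal_ofReal (by positivity)]

lemma integrable_bananaP :
    Integrable (fun p => bananaW p * (bananaP p)⁻¹) (posLeb.prod (posLeb.prod posLeb)) := by
  have h1 := measurable_bananaP
  have h2 := measurable_bananaW
  have h := lintegral_bananaP_pow 0
  have h0 := integrand_nonneg 0
  simp only [zero_add, pow_one] at h h0
  refine ⟨by fun_prop, ?_⟩
  rw [hasFiniteIntegral_iff_ofReal h0, h]
  exact ENNReal.ofReal_lt_top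

lemma besMom_zero : besMom 4 0 0 = 7 * zeta3 := by
  have h1 := measurable_bananaP
  have h2 := measurable_bananaW
  have h := lintegral_bananaP_pow 0
  rw [lintegral_prod _ (by fun_prop)] at h
  have e : ∫⁻ x, ∫⁻ r, ENNReal.ofReal (bananaW (x, r) * ((bananaP (x, r))^(0+1))⁻¹) ∂posLeb.prod posLeb ∂posLeb =
      ENNReal.ofReal (7 * zeta3) := by
    rw [← lintegral_banana_zero]
    refine lintegral_congr fun x => ?_
    rw [lintegral_prod _ (by fun_prop)]
    refine lintegral_congr fun y => lintegral_congr fun z => ?_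
    simp only [bananaW, bananaP]
    congr 1
    rw [zero_add, pow_one]
    ring
  rw [e, ENNReal.ofReal_eq_ofReal_iff (by have := zeta3_nonneg; positivity)
    (by have := besMom_nonneg 4 0 0; positivity)] at h
  rw [h]
  simp

/-- The derivatives of the banana integral. -/
noncomputable def bananaD (k : ℕ) (t : ℝ) : ℝ :=
  (resolvInt (posLeb.prod (posLeb.prod posLeb)) bananaP bananaW k t).re

lemma ofReal_bananaD (k : ℕ) (t : ℝ) :
    (bananaD k t : ℂ) = resolvInt (posLeb.prod (posLeb.prod posLeb)) bananaP bananaW k t := by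
  rw [bananaD, integral_resolv_ofReal, Complex.ofReal_re]

lemma ae_sixteen_le : ∀ᵐ p ∂posLeb.prod (posLeb.prod posLeb), 16 ≤ bananaP p := by
  filter_upwards [ae_pos_three] with p hp using sixteen_le_bananaP hp

lemma bananaD_zero (t : ℝ) : bananaD 0 t = bananaI t := by
  rw [bananaD, integral_resolv_ofReal, Complex.ofReal_re, bananaI, Measure.volume_eq_prod, Measure.volume_eq_prod,
    ← Measure.prod_restrict, ← Measure.prod_restrict]
  simp only [Nat.factorial_zero, Nat.cast_one, one_mul]
  refine integral_congr_ae (Eventually.of_forall fun p => ?_)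
  simp only [bananaW, bananaP]
  rw [zero_add, pow_one]
  ring

lemma hasDerivAt_bananaD (k : ℕ) {t : ℝ} (ht : t < 16) : HasDerivAt (bananaD k) (bananaD (k+1) t) t :=
  (hasDerivAt_resolvInt measurable_bananaP measurable_bananaW ae_sixteen_le integrable_bananaP k
    (t := t) (by simpa using ht)).real_of_complex

lemma bananaD_ode {t : ℝ} (ht : t < 16) :
    t^2*(t-4)*(t-16) * bananaD 3 t + 6*t*(t^2-15*t+32) * bananaD 2 t
      + (7*t^2-68*t+64) * bananaD 1 t + (t-4) * bananaD 0 t = -24 := by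
  have h := resolvInt_ode measurable_bananaP measurable_bananaW ae_sixteen_le integrable_bananaP
    integral_bananaP_pow (by simpa using besMom_init) (fun n => ?_) (t := t) (by simpa using ht)
  · rw [← ofReal_bananaD, ← ofReal_bananaD, ← ofReal_bananaD, ← ofReal_bananaD] at h
    exact_mod_cast h
  · have hf : (0:ℝ) < n.factorial := by exact_mod_cast n.factorial_pos
    have hr := besMom_rec n
    rw [show (n+2).factorial = (n+2)*((n+1)*n.factorial) by rw [Nat.factorial_succ, Nat.factorial_succ],
      show (n+1).factorial = (n+1)*n.factorial by rw [Nat.factorial_succ]]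
    push_cast
    have h1 : (n:ℝ) + 1 ≠ 0 := by positivity
    have h2 : (n:ℝ) + 2 ≠ 0 := by positivity
    field_simp
    linear_combination hr

lemma bananaI_tt {s : ℝ} (hs : 0 < s) : bananaI (tt s) = A2 s * GG s := by
  rw [← bananaD_zero]
  refine comp_tt_eq (fun t ht => hasDerivAt_bananaD 0 (by linarith))
    (fun t ht => hasDerivAt_bananaD 1 (by linarith)) (fun t ht => hasDerivAt_bananaD 2 (by linarith))
    (fun t ht => bananaD_ode (by linarith)) ?_ hs
  have h := (hasDerivAt_bananaD 0 (t := 0) (by norm_num)).continuousAt.tendsto.mono_left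
    (nhdsWithin_le_nhds (s := Set.Iio 0))
  convert! h using 2
  rw [bananaD, integral_resolv_ofReal, Complex.ofReal_re, ← besMom_zero]
  simp only [sub_zero]
  rw [integral_bananaP_pow]
  simp

end Banana

theorem stmt7 (y : ℝ) (hy : 0 < y) :
    (tHaupt (Complex.I * y)).im = 0 ∧ (tHaupt (Complex.I * y)).re < 0 ∧
    (bananaI ((tHaupt (Complex.I * y)).re) : ℂ) =
      varpi1 (Complex.I * y) *
        ((16 * zeta3
          + ∑' n : ℕ, ((psi (n+1) : ℝ) / ((n:ℝ)+1)^3) *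
              (Real.exp (-2*Real.pi*y))^(n+1) / (1 - (Real.exp (-2*Real.pi*y))^(n+1))
          + 32 * Real.pi^3 * y^3 : ℝ) : ℂ) := by
  have hs : 0 < Real.pi / (3 * y) := div_pos Real.pi_pos (by positivity)
  rw [Banana.tHaupt_eq hy, Complex.ofReal_im, Complex.ofReal_re]
  refine ⟨rfl, Banana.tt_neg hs, ?_⟩
  rw [Banana.bananaI_tt hs, Banana.varpi1_eq hy, Banana.period_sum_eq hy, ← Complex.ofReal_mul]
  congr 1
  field_simp
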